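/- Let h = 0 and β > β_c. If P is any g-function such that the Schonmann projection ν_{β,0}^+ is a g-measure consistent with P, then the variations of P are not summable: ∑_{k≥1} var_k(P) = ∞. -/

import Mathlib

open MeasureTheory Filter Topology ProbabilityTheory

noncomputable section

/-- Spin value of a Boolean spin: `true ↦ +1`, `false ↦ -1`. -/
def sval (b : Bool) : ℝ := if b then 1 else -1

/-- Two-dimensional spin configurations. -/
abbrev Cfg2 := ℤ × ℤ → Bool

/-- Two-sided sequences over an alphabet `A`. -/
abbrev ZSeq (A : Type*) := ℤ → A

/-- Pasts: index `k` corresponds to the coordinate `-(k+1)`. -/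
abbrev Past (A : Type*) := ℕ → A

/-- The four nearest neighbours of a site of `ℤ²`. -/
def nbrs (x : ℤ × ℤ) : Finset (ℤ × ℤ) :=
  {(x.1 + 1, x.2), (x.1 - 1, x.2), (x.1, x.2 + 1), (x.1, x.2 - 1)}

/-- Boltzmann weight
`exp(β[Σ_{{x,y}⊆Λ, x∼y} ω_x ω_y + Σ_{x∈Λ, y∉Λ, x∼y} ω_x σ_y] − h Σ_{x∈Λ} ω_x)`
(the sum over unordered pairs inside `Λ` is written as half the ordered sum). -/
def isingWeight (β h : ℝ) (Λ : Finset (ℤ × ℤ)) (σ ω : Cfg2) : ℝ :=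
  Real.exp (β * ((∑ x ∈ Λ, ∑ y ∈ Λ.filter (fun y => y ∈ nbrs x),
        sval (ω x) * sval (ω y)) / 2
      + ∑ x ∈ Λ, ∑ y ∈ (nbrs x).filter (fun y => y ∉ Λ), sval (ω x) * sval (σ y))
    - h * ∑ x ∈ Λ, sval (ω x))

/-- Fill in the values `τ` inside `Λ` and `σ` outside. -/
def fill (Λ : Finset (ℤ × ℤ)) (σ : Cfg2) (τ : ↥Λ → Bool) : Cfg2 :=
  fun x => if hx : x ∈ Λ then τ ⟨x, hx⟩ else σ x

/-- The finite-volume Ising measure in `Λ` with boundary condition `σ`, viewed as a measure on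
the full configuration space, the spins outside `Λ` being frozen to `σ`. -/
def isingFV (β h : ℝ) (Λ : Finset (ℤ × ℤ)) (σ : Cfg2) : Measure Cfg2 :=
  (∑ τ : ↥Λ → Bool, ENNReal.ofReal (isingWeight β h Λ σ (fill Λ σ τ)))⁻¹ •
    ∑ τ : ↥Λ → Bool,
      ENNReal.ofReal (isingWeight β h Λ σ (fill Λ σ τ)) • Measure.dirac (fill Λ σ τ)

/-- The box `[-n,n]²`. -/
def box (n : ℕ) : Finset (ℤ × ℤ) :=
  (Finset.Icc (-(n : ℤ)) (n : ℤ)) ×ˢ (Finset.Icc (-(n : ℤ)) (n : ℤ))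

/-- Convergence of a sequence of measures on a product space in the sense of convergence of the
measures of all finite-dimensional cylinder events; for probability measures on `{−1,+1}^ι`
this is exactly weak convergence. -/
def CylTendsto {ι A : Type*} [MeasurableSpace A] (μs : ℕ → Measure (ι → A))
    (μ : Measure (ι → A)) : Prop :=
  ∀ (s : Finset ι) (f : ι → A),
    Tendsto (fun n => μs n {η | ∀ i ∈ s, η i = f i}) atTop (𝓝 (μ {η | ∀ i ∈ s, η i = f i}))

/-- `μ` is the plus phase `μ_{β,h}^+`: the weak limit of the finite-volume Ising measures on
`[-n,n]²` with all-plus boundary conditions. -/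
def IsPlusPhase (β h : ℝ) (μ : Measure Cfg2) : Prop :=
  IsProbabilityMeasure μ ∧ CylTendsto (fun n => isingFV β h (box n) (fun _ => true)) μ

/-- `μ` is the minus phase `μ_{β,h}^-`. -/
def IsMinusPhase (β h : ℝ) (μ : Measure Cfg2) : Prop :=
  IsProbabilityMeasure μ ∧ CylTendsto (fun n => isingFV β h (box n) (fun _ => false)) μ

/-- The critical inverse temperature `β_c = ln(1+√2)/2`. -/
def betaCrit : ℝ := Real.log (1 + Real.sqrt 2) / 2

/-- Projection of a two-dimensional configuration onto the line `ℤ × {0}`. -/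
def lineProj (η : Cfg2) : ZSeq Bool := fun i => η (i, 0)

/-- The Schonmann projection of a measure on `{−1,+1}^{ℤ²}`. -/
def schonmann (μ : Measure Cfg2) : Measure (ZSeq Bool) := μ.map lineProj

/-- Restriction of a two-sided sequence to its strict past; index `k` is coordinate `-(k+1)`. -/
def restrictPast {A : Type*} (ω : ZSeq A) : Past A := fun k => ω (-(k + 1 : ℤ))

/-- The shift on two-sided sequences. -/
def shiftSeq {A : Type*} : ZSeq A → ZSeq A := fun ω i => ω (i + 1)

/-- The σ-algebra `ℱ_{<0}` generated by the coordinates of negative index. -/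
def pastSigma (A : Type*) [MeasurableSpace A] : MeasurableSpace (ZSeq A) :=
  MeasurableSpace.comap (fun ω : ZSeq A => restrictPast ω) inferInstance

/-- The σ-algebra generated by the coordinates in `S`. -/
def sigmaOn {ι A : Type*} [MeasurableSpace A] (S : Set ι) : MeasurableSpace (ι → A) :=
  MeasurableSpace.comap (fun ω : ι → A => S.restrict ω) inferInstance

/-- A g-function on the alphabet `A`: measurable, `[0,1]`-valued, normalized. -/
def IsGFunction {A : Type*} [Fintype A] [MeasurableSpace A] (P : A → Past A → ℝ) : Prop :=
  (∀ a, Measurable (P a)) ∧ ∀ ω, (∑ a : A, P a ω) = 1 ∧ ∀ a, P a ω ∈ Set.Icc (0 : ℝ) 1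

/-- `μ` is a translation-invariant g-measure consistent with the g-function `P`: for each `a`,
`ω ↦ P a (restrictPast ω)` is a version of the conditional probability `μ(X₀ = a | ℱ_{<0})`. -/
def IsGMeasure {A : Type*} [MeasurableSpace A] (μ : Measure (ZSeq A))
    (P : A → Past A → ℝ) : Prop :=
  IsProbabilityMeasure μ ∧ μ.map shiftSeq = μ ∧
    ∀ a : A, (fun ω => P a (restrictPast ω))
      =ᵐ[μ] μ[Set.indicator {ω : ZSeq A | ω 0 = a} (fun _ => (1 : ℝ)) | pastSigma A]

/-- The `k`-th variation of a g-function: the supremum of `|P a ω − P a σ|` over pasts agreeing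
on the coordinates `−k,…,−1`. -/
def varG {A : Type*} (P : A → Past A → ℝ) (k : ℕ) : ℝ :=
  sSup {d : ℝ | ∃ (a : A) (ω σ' : Past A), (∀ j < k, ω j = σ' j) ∧ d = |P a ω - P a σ'|}

/-- Elementary conditional probability `μ(B | A)`, as a real number. -/
def condProbR {X : Type*} [MeasurableSpace X] (μ : Measure X) (B A : Set X) : ℝ :=
  ((μ[|A]) B).toReal

/-- The event that `η_i = ω` (suitably reindexed) for `−n ≤ i ≤ −1` and `η_i = b`
for `−(n+l) ≤ i ≤ −(n+1)`. -/
def pastEvt (n l : ℕ) (b : Bool) (ω : Past Bool) : Set (ZSeq Bool) :=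
  {η | (∀ i : ℤ, -(n : ℤ) ≤ i → i ≤ -1 → η i = ω (i.natAbs - 1)) ∧
       (∀ i : ℤ, -((n : ℤ) + l) ≤ i → i ≤ -((n : ℤ) + 1) → η i = b)}

/-- The event that `η_i = b` for `−(n+l) ≤ i ≤ −n`. -/
def blockEvt (n l : ℕ) (b : Bool) : Set (ZSeq Bool) :=
  {η | ∀ i : ℤ, -((n : ℤ) + l) ≤ i → i ≤ -(n : ℤ) → η i = b}

/-- The event that `η_i = b` for `−n ≤ i ≤ −1`. -/
def allBlock (n : ℕ) (b : Bool) : Set (ZSeq Bool) :=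
  {η | ∀ i : ℤ, -(n : ℤ) ≤ i → i ≤ -1 → η i = b}

/-- `P` is the g-function `P^{+,b}` obtained from `ν` by conditioning on the symbol `b`
in the far past: `P(a|ω) = lim_n lim_l ν(η₀ = a | η = b on [−(n+l),−(n+1)], η = ω on [−n,−1])`,
both iterated limits being required to exist. -/
def IsCondG (ν : Measure (ZSeq Bool)) (b : Bool) (P : Bool → Past Bool → ℝ) : Prop :=
  ∀ (a : Bool) (ω : Past Bool), ∃ L : ℕ → ℝ,
    (∀ n, Tendsto (fun l => condProbR ν {η | η 0 = a} (pastEvt n l b ω)) atTop (𝓝 (L n))) ∧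
    Tendsto L atTop (𝓝 (P a ω))

/-- `ν'` is the iterated weak limit `lim_n lim_l ν( · | η = b on [−(n+l),−n])`. -/
def IsCondLimitMeasure (ν : Measure (ZSeq Bool)) (b : Bool) (ν' : Measure (ZSeq Bool)) : Prop :=
  ∃ νseq : ℕ → Measure (ZSeq Bool),
    (∀ n, CylTendsto (fun l => ν[|blockEvt n l b]) (νseq n)) ∧ CylTendsto νseq ν'

/-- Stochastic domination: `ν ≤ μ` iff `ν B ≤ μ B` for every increasing measurable event `B`. -/
def StochDom {A : Type*} [MeasurableSpace A] [Preorder A]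
    (ν μ : Measure (ZSeq A)) : Prop :=
  ∀ B : Set (ZSeq A), MeasurableSet B → (∀ ⦃x y : ZSeq A⦄, x ≤ y → x ∈ B → y ∈ B) → ν B ≤ μ B

/-- `π` is the i.i.d. product measure with `π(η_i = +1) = ρ` for each coordinate. -/
def IsBernoulliProd (ρ : ℝ) (π : Measure (ZSeq Bool)) : Prop :=
  IsProbabilityMeasure π ∧ ∀ (s : Finset ℤ) (f : ℤ → Bool),
    π {η | ∀ i ∈ s, η i = f i} = ∏ i ∈ s, ENNReal.ofReal (if f i then ρ else 1 - ρ)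

/-- Splicing of pasts: coordinates `−k,…,−1` (indices `< k`) from `ω`, the rest from `σ`. -/
def splice {A : Type*} (σ ω : Past A) (k : ℕ) : Past A := fun j => if j < k then ω j else σ j

/-- `ν'` is an extreme point of the convex set of g-measures consistent with `P`. -/
def ExtremeGMeasure (ν' : Measure (ZSeq Bool)) (P : Bool → Past Bool → ℝ) : Prop :=
  IsGMeasure ν' P ∧
  ∀ ν₁ ν₂ : Measure (ZSeq Bool), IsGMeasure ν₁ P → IsGMeasure ν₂ P →
    ∀ t : ℝ, t ∈ Set.Ioo (0 : ℝ) 1 →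
      ν' = ENNReal.ofReal t • ν₁ + ENNReal.ofReal (1 - t) • ν₂ → ν₁ = ν' ∧ ν₂ = ν'

/-- The event that the spins on the line are `−1` on `{−m,…,−n} × {0}`. -/
def lineMinusEvt (n m : ℕ) : Set Cfg2 :=
  {η | ∀ i : ℤ, -(m : ℤ) ≤ i → i ≤ -(n : ℤ) → η (i, 0) = false}

/-- Nearest-neighbour adjacency in `ℤ²` (`‖x−y‖₁ = 1`). -/
def adj2 (x y : ℤ × ℤ) : Prop := (x.1 - y.1).natAbs + (x.2 - y.2).natAbs = 1

/-- The event `A_n`: there is an infinite nearest-neighbour path of `+1` spins starting at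
`(n,0)` entirely contained in the half-plane `{x ≤ n}`. -/
def plusPathEvt (n : ℕ) : Set Cfg2 :=
  {η | ∃ γ : ℕ → ℤ × ℤ, γ 0 = ((n : ℤ), 0) ∧ (∀ j, adj2 (γ j) (γ (j + 1))) ∧
    Function.Injective γ ∧ (∀ j, (γ j).1 ≤ (n : ℤ)) ∧ ∀ j, η (γ j) = true}

/-- The block map for the decimation `ν_{l,k}`: the `j`-th letter consists of the spins on
`[j(k+l), j(k+l)+l−1]`. -/
def blockMap (l k : ℕ) (η : ZSeq Bool) : ZSeq (Fin l → Bool) :=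
  fun j r => η (j * ((k : ℤ) + l) + r)

end

section Gibbs

variable {V : Type*}

lemma finite_confs (Λ : Finset V) (η : V → Bool) :
    {σ : V → Bool | ∀ x, x ∉ Λ → σ x = η x}.Finite := by
  classical
  have : {σ : V → Bool | ∀ x, x ∉ Λ → σ x = η x} ⊆
      Set.range (fun (τ : ↥Λ → Bool) (x : V) => if hx : x ∈ Λ then τ ⟨x, hx⟩ else η x) := by
    intro σ hσ
    refine ⟨fun x => σ x, ?_⟩
    funext x
    by_cases hx : x ∈ Λ
    · simp [hx]
    · simp [hx, hσ x hx]
  exact (Set.finite_range _).subset this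

/-- Configurations agreeing with `η` outside `Λ`. -/
noncomputable def confs (Λ : Finset V) (η : V → Bool) : Finset (V → Bool) :=
  (finite_confs Λ η).toFinset

lemma mem_confs {Λ : Finset V} {η σ : V → Bool} :
    σ ∈ confs Λ η ↔ ∀ x, x ∉ Λ → σ x = η x := by
  simp [confs]

lemma self_mem_confs (Λ : Finset V) (η : V → Bool) : η ∈ confs Λ η :=
  mem_confs.2 fun _ _ => rfl

lemma confs_nonempty (Λ : Finset V) (η : V → Bool) : (confs Λ η).Nonempty :=
  ⟨η, self_mem_confs Λ η⟩

lemma sum_confs_union [DecidableEq V] {A B : Finset V} (hAB : Disjoint A B) (η : V → Bool)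
    {M : Type*} [AddCommMonoid M] (F : (V → Bool) → M) :
    ∑ σ ∈ confs (A ∪ B) η, F σ = ∑ ζ ∈ confs A η, ∑ σ ∈ confs B ζ, F σ := by
  classical
  rw [← Finset.sum_fiberwise_of_maps_to (s := confs (A ∪ B) η) (t := confs A η)
    (g := fun σ => A.piecewise σ η)]
  · refine Finset.sum_congr rfl fun ζ hζ => Finset.sum_congr ?_ fun _ _ => rfl
    ext σ
    rw [mem_confs] at hζ
    simp only [Finset.mem_filter, mem_confs, Finset.mem_union, not_or]
    constructor
    · rintro ⟨h1, h2⟩ x hx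
      rw [← h2]
      by_cases hA : x ∈ A
      · simp [hA]
      · simp [hA, h1 x ⟨hA, hx⟩]
    · intro h
      refine ⟨fun x hx => by rw [h x hx.2, hζ x hx.1], ?_⟩
      funext x
      by_cases hA : x ∈ A
      · simp [hA, h x (Finset.disjoint_left.1 hAB hA)]
      · simp [hA, hζ x hA]
  · intro σ _
    rw [mem_confs]
    intro x hx
    simp [hx]

open Classical in
lemma confs_singleton (v : V) (η : V → Bool) :
    confs {v} η = {Function.update η v true, Function.update η v false} := by
  ext σ
  simp only [mem_confs, Finset.mem_singleton, Finset.mem_insert]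
  constructor
  · intro h
    cases hv : σ v
    · right
      funext x
      by_cases hx : x = v
      · subst hx; simp [hv]
      · simp [hx, h x hx]
    · left
      funext x
      by_cases hx : x = v
      · subst hx; simp [hv]
      · simp [hx, h x hx]
  · rintro (rfl | rfl) x hx <;> simp [hx]

lemma update_true_ne_false [DecidableEq V] (v : V) (η : V → Bool) :
    Function.update η v true ≠ Function.update η v false := by
  intro h
  have := congrFun h v
  simp at this

lemma sum_confs_erase [DecidableEq V] {Λ : Finset V} {v : V} (hv : v ∈ Λ) (η : V → Bool)
    {M : Type*} [AddCommMonoid M] (F : (V → Bool) → M) :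
    ∑ σ ∈ confs Λ η, F σ = ∑ σ ∈ confs (Λ.erase v) (Function.update η v true), F σ
      + ∑ σ ∈ confs (Λ.erase v) (Function.update η v false), F σ := by
  classical
  have h : Λ = {v} ∪ Λ.erase v := by
    ext x; by_cases hx : x = v <;> simp [hx, hv]
  conv_lhs => rw [h]
  rw [sum_confs_union (by simp), confs_singleton]
  convert Finset.sum_pair (update_true_ne_false v η)

open Classical in
lemma filter_confs_eq {Λ T : Finset V} (hT : T ⊆ Λ) (η ζ : V → Bool) :
    (confs Λ η).filter (fun σ => ∀ x ∈ T, σ x = ζ x) = confs (Λ \ T) (T.piecewise ζ η) := by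
  ext σ
  simp only [Finset.mem_filter, mem_confs, Finset.mem_sdiff, not_and, not_not]
  constructor
  · rintro ⟨h1, h2⟩ x hx
    by_cases hxT : x ∈ T
    · simp [hxT, h2 x hxT]
    · have : x ∉ Λ := fun h => hxT (hx h)
      simp [hxT, h1 x this]
  · intro h
    constructor
    · intro x hx
      rw [h x fun h' => absurd h' hx]
      have : x ∉ T := fun h' => hx (hT h')
      simp [this]
    · intro x hx
      rw [h x fun _ => hx]
      simp [hx]

/-- Ising interaction over a finite set of (ordered) pairs. -/
def energy (E : Finset (V × V)) (σ : V → Bool) : ℝ := ∑ p ∈ E, sval (σ p.1) * sval (σ p.2)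

/-- Boltzmann weight. -/
noncomputable def wt (κ : ℝ) (E : Finset (V × V)) (σ : V → Bool) : ℝ :=
  Real.exp (κ * energy E σ)

/-- Unnormalized expectation in `Λ` with boundary condition `η`. -/
noncomputable def zf (κ : ℝ) (E : Finset (V × V)) (Λ : Finset V) (η : V → Bool)
    (f : (V → Bool) → ℝ) : ℝ :=
  ∑ σ ∈ confs Λ η, wt κ E σ * f σ

/-- Finite-volume expectation in `Λ` with boundary condition `η`. -/
noncomputable def av (κ : ℝ) (E : Finset (V × V)) (Λ : Finset V) (η : V → Bool)
    (f : (V → Bool) → ℝ) : ℝ :=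
  zf κ E Λ η f / zf κ E Λ η (fun _ => 1)

lemma wt_pos (κ : ℝ) (E : Finset (V × V)) (σ : V → Bool) : 0 < wt κ E σ := Real.exp_pos _

lemma zf_pos {κ : ℝ} {E : Finset (V × V)} {Λ : Finset V} {η : V → Bool} {f : (V → Bool) → ℝ}
    (hf : ∀ σ, 0 < f σ) : 0 < zf κ E Λ η f :=
  Finset.sum_pos (fun σ _ => mul_pos (wt_pos κ E σ) (hf σ)) (confs_nonempty Λ η)

lemma zf_one_pos {κ : ℝ} {E : Finset (V × V)} {Λ : Finset V} {η : V → Bool} :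
    0 < zf κ E Λ η (fun _ => 1) := zf_pos fun _ => one_pos

section
variable {κ : ℝ} {E : Finset (V × V)} {Λ : Finset V} {η : V → Bool}

lemma zf_add (f g : (V → Bool) → ℝ) :
    zf κ E Λ η (fun σ => f σ + g σ) = zf κ E Λ η f + zf κ E Λ η g := by
  simp [zf, mul_add, Finset.sum_add_distrib]

lemma zf_sub (f g : (V → Bool) → ℝ) :
    zf κ E Λ η (fun σ => f σ - g σ) = zf κ E Λ η f - zf κ E Λ η g := by
  simp [zf, mul_sub, Finset.sum_sub_distrib]

lemma zf_const_mul (c : ℝ) (f : (V → Bool) → ℝ) :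
    zf κ E Λ η (fun σ => c * f σ) = c * zf κ E Λ η f := by
  simp only [zf, Finset.mul_sum]
  exact Finset.sum_congr rfl fun _ _ => by ring

lemma zf_sum {ι : Type*} (s : Finset ι) (f : ι → (V → Bool) → ℝ) :
    zf κ E Λ η (fun σ => ∑ i ∈ s, f i σ) = ∑ i ∈ s, zf κ E Λ η (f i) := by
  simp only [zf, Finset.mul_sum]
  exact Finset.sum_comm

lemma zf_mono {f g : (V → Bool) → ℝ} (h : ∀ σ ∈ confs Λ η, f σ ≤ g σ) :
    zf κ E Λ η f ≤ zf κ E Λ η g :=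
  Finset.sum_le_sum fun σ hσ => mul_le_mul_of_nonneg_left (h σ hσ) (wt_pos κ E σ).le

lemma zf_congr {f g : (V → Bool) → ℝ} (h : ∀ σ ∈ confs Λ η, f σ = g σ) :
    zf κ E Λ η f = zf κ E Λ η g :=
  Finset.sum_congr rfl fun σ hσ => by rw [h σ hσ]

lemma av_add (f g : (V → Bool) → ℝ) :
    av κ E Λ η (fun σ => f σ + g σ) = av κ E Λ η f + av κ E Λ η g := by
  simp [av, zf_add, add_div]

lemma av_sub (f g : (V → Bool) → ℝ) :
    av κ E Λ η (fun σ => f σ - g σ) = av κ E Λ η f - av κ E Λ η g := by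
  simp [av, zf_sub, sub_div]

lemma av_const_mul (c : ℝ) (f : (V → Bool) → ℝ) :
    av κ E Λ η (fun σ => c * f σ) = c * av κ E Λ η f := by
  simp [av, zf_const_mul, mul_div_assoc]

lemma av_sum {ι : Type*} (s : Finset ι) (f : ι → (V → Bool) → ℝ) :
    av κ E Λ η (fun σ => ∑ i ∈ s, f i σ) = ∑ i ∈ s, av κ E Λ η (f i) := by
  simp only [av, zf_sum, Finset.sum_div]

lemma av_mono {f g : (V → Bool) → ℝ} (h : ∀ σ ∈ confs Λ η, f σ ≤ g σ) :
    av κ E Λ η f ≤ av κ E Λ η g :=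
  div_le_div_of_nonneg_right (zf_mono h) zf_one_pos.le

lemma av_congr {f g : (V → Bool) → ℝ} (h : ∀ σ ∈ confs Λ η, f σ = g σ) :
    av κ E Λ η f = av κ E Λ η g := by
  rw [av, zf_congr h, ← av]

lemma av_const (c : ℝ) : av κ E Λ η (fun _ => c) = c := by
  have := av_const_mul (κ := κ) (E := E) (Λ := Λ) (η := η) c (fun _ => 1)
  simp only [mul_one] at this
  rw [this, av, div_self zf_one_pos.ne', mul_one]

lemma av_nonneg {f : (V → Bool) → ℝ} (h : ∀ σ ∈ confs Λ η, 0 ≤ f σ) : 0 ≤ av κ E Λ η f := by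
  have := av_mono (κ := κ) (E := E) h
  rwa [av_const] at this

end

lemma sval_mul_sval_le (a b c d : Bool) :
    sval a * sval b + sval c * sval d ≤
      sval (a ⊓ c) * sval (b ⊓ d) + sval (a ⊔ c) * sval (b ⊔ d) := by
  cases a <;> cases b <;> cases c <;> cases d <;> norm_num [sval]

lemma wt_mul_le {κ : ℝ} (hκ : 0 ≤ κ) (E : Finset (V × V)) (σ σ' : V → Bool) :
    wt κ E σ * wt κ E σ' ≤ wt κ E (σ ⊓ σ') * wt κ E (σ ⊔ σ') := by
  rw [wt, wt, wt, wt, ← Real.exp_add, ← Real.exp_add, Real.exp_le_exp, ← mul_add, ← mul_add]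
  refine mul_le_mul_of_nonneg_left ?_ hκ
  rw [energy, energy, energy, energy, ← Finset.sum_add_distrib, ← Finset.sum_add_distrib]
  exact Finset.sum_le_sum fun p _ => sval_mul_sval_le _ _ _ _

/-- Comparison of boundary conditions: `(Λ, η)` lies below `(Λ', η')`. -/
def BdLe (Λ : Finset V) (η : V → Bool) (Λ' : Finset V) (η' : V → Bool) : Prop :=
  (∀ x, x ∉ Λ → η x = true → x ∉ Λ' ∧ η' x = true) ∧
    (∀ x, x ∉ Λ' → η' x = false → x ∉ Λ ∧ η x = false)

/-- Monotonicity in the boundary condition for non-negative increasing functions. -/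
lemma zf_mul_zf_le {κ : ℝ} (hκ : 0 ≤ κ) (E : Finset (V × V)) {Λ Λ' : Finset V}
    {η η' : V → Bool} (hle : BdLe Λ η Λ' η') {f : (V → Bool) → ℝ} (hf : Monotone f)
    (hf0 : ∀ σ, 0 ≤ f σ) :
    zf κ E Λ η f * zf κ E Λ' η' (fun _ => 1) ≤ zf κ E Λ η (fun _ => 1) * zf κ E Λ' η' f := by
  classical
  have h := four_functions_theorem (fun σ => wt κ E σ * f σ) (fun σ => wt κ E σ)
    (fun σ => wt κ E σ) (fun σ => wt κ E σ * f σ)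
    (fun σ => mul_nonneg (wt_pos κ E σ).le (hf0 σ)) (fun σ => (wt_pos κ E σ).le)
    (fun σ => (wt_pos κ E σ).le) (fun σ => mul_nonneg (wt_pos κ E σ).le (hf0 σ))
    (fun a b => by
      calc wt κ E a * f a * wt κ E b = wt κ E a * wt κ E b * f a := by ring
        _ ≤ wt κ E (a ⊓ b) * wt κ E (a ⊔ b) * f (a ⊔ b) :=
          mul_le_mul (wt_mul_le hκ E a b) (hf le_sup_left) (hf0 _)
            (mul_pos (wt_pos ..) (wt_pos ..)).le
        _ = _ := by ring) (confs Λ η) (confs Λ' η')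
  simp only [zf, mul_one]
  refine h.trans (mul_le_mul ?_ ?_ ?_ ?_)
  · refine Finset.sum_le_sum_of_subset_of_nonneg ?_ fun σ _ _ => (wt_pos κ E σ).le
    intro σ hσ
    obtain ⟨a, ha, b, hb, rfl⟩ := Finset.mem_infs.1 hσ
    rw [mem_confs] at *
    intro x hx
    rw [Pi.inf_apply, ha x hx]
    cases h1 : η x
    · simp
    · obtain ⟨h2, h3⟩ := hle.1 x hx h1
      rw [hb x h2, h3]; rfl
  · refine Finset.sum_le_sum_of_subset_of_nonneg ?_
      fun σ _ _ => mul_nonneg (wt_pos κ E σ).le (hf0 σ)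
    intro σ hσ
    obtain ⟨a, ha, b, hb, rfl⟩ := Finset.mem_sups.1 hσ
    rw [mem_confs] at *
    intro x hx
    rw [Pi.sup_apply, hb x hx]
    cases h1 : η' x
    · obtain ⟨h2, h3⟩ := hle.2 x hx h1
      rw [ha x h2, h3]; rfl
    · simp
  · exact Finset.sum_nonneg fun σ _ => mul_nonneg (wt_pos κ E σ).le (hf0 σ)
  · exact Finset.sum_nonneg fun σ _ => (wt_pos κ E σ).le

lemma av_le_av {κ : ℝ} (hκ : 0 ≤ κ) (E : Finset (V × V)) {Λ Λ' : Finset V}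
    {η η' : V → Bool} (hle : BdLe Λ η Λ' η') {f : (V → Bool) → ℝ} (hf : Monotone f) :
    av κ E Λ η f ≤ av κ E Λ' η' f := by
  classical
  obtain ⟨C, hC⟩ : ∃ C : ℝ, ∀ σ ∈ confs Λ η ∪ confs Λ' η', 0 ≤ f σ + C := by
    refine ⟨∑ σ ∈ confs Λ η ∪ confs Λ' η', |f σ|, fun σ hσ => ?_⟩
    have := Finset.single_le_sum (f := fun σ => |f σ|) (fun _ _ => abs_nonneg _) hσ
    linarith [neg_abs_le (f σ)]
  set g : (V → Bool) → ℝ := fun σ => max (f σ + C) 0 with hg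
  have hgm : Monotone g := fun a b hab =>
    max_le_max (add_le_add_left (hf hab) C) le_rfl
  have h := zf_mul_zf_le hκ E hle hgm fun σ => le_max_right _ _
  have h1 : av κ E Λ η g ≤ av κ E Λ' η' g := by
    rw [av, av, div_le_div_iff₀ zf_one_pos zf_one_pos]
    linarith
  have h2 : av κ E Λ η g = av κ E Λ η f + C := by
    rw [← av_const (κ := κ) (E := E) (Λ := Λ) (η := η) C, ← av_add]
    exact av_congr fun σ hσ => max_eq_left (hC σ (Finset.mem_union_left _ hσ))
  have h3 : av κ E Λ' η' g = av κ E Λ' η' f + C := by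
    rw [← av_const (κ := κ) (E := E) (Λ := Λ') (η := η') C, ← av_add]
    exact av_congr fun σ hσ => max_eq_left (hC σ (Finset.mem_union_right _ hσ))
  linarith

end Gibbs

section Positivity

variable {ι I X : Type*} [Fintype ι] [DecidableEq ι] [Fintype I] [Fintype X]

/-- Functions with non-negative correlations with all monomials in the generators `u`. -/
def PosCone (u : I → X → ℝ) (F : (ι → X) → ℝ) : Prop :=
  ∀ m : ι → I → ℕ, 0 ≤ ∑ ξ : ι → X, F ξ * ∏ x, ∏ i, u i (ξ x) ^ m x i

/-- Functions whose multiplication preserves `PosCone`. -/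
def PosMul (u : I → X → ℝ) (g : (ι → X) → ℝ) : Prop :=
  ∀ F, PosCone u F → PosCone u (fun ξ => g ξ * F ξ)

variable {u : I → X → ℝ}

lemma posCone_one (hu : ∀ n : I → ℕ, 0 ≤ ∑ a, ∏ i, u i a ^ n i) :
    PosCone u (fun _ : ι → X => 1) := by
  intro m
  have h := Finset.prod_univ_sum (fun _ : ι => (Finset.univ : Finset X))
    (fun x a => ∏ i, u i a ^ m x i)
  rw [Fintype.piFinset_univ] at h
  simp only [one_mul]
  rw [← h]
  exact Finset.prod_nonneg fun x _ => hu _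

lemma PosMul.sum_nonneg (hu : ∀ n : I → ℕ, 0 ≤ ∑ a, ∏ i, u i a ^ n i) {g : (ι → X) → ℝ}
    (hg : PosMul u g) : 0 ≤ ∑ ξ, g ξ := by
  have := hg _ (posCone_one hu) (fun _ _ => 0)
  simpa using this

lemma PosCone.add {F G : (ι → X) → ℝ} (hF : PosCone u F) (hG : PosCone u G) :
    PosCone u (fun ξ => F ξ + G ξ) := by
  intro m
  simp only [add_mul, Finset.sum_add_distrib]
  exact add_nonneg (hF m) (hG m)

lemma PosCone.const_mul {F : (ι → X) → ℝ} (hF : PosCone u F) {c : ℝ} (hc : 0 ≤ c) :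
    PosCone u (fun ξ => c * F ξ) := by
  intro m
  simp only [mul_assoc, ← Finset.mul_sum]
  exact mul_nonneg hc (hF m)

lemma PosMul.add {f g : (ι → X) → ℝ} (hf : PosMul u f) (hg : PosMul u g) :
    PosMul u (fun ξ => f ξ + g ξ) := by
  intro F hF
  simp only [add_mul]
  exact (hf F hF).add (hg F hF)

lemma PosMul.mul {f g : (ι → X) → ℝ} (hf : PosMul u f) (hg : PosMul u g) :
    PosMul u (fun ξ => f ξ * g ξ) := by
  intro F hF
  simp only [mul_assoc]
  exact hf _ (hg F hF)

lemma posMul_const {c : ℝ} (hc : 0 ≤ c) : PosMul u (fun _ : ι → X => c) :=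
  fun _ hF => hF.const_mul hc

lemma PosMul.sum {κ : Type*} (s : Finset κ) {f : κ → (ι → X) → ℝ}
    (hf : ∀ k ∈ s, PosMul u (f k)) : PosMul u (fun ξ => ∑ k ∈ s, f k ξ) := by
  classical
  induction s using Finset.induction_on with
  | empty => simpa using posMul_const (u := u) (ι := ι) le_rfl
  | insert a s ha ih =>
    simp only [Finset.sum_insert ha]
    exact (hf a (by simp)).add (ih fun k hk => hf k (by simp [hk]))

lemma PosMul.pow {f : (ι → X) → ℝ} (hf : PosMul u f) (n : ℕ) :
    PosMul u (fun ξ => f ξ ^ n) := by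
  induction n with
  | zero => simpa using posMul_const (u := u) (ι := ι) zero_le_one
  | succ n ih => simpa only [pow_succ] using ih.mul hf

lemma PosMul.exp {f : (ι → X) → ℝ} (hf : PosMul u f) :
    PosMul u (fun ξ => Real.exp (f ξ)) := by
  intro F hF m
  have h1 : ∀ n : ℕ, PosMul u (fun ξ => (1 + f ξ / n) ^ n) := fun n => by
    refine ((posMul_const zero_le_one).add ?_).pow n
    simpa only [div_eq_mul_inv] using hf.mul (posMul_const (c := (n : ℝ)⁻¹) (by positivity))
  refine ge_of_tendsto' (f := fun n : ℕ =>
    ∑ ξ : ι → X, ((1 + f ξ / n) ^ n * F ξ) * ∏ x, ∏ i, u i (ξ x) ^ m x i) (x := atTop) ?_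
    (fun n => h1 n F hF m)
  exact tendsto_finsetSum _ fun ξ _ =>
    ((Real.tendsto_one_add_div_pow_exp (f ξ)).mul_const _).mul_const _

lemma posMul_gen [DecidableEq I] (x : ι) (i : I) :
    PosMul u (fun ξ : ι → X => u i (ξ x)) := by
  intro F hF m
  have h := hF (fun y j => m y j + if y = x ∧ j = i then 1 else 0)
  refine h.trans_eq (Finset.sum_congr rfl fun ξ _ => ?_)
  have : ∏ y, ∏ j, u j (ξ y) ^ (m y j + if y = x ∧ j = i then 1 else 0) =
      u i (ξ x) * ∏ y, ∏ j, u j (ξ y) ^ m y j := by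
    simp only [pow_add, Finset.prod_mul_distrib]
    rw [mul_comm]
    congr 1
    rw [Finset.prod_eq_single x, Finset.prod_eq_single i]
    · simp
    · intro j _ hj; simp [hj]
    · simp
    · intro y _ hy; simp [hy]
    · simp
  rw [this]
  ring

end Positivity

section Replicas

/-- Extension of a configuration in `Λ` by a boundary condition. -/
def ext2 {V : Type*} [DecidableEq V] (Λ : Finset V) (η : V → Bool) (τ : ↥Λ → Bool) : V → Bool :=
  fun x => if hx : x ∈ Λ then τ ⟨x, hx⟩ else η x

lemma sum_confs_eq {V : Type*} [DecidableEq V] (Λ : Finset V) (η : V → Bool)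
    {M : Type*} [AddCommMonoid M] (F : (V → Bool) → M) :
    ∑ σ ∈ confs Λ η, F σ = ∑ τ : ↥Λ → Bool, F (ext2 Λ η τ) := by
  refine Finset.sum_bij' (fun σ _ => fun x => σ x) (fun τ _ => ext2 Λ η τ) ?_ ?_ ?_ ?_ ?_
  · simp
  · intro τ _
    rw [mem_confs]
    intro x hx
    simp [ext2, hx]
  · intro σ hσ
    rw [mem_confs] at hσ
    funext x
    by_cases hx : x ∈ Λ
    · simp [ext2, hx]
    · simp [ext2, hx, hσ x hx]
  · intro τ _
    funext x
    simp [ext2]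
  · intro σ hσ
    rw [mem_confs] at hσ
    congr 1
    funext x
    by_cases hx : x ∈ Λ
    · simp [ext2, hx]
    · simp [ext2, hx, hσ x hx]

lemma sum_prod_arrow {ι X Y : Type*} [Fintype ι] [DecidableEq ι] [Fintype X] [Fintype Y]
    (F : (ι → X) → (ι → Y) → ℝ) :
    ∑ a, ∑ b, F a b = ∑ c : ι → X × Y, F (fun i => (c i).1) (fun i => (c i).2) := by
  rw [← Fintype.sum_prod_type']
  exact (Fintype.sum_equiv (Equiv.arrowProdEquivProdArrow ι (fun _ => X) (fun _ => Y)) _ _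
    fun c => rfl).symm

lemma cov_sum {S : Type*} (A : Finset S) (w f g : S → ℝ) :
    ∑ p ∈ A, ∑ q ∈ A, w p * w q * ((f p - f q) * (g p - g q)) =
      2 * ((∑ p ∈ A, w p) * (∑ p ∈ A, w p * (f p * g p))
        - (∑ p ∈ A, w p * f p) * (∑ p ∈ A, w p * g p)) := by
  have : ∀ p q, w p * w q * ((f p - f q) * (g p - g q)) =
      (w p * (f p * g p)) * w q + w p * (w q * (f q * g q))
        - (w p * f p) * (w q * g q) - (w p * g p) * (w q * f q) := fun p q => by ring
  simp only [this, Finset.sum_sub_distrib, Finset.sum_add_distrib, ← Finset.mul_sum,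
    ← Finset.sum_mul]
  ring

variable {V : Type*}

/-- The orthogonal combinations of four replica spins. -/
noncomputable def quad : Fin 4 → Bool × Bool × Bool × Bool → ℝ := fun i a =>
  match i with
  | 0 => (sval a.1 + sval a.2.1 + sval a.2.2.1 + sval a.2.2.2) / 2
  | 1 => (sval a.1 + sval a.2.1 - sval a.2.2.1 - sval a.2.2.2) / 2
  | 2 => (sval a.1 - sval a.2.1 + sval a.2.2.1 - sval a.2.2.2) / 2
  | 3 => (-sval a.1 + sval a.2.1 + sval a.2.2.1 - sval a.2.2.2) / 2

lemma quad_nonneg (n : Fin 4 → ℕ) : 0 ≤ ∑ a, ∏ i, quad i a ^ n i := by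
  simp only [Fintype.sum_prod_type, Fintype.sum_bool, Fin.prod_univ_four, quad, sval]
  norm_num
  rcases Nat.even_or_odd (n 0) with h0 | h0 <;> rcases Nat.even_or_odd (n 1) with h1 | h1 <;>
  rcases Nat.even_or_odd (n 2) with h2 | h2 <;> rcases Nat.even_or_odd (n 3) with h3 | h3 <;>
  simp only [h0.neg_pow, h1.neg_pow, h2.neg_pow, h3.neg_pow, one_pow] <;> ring_nf <;> positivity

lemma quad_inner (a b : Bool × Bool × Bool × Bool) :
    sval a.1 * sval b.1 + sval a.2.1 * sval b.2.1 + sval a.2.2.1 * sval b.2.2.1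
      + sval a.2.2.2 * sval b.2.2.2 = ∑ i, quad i a * quad i b := by
  simp only [Fin.sum_univ_four, quad]
  ring

/-- Indicator that the first spin is plus and the second one is minus. -/
def pmInd (a b : Bool) : ℝ := if a = true ∧ b = false then 1 else 0

lemma quad_pm (a : Bool × Bool × Bool × Bool) :
    pmInd a.1 a.2.1 - pmInd a.2.2.1 a.2.2.2 = -(quad 3 a * (1 + quad 2 a)) / 2 := by
  obtain ⟨a, b, c, d⟩ := a
  cases a <;> cases b <;> cases c <;> cases d <;> norm_num [pmInd, quad, sval]

lemma lebowitz_cov [DecidableEq V] {κ : ℝ} (hκ : 0 ≤ κ) (E : Finset (V × V)) (Λ : Finset V)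
    (η : V → Bool) (u v : V) :
    ∑ p ∈ confs Λ (fun _ => true) ×ˢ confs Λ η, ∑ q ∈ confs Λ (fun _ => true) ×ˢ confs Λ η,
      (wt κ E p.1 * wt κ E p.2) * (wt κ E q.1 * wt κ E q.2) *
        (((sval (p.1 u) + sval (p.2 u)) - (sval (q.1 u) + sval (q.2 u))) *
          (pmInd (p.1 v) (p.2 v) - pmInd (q.1 v) (q.2 v))) ≤ 0 := by
  simp only [Finset.sum_product, sum_confs_eq, sum_prod_arrow]
  set q : (↥Λ → Bool × Bool × Bool × Bool) → V → Bool × Bool × Bool × Bool :=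
    fun ξ x => if hx : x ∈ Λ then ξ ⟨x, hx⟩ else (true, η x, true, η x) with hq
  have hgood : ∀ i x, PosMul quad (fun ξ => quad i (q ξ x)) := by
    intro i x
    by_cases hx : x ∈ Λ
    · simp only [hq, hx, dite_true]
      exact posMul_gen _ i
    · simp only [hq, hx, dite_false]
      apply posMul_const
      cases η x <;> fin_cases i <;> norm_num [quad, sval]
  have key : 0 ≤ ∑ ξ, Real.exp (∑ p ∈ E, κ * ∑ i, quad i (q ξ p.1) * quad i (q ξ p.2)) *
      (quad 1 (q ξ u) * (quad 3 (q ξ v) * (1 + quad 2 (q ξ v)))) := by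
    refine PosMul.sum_nonneg quad_nonneg (PosMul.mul (PosMul.exp ?_) ((hgood _ _).mul
      ((hgood _ _).mul ((posMul_const zero_le_one).add (hgood _ _)))))
    exact PosMul.sum _ fun p _ => (posMul_const hκ).mul
      (PosMul.sum _ fun i _ => (hgood _ _).mul (hgood _ _))
  have hext1 : ∀ ξ : ↥Λ → Bool × Bool × Bool × Bool,
      (ext2 Λ (fun _ => true) fun i => (ξ i).1) = fun x => (q ξ x).1 := fun ξ => by
    funext x; by_cases hx : x ∈ Λ <;> simp [ext2, hq, hx]
  have hext2 : ∀ ξ : ↥Λ → Bool × Bool × Bool × Bool,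
      (ext2 Λ η fun i => (ξ i).2.1) = fun x => (q ξ x).2.1 := fun ξ => by
    funext x; by_cases hx : x ∈ Λ <;> simp [ext2, hq, hx]
  have hext3 : ∀ ξ : ↥Λ → Bool × Bool × Bool × Bool,
      (ext2 Λ (fun _ => true) fun i => (ξ i).2.2.1) = fun x => (q ξ x).2.2.1 := fun ξ => by
    funext x; by_cases hx : x ∈ Λ <;> simp [ext2, hq, hx]
  have hext4 : ∀ ξ : ↥Λ → Bool × Bool × Bool × Bool,
      (ext2 Λ η fun i => (ξ i).2.2.2) = fun x => (q ξ x).2.2.2 := fun ξ => by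
    funext x; by_cases hx : x ∈ Λ <;> simp [ext2, hq, hx]
  rw [← neg_nonneg, ← Finset.sum_neg_distrib]
  refine key.trans_eq (Finset.sum_congr rfl fun ξ _ => ?_)
  rw [hext1, hext2, hext3, hext4, quad_pm]
  have hw : Real.exp (∑ p ∈ E, κ * ∑ i, quad i (q ξ p.1) * quad i (q ξ p.2)) =
      wt κ E (fun x => (q ξ x).1) * wt κ E (fun x => (q ξ x).2.1) *
        (wt κ E (fun x => (q ξ x).2.2.1) * wt κ E (fun x => (q ξ x).2.2.2)) := by
    rw [wt, wt, wt, wt, ← Real.exp_add, ← Real.exp_add, ← Real.exp_add, ← mul_add, ← mul_add,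
      ← mul_add, energy, energy, energy, energy, ← Finset.sum_add_distrib,
      ← Finset.sum_add_distrib, ← Finset.sum_add_distrib, Finset.mul_sum]
    congr 1
    refine Finset.sum_congr rfl fun p _ => ?_
    rw [← quad_inner]
    ring
  rw [hw]
  simp only [quad]
  ring

/-- The sum of the magnetizations at `u` with plus and `η` boundary conditions. -/
noncomputable def dsum (κ : ℝ) (E : Finset (V × V)) (Λ : Finset V) (η : V → Bool) (u : V) : ℝ :=
  av κ E Λ (fun _ => true) (fun σ => sval (σ u)) + av κ E Λ η (fun σ => sval (σ u))

lemma dsum_erase_le [DecidableEq V] {κ : ℝ} (hκ : 0 ≤ κ) (E : Finset (V × V)) {Λ : Finset V}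
    {η : V → Bool} {v : V} (hv : v ∈ Λ) (hη : η v = false) (u : V) :
    dsum κ E (Λ.erase v) η u ≤ dsum κ E Λ η u := by
  have h := lebowitz_cov hκ E Λ η u v
  rw [cov_sum (confs Λ (fun _ => true) ×ˢ confs Λ η) (fun p => wt κ E p.1 * wt κ E p.2)
    (fun p => sval (p.1 u) + sval (p.2 u)) (fun p => pmInd (p.1 v) (p.2 v))] at h
  have hut : Function.update (fun _ : V => true) v true = fun _ => true := by
    funext x; by_cases hx : x = v <;> simp [Function.update, hx]
  have huf : Function.update η v false = η := by
    rw [← hη]; exact Function.update_eq_self v η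
  have e1 : ∀ F : (V → Bool) × (V → Bool) → ℝ,
      ∑ p ∈ confs Λ (fun _ => true) ×ˢ confs Λ η, F p * pmInd (p.1 v) (p.2 v) =
      ∑ p ∈ confs (Λ.erase v) (fun _ => true) ×ˢ confs (Λ.erase v) η, F p := by
    intro F
    simp only [Finset.sum_product]
    rw [sum_confs_erase hv, hut]
    have hz : ∑ σ ∈ confs (Λ.erase v) (Function.update (fun _ => true) v false),
        ∑ y ∈ confs Λ η, F (σ, y) * pmInd (σ v) (y v) = 0 := by
      refine Finset.sum_eq_zero fun σ hσ => Finset.sum_eq_zero fun y _ => ?_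
      rw [mem_confs] at hσ
      simp [pmInd, hσ v (by simp)]
    rw [hz, add_zero]
    refine Finset.sum_congr rfl fun σ hσ => ?_
    rw [sum_confs_erase hv, huf]
    have hz : ∑ y ∈ confs (Λ.erase v) (Function.update η v true),
        F (σ, y) * pmInd (σ v) (y v) = 0 := by
      refine Finset.sum_eq_zero fun y hy => ?_
      rw [mem_confs] at hy
      simp [pmInd, hy v (by simp)]
    rw [hz, zero_add]
    refine Finset.sum_congr rfl fun y hy => ?_
    rw [mem_confs] at hσ hy
    simp [pmInd, hσ v (by simp), hy v (by simp), hη]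
  have e2 : ∀ Λ' : Finset V, ∑ p ∈ confs Λ' (fun _ => true) ×ˢ confs Λ' η,
      wt κ E p.1 * wt κ E p.2 =
        zf κ E Λ' (fun _ => true) (fun _ => 1) * zf κ E Λ' η (fun _ => 1) := by
    intro Λ'
    simp only [Finset.sum_product, zf, mul_one, Finset.sum_mul_sum]
  have e3 : ∀ Λ' : Finset V, ∑ p ∈ confs Λ' (fun _ => true) ×ˢ confs Λ' η,
      wt κ E p.1 * wt κ E p.2 * (sval (p.1 u) + sval (p.2 u)) =
        zf κ E Λ' (fun _ => true) (fun _ => 1) * zf κ E Λ' η (fun _ => 1) *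
          dsum κ E Λ' η u := by
    intro Λ'
    have h1 : (zf κ E Λ' (fun _ => true) (fun _ => 1)) ≠ 0 := zf_one_pos.ne'
    have h2 : (zf κ E Λ' η (fun _ => 1)) ≠ 0 := zf_one_pos.ne'
    have : zf κ E Λ' (fun _ => true) (fun _ => 1) * zf κ E Λ' η (fun _ => 1) *
        dsum κ E Λ' η u = zf κ E Λ' (fun _ => true) (fun σ => sval (σ u)) *
          zf κ E Λ' η (fun _ => 1) + zf κ E Λ' (fun _ => true) (fun _ => 1) *
          zf κ E Λ' η (fun σ => sval (σ u)) := by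
      rw [dsum, av, av]; field_simp
    rw [this]
    simp only [Finset.sum_product, zf, mul_one, Finset.sum_mul_sum, ← Finset.sum_add_distrib]
    exact Finset.sum_congr rfl fun _ _ => Finset.sum_congr rfl fun _ _ => by ring
  simp only [← mul_assoc] at h
  rw [e1 (fun p => wt κ E p.1 * wt κ E p.2 * (sval (p.1 u) + sval (p.2 u))),
    e1 (fun p => wt κ E p.1 * wt κ E p.2), e2, e2, e3, e3] at h
  have p1 : 0 < zf κ E Λ (fun _ => true) (fun _ => 1) * zf κ E Λ η (fun _ => 1) :=
    mul_pos zf_one_pos zf_one_pos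
  have p2 : 0 < zf κ E (Λ.erase v) (fun _ => true) (fun _ => 1) *
    zf κ E (Λ.erase v) η (fun _ => 1) := mul_pos zf_one_pos zf_one_pos
  have h' : (zf κ E Λ (fun _ => true) (fun _ => 1) * zf κ E Λ η (fun _ => 1)) *
    (zf κ E (Λ.erase v) (fun _ => true) (fun _ => 1) *
    zf κ E (Λ.erase v) η (fun _ => 1)) * (dsum κ E (Λ.erase v) η u - dsum κ E Λ η u) ≤ 0 := by
    nlinarith [h]
  by_contra hcon
  push Not at hcon
  nlinarith [mul_pos (mul_pos p1 p2) (sub_pos.2 hcon)]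

lemma dsum_mono [DecidableEq V] {κ : ℝ} (hκ : 0 ≤ κ) (E : Finset (V × V)) {Λ Λ' : Finset V}
    (hΛ : Λ ⊆ Λ') {η : V → Bool} (hη : ∀ x ∈ Λ', x ∉ Λ → η x = false) (u : V) :
    dsum κ E Λ η u ≤ dsum κ E Λ' η u := by
  induction hn : (Λ' \ Λ).card generalizing Λ' with
  | zero =>
    rw [Finset.card_eq_zero, Finset.sdiff_eq_empty_iff_subset] at hn
    rw [Finset.Subset.antisymm hΛ hn]
  | succ n ih =>
    obtain ⟨v, hv⟩ : (Λ' \ Λ).Nonempty := by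
      rw [← Finset.card_pos]; omega
    obtain ⟨hv1, hv2⟩ := Finset.mem_sdiff.1 hv
    refine (ih (Λ' := Λ'.erase v) ?_ ?_ ?_).trans (dsum_erase_le hκ E hv1 (hη v hv1 hv2) u)
    · exact fun x hx => Finset.mem_erase.2 ⟨fun h => hv2 (h ▸ hx), hΛ hx⟩
    · exact fun x hx => hη x (Finset.mem_of_mem_erase hx)
    · have : Λ'.erase v \ Λ = (Λ' \ Λ).erase v := by
        ext x; simp [and_assoc]
      rw [this, Finset.card_erase_of_mem hv, hn]; rfl

/-- Sum and difference of two replica spins. -/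
def duo : Fin 2 → Bool × Bool → ℝ := fun i a =>
  match i with
  | 0 => sval a.1 + sval a.2
  | 1 => sval a.1 - sval a.2

lemma duo_nonneg (n : Fin 2 → ℕ) : 0 ≤ ∑ a, ∏ i, duo i a ^ n i := by
  simp only [Fintype.sum_prod_type, Fintype.sum_bool, Fin.prod_univ_two, duo, sval]
  norm_num
  rcases Nat.even_or_odd (n 0) with h0 | h0 <;> rcases Nat.even_or_odd (n 1) with h1 | h1 <;>
  simp only [h0.neg_pow, h1.neg_pow] <;> ring_nf <;> positivity

/-- Pair correlations with plus boundary condition increase with the couplings. -/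
lemma ginibre [DecidableEq V] {κ κ' : ℝ} (hκ' : 0 ≤ κ') (hκ : κ' ≤ κ) {E E' : Finset (V × V)}
    (hE : E' ⊆ E) (Λ : Finset V) (x y : V) :
    av κ' E' Λ (fun _ => true) (fun σ => sval (σ x) * sval (σ y)) ≤
      av κ E Λ (fun _ => true) (fun σ => sval (σ x) * sval (σ y)) := by
  have key : 0 ≤ ∑ σ ∈ confs Λ (fun _ => true), ∑ σ' ∈ confs Λ (fun _ => true),
      wt κ E σ * wt κ' E' σ' * (sval (σ x) * sval (σ y) - sval (σ' x) * sval (σ' y)) := by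
    simp only [sum_confs_eq, sum_prod_arrow]
    set q : (↥Λ → Bool × Bool) → V → Bool × Bool :=
      fun ξ x => if hx : x ∈ Λ then ξ ⟨x, hx⟩ else (true, true) with hq
    have hgood : ∀ i x, PosMul duo (fun ξ => duo i (q ξ x)) := by
      intro i x
      by_cases hx : x ∈ Λ
      · simp only [hq, hx, dite_true]
        exact posMul_gen _ i
      · simp only [hq, hx, dite_false]
        apply posMul_const
        fin_cases i <;> norm_num [duo, sval]
    have hext1 : ∀ ξ : ↥Λ → Bool × Bool,
        (ext2 Λ (fun _ => true) fun i => (ξ i).1) = fun x => (q ξ x).1 := fun ξ => by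
      funext x; by_cases hx : x ∈ Λ <;> simp [ext2, hq, hx]
    have hext2 : ∀ ξ : ↥Λ → Bool × Bool,
        (ext2 Λ (fun _ => true) fun i => (ξ i).2) = fun x => (q ξ x).2 := fun ξ => by
      funext x; by_cases hx : x ∈ Λ <;> simp [ext2, hq, hx]
    have main : 0 ≤ ∑ ξ, Real.exp (∑ p ∈ E,
        ((κ + if p ∈ E' then κ' else 0) / 4 * (duo 0 (q ξ p.1) * duo 0 (q ξ p.2)
            + duo 1 (q ξ p.1) * duo 1 (q ξ p.2))
          + (κ - if p ∈ E' then κ' else 0) / 4 * (duo 0 (q ξ p.1) * duo 1 (q ξ p.2)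
            + duo 1 (q ξ p.1) * duo 0 (q ξ p.2)))) *
        (1 / 2 * (duo 0 (q ξ x) * duo 1 (q ξ y) + duo 1 (q ξ x) * duo 0 (q ξ y))) := by
      refine PosMul.sum_nonneg duo_nonneg (PosMul.mul (PosMul.exp ?_)
        ((posMul_const (by norm_num)).mul (((hgood _ _).mul (hgood _ _)).add
          ((hgood _ _).mul (hgood _ _)))))
      refine PosMul.sum _ fun p _ => ?_
      refine ((posMul_const ?_).mul (((hgood _ _).mul (hgood _ _)).add
          ((hgood _ _).mul (hgood _ _)))).add ((posMul_const ?_).mul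
          (((hgood _ _).mul (hgood _ _)).add ((hgood _ _).mul (hgood _ _))))
      · split_ifs <;> linarith
      · split_ifs <;> linarith
    refine main.trans_eq (Finset.sum_congr rfl fun ξ _ => ?_)
    rw [hext1, hext2]
    congr 1
    · rw [wt, wt, ← Real.exp_add, energy, energy]
      congr 1
      have : ∑ p ∈ E', sval (q ξ p.1).2 * sval (q ξ p.2).2 =
          ∑ p ∈ E, if p ∈ E' then sval (q ξ p.1).2 * sval (q ξ p.2).2 else 0 := by
        rw [← Finset.sum_filter, Finset.filter_mem_eq_inter, Finset.inter_eq_right.2 hE]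
      rw [this, Finset.mul_sum, Finset.mul_sum, ← Finset.sum_add_distrib]
      refine Finset.sum_congr rfl fun p _ => ?_
      simp only [duo]
      split_ifs <;> ring
    · simp only [duo]
      ring
  have e : ∑ σ ∈ confs Λ (fun _ => true), ∑ σ' ∈ confs Λ (fun _ => true),
      wt κ E σ * wt κ' E' σ' * (sval (σ x) * sval (σ y) - sval (σ' x) * sval (σ' y)) =
      zf κ E Λ (fun _ => true) (fun σ => sval (σ x) * sval (σ y)) *
        zf κ' E' Λ (fun _ => true) (fun _ => 1) - zf κ E Λ (fun _ => true) (fun _ => 1) *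
        zf κ' E' Λ (fun _ => true) (fun σ => sval (σ x) * sval (σ y)) := by
    simp only [zf, Finset.sum_mul_sum, ← Finset.sum_sub_distrib]
    exact Finset.sum_congr rfl fun _ _ => Finset.sum_congr rfl fun _ _ => by ring
  rw [e] at key
  rw [av, av, div_le_div_iff₀ zf_one_pos zf_one_pos]
  linarith

end Replicas

section Lattice

lemma mem_nbrs_iff {x y : ℤ × ℤ} : y ∈ nbrs x ↔
    (y.1 = x.1 + 1 ∧ y.2 = x.2) ∨ (y.1 = x.1 - 1 ∧ y.2 = x.2) ∨
      (y.1 = x.1 ∧ y.2 = x.2 + 1) ∨ (y.1 = x.1 ∧ y.2 = x.2 - 1) := by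
  simp [nbrs, Prod.ext_iff]

lemma mem_nbrs_comm {x y : ℤ × ℤ} : y ∈ nbrs x ↔ x ∈ nbrs y := by
  simp only [mem_nbrs_iff]
  omega

lemma not_mem_nbrs_self (x : ℤ × ℤ) : x ∉ nbrs x := by
  simp only [mem_nbrs_iff]
  omega

/-- Ordered nearest-neighbour pairs touching `Λ`. -/
def edg (Λ : Finset (ℤ × ℤ)) : Finset ((ℤ × ℤ) × (ℤ × ℤ)) :=
  (Λ.biUnion fun x => (nbrs x).image fun y => (x, y)) ∪
    (Λ.biUnion fun x => (nbrs x).image fun y => (y, x))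

lemma mem_edg {Λ : Finset (ℤ × ℤ)} {p : (ℤ × ℤ) × (ℤ × ℤ)} :
    p ∈ edg Λ ↔ p.2 ∈ nbrs p.1 ∧ (p.1 ∈ Λ ∨ p.2 ∈ Λ) := by
  obtain ⟨x, y⟩ := p
  simp only [edg, Finset.mem_union, Finset.mem_biUnion, Finset.mem_image, Prod.mk.injEq]
  constructor
  · rintro (⟨a, ha, b, hb, rfl, rfl⟩ | ⟨a, ha, b, hb, rfl, rfl⟩)
    · exact ⟨hb, Or.inl ha⟩
    · exact ⟨mem_nbrs_comm.1 hb, Or.inr ha⟩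
  · rintro ⟨h, h1 | h1⟩
    · exact Or.inl ⟨x, h1, y, h, rfl, rfl⟩
    · exact Or.inr ⟨y, h1, x, mem_nbrs_comm.1 h, rfl, rfl⟩

lemma edg_mono {Λ Λ' : Finset (ℤ × ℤ)} (h : Λ ⊆ Λ') : edg Λ ⊆ edg Λ' := by
  intro p hp
  rw [mem_edg] at *
  exact ⟨hp.1, hp.2.imp (fun x => h x) (fun x => h x)⟩

lemma card_nbrs_le (x : ℤ × ℤ) : (nbrs x).card ≤ 4 := Finset.card_le_four

lemma card_edg_le (Λ : Finset (ℤ × ℤ)) : (edg Λ).card ≤ 8 * Λ.card := by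
  refine (Finset.card_union_le _ _).trans ?_
  have h1 : (Λ.biUnion fun x => (nbrs x).image fun y => (x, y)).card ≤ Λ.card * 4 :=
    Finset.card_biUnion_le_card_mul _ _ _ fun x _ =>
      Finset.card_image_le.trans (card_nbrs_le x)
  have h2 : (Λ.biUnion fun x => (nbrs x).image fun y => (y, x)).card ≤ Λ.card * 4 :=
    Finset.card_biUnion_le_card_mul _ _ _ fun x _ =>
      Finset.card_image_le.trans (card_nbrs_le x)
  omega

lemma energy_congr {V : Type*} {E : Finset (V × V)} {σ σ' : V → Bool}
    (h : ∀ p ∈ E, σ p.1 = σ' p.1 ∧ σ p.2 = σ' p.2) : energy E σ = energy E σ' :=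
  Finset.sum_congr rfl fun p hp => by rw [(h p hp).1, (h p hp).2]

lemma abs_sval (b : Bool) : |sval b| = 1 := by cases b <;> simp [sval]

lemma abs_energy_le {V : Type*} (E : Finset (V × V)) (σ : V → Bool) :
    |energy E σ| ≤ E.card := by
  refine (Finset.abs_sum_le_sum_abs _ _).trans ?_
  simp [abs_mul, abs_sval]

lemma energy_union {V : Type*} [DecidableEq V] {E F : Finset (V × V)} (h : Disjoint E F)
    (σ : V → Bool) : energy (E ∪ F) σ = energy E σ + energy F σ :=
  Finset.sum_union h

lemma wt_union {V : Type*} [DecidableEq V] {κ : ℝ} {E F : Finset (V × V)} (h : Disjoint E F)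
    (σ : V → Bool) : wt κ (E ∪ F) σ = wt κ E σ * wt κ F σ := by
  rw [wt, energy_union h, mul_add, Real.exp_add]; rfl

/-- Interactions not touching `Λ` only contribute a constant factor. -/
lemma zf_subset {V : Type*} [DecidableEq V] (κ : ℝ) {E E' : Finset (V × V)} (hE : E' ⊆ E)
    {Λ : Finset V} (h : ∀ p ∈ E, p ∉ E' → p.1 ∉ Λ ∧ p.2 ∉ Λ) (η : V → Bool)
    (f : (V → Bool) → ℝ) :
    zf κ E Λ η f = wt κ (E \ E') η * zf κ E' Λ η f := by
  rw [zf, zf, Finset.mul_sum]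
  refine Finset.sum_congr rfl fun σ hσ => ?_
  rw [mem_confs] at hσ
  conv_lhs => rw [← Finset.sdiff_union_of_subset hE, wt_union Finset.sdiff_disjoint]
  have : wt κ (E \ E') σ = wt κ (E \ E') η := by
    rw [wt, wt, energy_congr]
    intro p hp
    obtain ⟨h1, h2⟩ := Finset.mem_sdiff.1 hp
    exact ⟨hσ _ (h p h1 h2).1, hσ _ (h p h1 h2).2⟩
  rw [this]
  ring

lemma av_subset {V : Type*} [DecidableEq V] (κ : ℝ) {E E' : Finset (V × V)} (hE : E' ⊆ E)
    {Λ : Finset V} (h : ∀ p ∈ E, p ∉ E' → p.1 ∉ Λ ∧ p.2 ∉ Λ) (η : V → Bool)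
    (f : (V → Bool) → ℝ) : av κ E Λ η f = av κ E' Λ η f := by
  rw [av, zf_subset κ hE h, zf_subset κ hE h, mul_div_mul_left _ _ (wt_pos ..).ne', ← av]

lemma edg_sdiff_away {Λ R : Finset (ℤ × ℤ)} :
    ∀ p ∈ edg R, p ∉ edg Λ → p.1 ∉ Λ ∧ p.2 ∉ Λ := by
  intro p hp hp'
  rw [mem_edg] at hp hp'
  simp only [not_and, not_or] at hp'
  exact hp' hp.1

lemma zf_edg_subset (κ : ℝ) {Λ R : Finset (ℤ × ℤ)} (h : Λ ⊆ R) (η : Cfg2) (f : Cfg2 → ℝ) :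
    zf κ (edg R) Λ η f = wt κ (edg R \ edg Λ) η * zf κ (edg Λ) Λ η f :=
  zf_subset κ (edg_mono h) edg_sdiff_away η f

lemma av_edg_subset (κ : ℝ) {Λ R : Finset (ℤ × ℤ)} (h : Λ ⊆ R) (η : Cfg2) (f : Cfg2 → ℝ) :
    av κ (edg R) Λ η f = av κ (edg Λ) Λ η f :=
  av_subset κ (edg_mono h) edg_sdiff_away η f

lemma dsum_edg_subset (κ : ℝ) {Λ R : Finset (ℤ × ℤ)} (h : Λ ⊆ R) (η : Cfg2) (u : ℤ × ℤ) :
    dsum κ (edg R) Λ η u = dsum κ (edg Λ) Λ η u := by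
  rw [dsum, dsum, av_edg_subset κ h, av_edg_subset κ h]

/-- Graph automorphisms and locality. -/
lemma zf_transport (κ : ℝ) (e : ℤ × ℤ ≃ ℤ × ℤ) (he : ∀ x y, e y ∈ nbrs (e x) ↔ y ∈ nbrs x)
    {Λ Λ' : Finset (ℤ × ℤ)} (hΛ : ∀ x, e x ∈ Λ' ↔ x ∈ Λ) {η η' : Cfg2}
    (hη : ∀ x, x ∉ Λ → (∃ y ∈ Λ, x ∈ nbrs y) → η' (e x) = η x) {f f' : Cfg2 → ℝ}
    (hf : ∀ σ ∈ confs Λ η, ∀ σ' ∈ confs Λ' η', (∀ x ∈ Λ, σ' (e x) = σ x) → f σ = f' σ') :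
    zf κ (edg Λ) Λ η f = zf κ (edg Λ') Λ' η' f' := by
  have hE : ∀ σ σ' : Cfg2, (∀ p ∈ edg Λ, σ' (e p.1) = σ p.1 ∧ σ' (e p.2) = σ p.2) →
      energy (edg Λ) σ = energy (edg Λ') σ' := by
    intro σ σ' h
    refine Finset.sum_bij' (fun p _ => (e p.1, e p.2)) (fun p _ => (e.symm p.1, e.symm p.2))
      ?_ ?_ ?_ ?_ ?_
    · intro p hp
      rw [mem_edg] at *
      rw [he, hΛ, hΛ]
      exact hp
    · intro p hp
      rw [mem_edg] at *
      rw [← he, ← hΛ, ← hΛ]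
      simpa using hp
    · intro p _; simp
    · intro p _; simp
    · intro p hp
      rw [(h p hp).1, (h p hp).2]
  have hag : ∀ σ ∈ confs Λ η, ∀ σ' ∈ confs Λ' η', (∀ x ∈ Λ, σ' (e x) = σ x) →
      wt κ (edg Λ) σ * f σ = wt κ (edg Λ') σ' * f' σ' := by
    intro σ hσ σ' hσ' h
    rw [hf σ hσ σ' hσ' h, wt, wt, hE σ σ']
    rw [mem_confs] at hσ hσ'
    intro p hp
    rw [mem_edg] at hp
    have aux : ∀ x y, y ∈ nbrs x → (x ∈ Λ ∨ y ∈ Λ) → σ' (e x) = σ x := by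
      intro x y hxy hor
      by_cases hx : x ∈ Λ
      · exact h x hx
      · rw [hσ' _ (fun h' => hx ((hΛ x).1 h')), hσ x hx]
        exact hη x hx ⟨y, hor.resolve_left hx, mem_nbrs_comm.1 hxy⟩
    exact ⟨aux _ _ hp.1 hp.2, aux _ _ (mem_nbrs_comm.1 hp.1) hp.2.symm⟩
  have hm1 : ∀ σ : Cfg2, (fun y => if y ∈ Λ' then σ (e.symm y) else η' y) ∈ confs Λ' η' := by
    intro σ
    rw [mem_confs]
    intro x hx
    simp [hx]
  have hm2 : ∀ σ : Cfg2, (fun y => if y ∈ Λ then σ (e y) else η y) ∈ confs Λ η := by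
    intro σ
    rw [mem_confs]
    intro x hx
    simp [hx]
  refine Finset.sum_bij' (fun σ _ => fun y => if y ∈ Λ' then σ (e.symm y) else η' y)
    (fun σ _ => fun y => if y ∈ Λ then σ (e y) else η y) ?_ ?_ ?_ ?_ ?_
  · intro σ _; exact hm1 σ
  · intro σ _; exact hm2 σ
  · intro σ hσ
    rw [mem_confs] at hσ
    funext y
    by_cases hy : y ∈ Λ
    · simp [hy, hΛ]
    · simp [hy, hσ y hy]
  · intro σ hσ
    rw [mem_confs] at hσ
    funext y
    by_cases hy : y ∈ Λ'
    · have : e.symm y ∈ Λ := by rw [← hΛ]; simpa using hy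
      simp [hy, this]
    · simp [hy, hσ y hy]
  · intro σ hσ
    refine hag σ hσ _ (hm1 σ) fun x hx => ?_
    simp [hΛ, hx]

lemma dsum_transport (κ : ℝ) (e : ℤ × ℤ ≃ ℤ × ℤ)
    (he : ∀ x y, e y ∈ nbrs (e x) ↔ y ∈ nbrs x)
    {Λ Λ' : Finset (ℤ × ℤ)} (hΛ : ∀ x, e x ∈ Λ' ↔ x ∈ Λ) {η η' : Cfg2}
    (hη : ∀ x, x ∉ Λ → (∃ y ∈ Λ, x ∈ nbrs y) → η' (e x) = η x) {u : ℤ × ℤ} (hu : u ∈ Λ) :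
    dsum κ (edg Λ) Λ η u = dsum κ (edg Λ') Λ' η' (e u) := by
  rw [dsum, dsum, av, av, av, av]
  congr 2
  · refine zf_transport κ e he hΛ (η' := fun _ => true) (fun _ _ _ => rfl) ?_
    intro σ _ σ' _ h
    simp only [h u hu]
  · exact zf_transport κ e he hΛ (η' := fun _ => true) (fun _ _ _ => rfl) fun σ _ σ' _ h => rfl
  · refine zf_transport κ e he hΛ hη ?_
    intro σ _ σ' _ h
    simp only [h u hu]
  · exact zf_transport κ e he hΛ hη fun σ _ σ' _ h => rfl

lemma zf_local (κ : ℝ) {Λ : Finset (ℤ × ℤ)} {η η' : Cfg2}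
    (hη : ∀ x, x ∉ Λ → (∃ y ∈ Λ, x ∈ nbrs y) → η' x = η x) {f f' : Cfg2 → ℝ}
    (hf : ∀ σ ∈ confs Λ η, ∀ σ' ∈ confs Λ η', (∀ x ∈ Λ, σ' x = σ x) → f σ = f' σ') :
    zf κ (edg Λ) Λ η f = zf κ (edg Λ) Λ η' f' :=
  zf_transport κ (Equiv.refl _) (fun _ _ => Iff.rfl) (fun _ => Iff.rfl) hη hf

/-- Spin flip. -/
def flipc {V : Type*} (σ : V → Bool) : V → Bool := fun x => !(σ x)

lemma flipc_flipc {V : Type*} (σ : V → Bool) : flipc (flipc σ) = σ := by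
  funext x; simp [flipc]

lemma sval_not (b : Bool) : sval (!b) = -sval b := by cases b <;> simp [sval]

lemma energy_flipc {V : Type*} (E : Finset (V × V)) (σ : V → Bool) :
    energy E (flipc σ) = energy E σ := by
  simp [energy, flipc, sval_not]

lemma zf_flip {V : Type*} (κ : ℝ) (E : Finset (V × V)) (Λ : Finset V) (η : V → Bool)
    (f : (V → Bool) → ℝ) :
    zf κ E Λ (flipc η) f = zf κ E Λ η (fun σ => f (flipc σ)) := by
  refine Finset.sum_bij' (fun σ _ => flipc σ) (fun σ _ => flipc σ) ?_ ?_ ?_ ?_ ?_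
  · intro σ hσ
    rw [mem_confs] at *
    intro x hx
    simp [flipc, hσ x hx]
  · intro σ hσ
    rw [mem_confs] at *
    intro x hx
    simp [flipc, hσ x hx]
  · intro σ _; exact flipc_flipc σ
  · intro σ _; exact flipc_flipc σ
  · intro σ _
    simp only [flipc_flipc, wt, energy_flipc]

lemma av_flip {V : Type*} (κ : ℝ) (E : Finset (V × V)) (Λ : Finset V) (η : V → Bool)
    (f : (V → Bool) → ℝ) :
    av κ E Λ (flipc η) f = av κ E Λ η (fun σ => f (flipc σ)) := by
  rw [av, av, zf_flip, zf_flip]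

lemma av_false {V : Type*} (κ : ℝ) (E : Finset (V × V)) (Λ : Finset V)
    (f : (V → Bool) → ℝ) :
    av κ E Λ (fun _ => false) f = av κ E Λ (fun _ => true) (fun σ => f (flipc σ)) :=
  av_flip κ E Λ (fun _ => true) f

lemma dsum_eq {V : Type*} (κ : ℝ) (E : Finset (V × V)) (Λ : Finset V) (η : V → Bool) (u : V) :
    dsum κ E Λ η u = av κ E Λ η (fun σ => sval (σ u)) -
      av κ E Λ (fun _ => false) (fun σ => sval (σ u)) := by
  rw [av_false, dsum]
  simp only [flipc, sval_not]
  have := av_const_mul (κ := κ) (E := E) (Λ := Λ) (η := fun _ => true) (-1)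
    (fun σ => sval (σ u))
  simp only [neg_mul, one_mul] at this
  rw [this]
  ring

/-- Factorization over two non-adjacent regions. -/
lemma zf_decouple (κ : ℝ) {U D : Finset (ℤ × ℤ)} (hUD : Disjoint U D)
    (hadj : ∀ x ∈ U, ∀ y ∈ D, y ∉ nbrs x) (η : Cfg2) {f g : Cfg2 → ℝ}
    (hf : ∀ σ σ' : Cfg2, (∀ x, x ∉ D → σ x = σ' x) → f σ = f σ')
    (hg : ∀ σ σ' : Cfg2, (∀ x, x ∉ U → σ x = σ' x) → g σ = g σ') :
    zf κ (edg (U ∪ D)) (U ∪ D) η (fun σ => f σ * g σ) =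
      zf κ (edg U) U η f * zf κ (edg D) D η g := by
  have hedg : edg (U ∪ D) = edg U ∪ edg D := by
    ext p
    simp only [mem_edg, Finset.mem_union]
    tauto
  have hdisj : Disjoint (edg U) (edg D) := by
    rw [Finset.disjoint_left]
    intro p h1 h2
    rw [mem_edg] at h1 h2
    rcases h1.2 with h | h <;> rcases h2.2 with h' | h'
    · exact Finset.disjoint_left.1 hUD h h'
    · exact hadj _ h _ h' h1.1
    · exact hadj _ h _ h' (mem_nbrs_comm.1 h1.1)
    · exact Finset.disjoint_left.1 hUD h h'
  have hoff : ∀ p ∈ edg U, p.1 ∉ D ∧ p.2 ∉ D := by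
    intro p hp
    rw [mem_edg] at hp
    rcases hp.2 with h | h
    · exact ⟨Finset.disjoint_left.1 hUD h, fun h' => hadj _ h _ h' hp.1⟩
    · exact ⟨fun h' => hadj _ h _ h' (mem_nbrs_comm.1 hp.1), Finset.disjoint_left.1 hUD h⟩
  rw [zf, sum_confs_union hUD, hedg, zf, Finset.sum_mul]
  refine Finset.sum_congr rfl fun ζ hζ => ?_
  rw [mem_confs] at hζ
  have hl : zf κ (edg D) D η g = zf κ (edg D) D ζ g := by
    refine zf_local κ ?_ ?_
    · rintro x - ⟨y, hy, hxy⟩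
      exact hζ x fun h => hadj x h y hy (mem_nbrs_comm.1 hxy)
    · intro σ hσ σ' hσ' h
      rw [mem_confs] at hσ hσ'
      refine hg _ _ fun x hx => ?_
      by_cases hxD : x ∈ D
      · exact (h x hxD).symm
      · rw [hσ x hxD, hσ' x hxD, hζ x hx]
  rw [hl, zf, Finset.mul_sum]
  refine Finset.sum_congr rfl fun σ hσ => ?_
  rw [mem_confs] at hσ
  have h1 : wt κ (edg U) σ = wt κ (edg U) ζ := by
    rw [wt, wt, energy_congr]
    exact fun p hp => ⟨hσ _ (hoff p hp).1, hσ _ (hoff p hp).2⟩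
  rw [wt_union hdisj, h1, hf σ ζ hσ]
  ring

lemma av_decouple (κ : ℝ) {U D : Finset (ℤ × ℤ)} (hUD : Disjoint U D)
    (hadj : ∀ x ∈ U, ∀ y ∈ D, y ∉ nbrs x) (η : Cfg2) {f : Cfg2 → ℝ}
    (hf : ∀ σ σ' : Cfg2, (∀ x, x ∉ D → σ x = σ' x) → f σ = f σ') :
    av κ (edg (U ∪ D)) (U ∪ D) η f = av κ (edg U) U η f := by
  have h1 := zf_decouple κ hUD hadj η hf (g := fun _ => 1) (fun _ _ _ => rfl)
  have h2 := zf_decouple κ hUD hadj η (f := fun _ => 1) (fun _ _ _ => rfl) (g := fun _ => 1)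
    (fun _ _ _ => rfl)
  simp only [mul_one] at h1 h2
  rw [av, h1, h2, mul_div_mul_right _ _ zf_one_pos.ne', ← av]

lemma dsum_decouple (κ : ℝ) {U D : Finset (ℤ × ℤ)} (hUD : Disjoint U D)
    (hadj : ∀ x ∈ U, ∀ y ∈ D, y ∉ nbrs x) (η : Cfg2) {u : ℤ × ℤ} (hu : u ∉ D) :
    dsum κ (edg (U ∪ D)) (U ∪ D) η u = dsum κ (edg U) U η u := by
  rw [dsum, dsum, av_decouple κ hUD hadj, av_decouple κ hUD hadj]
  all_goals
    intro σ σ' h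
    rw [h u hu]

/-- Change of energy under a spin flip at `v`. -/
lemma energy_update {R : Finset (ℤ × ℤ)} {v : ℤ × ℤ} (hv : v ∈ R) (σ : Cfg2) :
    energy (edg R) (Function.update σ v true) - energy (edg R) (Function.update σ v false) =
      4 * ∑ y ∈ nbrs v, sval (σ y) := by
  have hne : ∀ y ∈ nbrs v, y ≠ v := fun y hy h => not_mem_nbrs_self v (h ▸ hy)
  rw [energy, energy, ← Finset.sum_sub_distrib]
  set T1 := (nbrs v).image fun y => (v, y) with hT1
  set T2 := (nbrs v).image fun y => (y, v) with hT2
  have hd : Disjoint T1 T2 := by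
    rw [Finset.disjoint_left]
    intro p h1 h2
    obtain ⟨y, hy, rfl⟩ := Finset.mem_image.1 h1
    obtain ⟨z, hz, h⟩ := Finset.mem_image.1 h2
    simp only [Prod.mk.injEq] at h
    exact hne z hz h.1
  have hsub : T1 ∪ T2 ⊆ edg R := by
    intro p hp
    rw [mem_edg]
    rcases Finset.mem_union.1 hp with h | h
    · obtain ⟨y, hy, rfl⟩ := Finset.mem_image.1 h
      exact ⟨hy, Or.inl hv⟩
    · obtain ⟨y, hy, rfl⟩ := Finset.mem_image.1 h
      exact ⟨mem_nbrs_comm.1 hy, Or.inr hv⟩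
  rw [← Finset.sum_subset hsub, Finset.sum_union hd, hT1, hT2,
    Finset.sum_image (by intro a _ b _ h; simpa using h),
    Finset.sum_image (by intro a _ b _ h; simpa using h), ← Finset.sum_add_distrib,
    Finset.mul_sum]
  · refine Finset.sum_congr rfl fun y hy => ?_
    simp only [Function.update_self, Function.update_of_ne (hne y hy), sval, if_true,
      Bool.false_eq_true, if_false]
    ring
  · intro p hp hp'
    have h1 : p.1 ≠ v := by
      intro h
      refine hp' (Finset.mem_union_left _ (Finset.mem_image.2 ⟨p.2, ?_, by rw [← h]⟩))
      rw [← h]; exact (mem_edg.1 hp).1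
    have h2 : p.2 ≠ v := by
      intro h
      refine hp' (Finset.mem_union_right _ (Finset.mem_image.2 ⟨p.1, ?_, by rw [← h]⟩))
      rw [← h]; exact mem_nbrs_comm.1 (mem_edg.1 hp).1
    simp [Function.update_of_ne h1, Function.update_of_ne h2]

lemma isingWeight_eq (β : ℝ) (Λ : Finset (ℤ × ℤ)) (η σ : Cfg2) (hσ : σ ∈ confs Λ η) :
    isingWeight β 0 Λ η σ = wt (β / 2) (edg Λ) σ := by
  rw [mem_confs] at hσ
  rw [isingWeight, wt]
  congr 1
  have e1 : ∑ x ∈ Λ, ∑ y ∈ Λ.filter (fun y => y ∈ nbrs x), sval (σ x) * sval (σ y) =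
      ∑ p ∈ (edg Λ).filter (fun p => p.1 ∈ Λ ∧ p.2 ∈ Λ), sval (σ p.1) * sval (σ p.2) := by
    rw [Finset.sum_sigma']
    refine Finset.sum_bij' (fun p _ => (p.1, p.2)) (fun p _ => ⟨p.1, p.2⟩) ?_ ?_ ?_ ?_ ?_ <;>
      simp only [Finset.mem_sigma, Finset.mem_filter, mem_edg] <;> try tauto
  have e2 : ∑ x ∈ Λ, ∑ y ∈ (nbrs x).filter (fun y => y ∉ Λ), sval (σ x) * sval (η y) =
      ∑ p ∈ (edg Λ).filter (fun p => p.1 ∈ Λ ∧ p.2 ∉ Λ), sval (σ p.1) * sval (σ p.2) := by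
    rw [Finset.sum_sigma']
    refine Finset.sum_bij' (fun p _ => (p.1, p.2)) (fun p _ => ⟨p.1, p.2⟩) ?_ ?_ ?_ ?_ ?_
    · simp only [Finset.mem_sigma, Finset.mem_filter, mem_edg]; tauto
    · simp only [Finset.mem_sigma, Finset.mem_filter, mem_edg]; tauto
    · simp
    · simp
    · simp only [Finset.mem_sigma, Finset.mem_filter]
      intro p hp
      rw [hσ _ hp.2.2]
  have e3 : ∑ x ∈ Λ, ∑ y ∈ (nbrs x).filter (fun y => y ∉ Λ), sval (σ x) * sval (η y) =
      ∑ p ∈ (edg Λ).filter (fun p => p.1 ∉ Λ), sval (σ p.1) * sval (σ p.2) := by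
    rw [Finset.sum_sigma']
    refine Finset.sum_bij' (fun p _ => (p.2, p.1)) (fun p _ => ⟨p.2, p.1⟩) ?_ ?_ ?_ ?_ ?_
    · simp only [Finset.mem_sigma, Finset.mem_filter, mem_edg]
      intro p hp
      exact ⟨⟨mem_nbrs_comm.1 hp.2.1, Or.inr hp.1⟩, hp.2.2⟩
    · simp only [Finset.mem_sigma, Finset.mem_filter, mem_edg]
      intro p hp
      exact ⟨hp.1.2.resolve_left hp.2, mem_nbrs_comm.1 hp.1.1, hp.2⟩
    · simp
    · simp
    · simp only [Finset.mem_sigma, Finset.mem_filter]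
      intro p hp
      rw [hσ _ hp.2.2]
      ring
  have e4 : energy (edg Λ) σ =
      ∑ p ∈ (edg Λ).filter (fun p => p.1 ∈ Λ ∧ p.2 ∈ Λ), sval (σ p.1) * sval (σ p.2) +
      ∑ p ∈ (edg Λ).filter (fun p => p.1 ∈ Λ ∧ p.2 ∉ Λ), sval (σ p.1) * sval (σ p.2) +
      ∑ p ∈ (edg Λ).filter (fun p => p.1 ∉ Λ), sval (σ p.1) * sval (σ p.2) := by
    rw [energy, ← Finset.sum_filter_add_sum_filter_not (edg Λ) (fun p => p.1 ∈ Λ),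
      ← Finset.sum_filter_add_sum_filter_not ((edg Λ).filter (fun p => p.1 ∈ Λ))
        (fun p => p.2 ∈ Λ), Finset.filter_filter, Finset.filter_filter]
  rw [e4, ← e1, ← e2, ← e3]
  ring

lemma fill_eq_ext2 (Λ : Finset (ℤ × ℤ)) (η : Cfg2) (τ : ↥Λ → Bool) :
    fill Λ η τ = ext2 Λ η τ := rfl

open Classical in
/-- The frozen finite-volume measure in terms of `av`. -/
lemma isingFV_apply (β : ℝ) (Λ : Finset (ℤ × ℤ)) (η : Cfg2) {s : Set Cfg2}
    (hs : MeasurableSet s) :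
    (isingFV β 0 Λ η s).toReal =
      av (β / 2) (edg Λ) Λ η (fun σ => if σ ∈ s then 1 else 0) := by
  have hw : ∀ τ : ↥Λ → Bool, isingWeight β 0 Λ η (ext2 Λ η τ) =
      wt (β / 2) (edg Λ) (ext2 Λ η τ) := by
    intro τ
    refine isingWeight_eq β Λ η _ (mem_confs.2 fun x hx => ?_)
    simp [ext2, hx]
  rw [isingFV, av, zf, zf, sum_confs_eq, sum_confs_eq]
  simp only [fill_eq_ext2, hw, Measure.smul_apply, Measure.finsetSum_apply, smul_eq_mul,
    Measure.dirac_apply' _ hs]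
  rw [ENNReal.toReal_mul, ENNReal.toReal_inv, ← ENNReal.ofReal_sum_of_nonneg
    (fun τ _ => (wt_pos _ _ _).le), ENNReal.toReal_ofReal
    (Finset.sum_nonneg fun τ _ => (wt_pos _ _ _).le), ENNReal.toReal_sum]
  · rw [mul_comm, ← div_eq_mul_inv]
    congr 1
    · refine Finset.sum_congr rfl fun τ _ => ?_
      rw [ENNReal.toReal_mul, ENNReal.toReal_ofReal (wt_pos _ _ _).le]
      by_cases h : ext2 Λ η τ ∈ s <;> simp [h]
    · simp
  · intro τ _
    refine ENNReal.mul_ne_top ENNReal.ofReal_ne_top ?_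
    by_cases h : ext2 Λ η τ ∈ s <;> simp [h]

end Lattice

section SingleSite

/-- Conditional probability of a minus spin at `v` given its neighbours. -/
noncomputable def qminus (β : ℝ) (v : ℤ × ℤ) (σ : Cfg2) : ℝ :=
  1 / (1 + Real.exp (2 * β * ∑ y ∈ nbrs v, sval (σ y)))

lemma abs_nbr_sum_le (v : ℤ × ℤ) (σ : Cfg2) : |∑ y ∈ nbrs v, sval (σ y)| ≤ 4 := by
  refine (Finset.abs_sum_le_sum_abs _ _).trans ?_
  simp only [abs_sval, Finset.sum_const, nsmul_eq_mul, mul_one]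
  exact_mod_cast card_nbrs_le v

lemma sum_confs_pair {V : Type*} [DecidableEq V] {Λ : Finset V} {v : V} (hv : v ∈ Λ)
    (η : V → Bool) (F : (V → Bool) → ℝ) :
    ∑ σ ∈ confs Λ η, F σ = ∑ ζ ∈ confs (Λ.erase v) η,
      (F (Function.update ζ v true) + F (Function.update ζ v false)) := by
  have h : Λ = Λ.erase v ∪ {v} := by
    ext x; by_cases hx : x = v <;> simp [hx, hv]
  conv_lhs => rw [h]
  rw [sum_confs_union (by simp)]
  refine Finset.sum_congr rfl fun ζ _ => ?_
  rw [confs_singleton]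
  convert Finset.sum_pair (update_true_ne_false v ζ)

lemma wt_update {β : ℝ} {R : Finset (ℤ × ℤ)} {v : ℤ × ℤ} (hv : v ∈ R) (σ : Cfg2) :
    wt (β / 2) (edg R) (Function.update σ v true) =
      wt (β / 2) (edg R) (Function.update σ v false) *
        Real.exp (2 * β * ∑ y ∈ nbrs v, sval (σ y)) := by
  have h := energy_update hv σ
  rw [wt, wt, ← Real.exp_add]
  congr 1
  linear_combination (β / 2) * h

lemma qminus_update (β : ℝ) (v : ℤ × ℤ) (σ : Cfg2) (b : Bool) :
    qminus β v (Function.update σ v b) = qminus β v σ := by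
  rw [qminus, qminus]
  congr 4
  refine Finset.sum_congr rfl fun y hy => ?_
  rw [Function.update_of_ne]
  rintro rfl
  exact not_mem_nbrs_self _ hy

lemma zf_minus {β : ℝ} {R Λ : Finset (ℤ × ℤ)} {v : ℤ × ℤ} (hR : v ∈ R) (hv : v ∈ Λ)
    (η : Cfg2) {F : Cfg2 → ℝ} (hF : ∀ σ b, F (Function.update σ v b) = F σ) :
    zf (β / 2) (edg R) Λ η (fun σ => (if σ v then 0 else 1) * F σ) =
      zf (β / 2) (edg R) Λ η (fun σ => qminus β v σ * F σ) := by
  rw [zf, zf, sum_confs_pair hv, sum_confs_pair hv]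
  refine Finset.sum_congr rfl fun ζ _ => ?_
  simp only [hF, qminus_update, Function.update_self, wt_update hR]
  have : (1 + Real.exp (2 * β * ∑ y ∈ nbrs v, sval (ζ y))) ≠ 0 := by positivity
  rw [qminus]
  simp only [if_true, Bool.false_eq_true, if_false, zero_mul, mul_zero, one_mul, zero_add]
  field_simp
  ring

lemma qminus_ge {β : ℝ} (hβ : 0 < β) (v : ℤ × ℤ) (σ : Cfg2) :
    1 / (1 + Real.exp (8 * β)) ≤ qminus β v σ := by
  rw [qminus]
  have h1 := (abs_le.1 (abs_nbr_sum_le v σ)).2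
  refine one_div_le_one_div_of_le (by positivity) ?_
  have := Real.exp_le_exp.2
    (show 2 * β * ∑ y ∈ nbrs v, sval (σ y) ≤ 8 * β by nlinarith)
  linarith

lemma qminus_le {β : ℝ} (hβ : 0 < β) (v : ℤ × ℤ) (σ : Cfg2) :
    1 / (1 + Real.exp (8 * β)) ≤ 1 - qminus β v σ := by
  rw [qminus]
  have h1 := (abs_le.1 (abs_nbr_sum_le v σ)).1
  have h2 : Real.exp (-(8 * β)) ≤ Real.exp (2 * β * ∑ y ∈ nbrs v, sval (σ y)) := by
    rw [Real.exp_le_exp]; nlinarith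
  rw [Real.exp_neg] at h2
  set x := Real.exp (2 * β * ∑ y ∈ nbrs v, sval (σ y)) with hx
  have hx0 : 0 < x := Real.exp_pos _
  have he : 0 < Real.exp (8 * β) := Real.exp_pos _
  have h3 : 1 - 1 / (1 + x) = x / (1 + x) := by field_simp; ring
  rw [h3, div_le_div_iff₀ (by positivity) (by positivity)]
  have : 1 ≤ x * Real.exp (8 * β) := by
    rw [inv_eq_one_div, div_le_iff₀ he] at h2; exact h2
  nlinarith

lemma sval_mono {a b : Bool} (h : a ≤ b) : sval a ≤ sval b := by
  revert h; cases a <;> cases b <;> simp [sval]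

lemma exists_monotone_qminus {β : ℝ} (hβ : 0 < β) : ∃ c : ℝ, 0 < c ∧
    ∀ v, ∀ u ∈ nbrs v, Monotone (fun σ : Cfg2 => -qminus β v σ - c * sval (σ u)) := by
  set B := Real.exp (8 * β) with hB
  have hB0 : 0 < B := Real.exp_pos _
  have h4 : 1 < Real.exp (4 * β) := by
    rw [← Real.exp_zero, Real.exp_lt_exp]; linarith
  refine ⟨Real.exp (-(8 * β)) * (Real.exp (4 * β) - 1) / (2 * (1 + B) ^ 2), ?_, ?_⟩
  · have := Real.exp_pos (-(8 * β))
    have : 0 < Real.exp (4 * β) - 1 := by linarith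
    positivity
  intro v u hu σ σ' hσ
  have hn : ∀ y, sval (σ y) ≤ sval (σ' y) := fun y => sval_mono (hσ y)
  set x := Real.exp (2 * β * ∑ y ∈ nbrs v, sval (σ y)) with hx
  set z := Real.exp (2 * β * ∑ y ∈ nbrs v, sval (σ' y)) with hz
  have hx0 : 0 < x := Real.exp_pos _
  have hz0 : 0 < z := Real.exp_pos _
  have hq : qminus β v σ = 1 / (1 + x) := rfl
  have hq' : qminus β v σ' = 1 / (1 + z) := rfl
  simp only [hq, hq']
  have hxz : x ≤ z := by
    rw [hx, hz, Real.exp_le_exp]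
    have : ∑ y ∈ nbrs v, sval (σ y) ≤ ∑ y ∈ nbrs v, sval (σ' y) :=
      Finset.sum_le_sum fun y _ => hn y
    nlinarith
  rcases eq_or_ne (σ u) (σ' u) with h | h
  · rw [h]
    have : 1 / (1 + z) ≤ 1 / (1 + x) := by gcongr
    linarith
  · have hs : σ u = false ∧ σ' u = true := by
      have := hσ u
      revert this h
      cases σ u <;> cases σ' u <;> simp
    have hs2 : sval (σ u) = -1 ∧ sval (σ' u) = 1 := by simp [hs.1, hs.2, sval]
    have hsum : ∑ y ∈ nbrs v, sval (σ y) + 2 ≤ ∑ y ∈ nbrs v, sval (σ' y) := by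
      rw [← Finset.add_sum_erase _ _ hu, ← Finset.add_sum_erase _ _ hu, hs2.1, hs2.2]
      have := Finset.sum_le_sum (s := (nbrs v).erase u) fun y _ => hn y
      linarith
    have hz1 : x * Real.exp (4 * β) ≤ z := by
      rw [hx, hz, ← Real.exp_add, Real.exp_le_exp]; nlinarith
    have hx1 : Real.exp (-(8 * β)) ≤ x := by
      rw [hx, Real.exp_le_exp]
      have := (abs_le.1 (abs_nbr_sum_le v σ)).1
      nlinarith
    have hzB : z ≤ B := by
      rw [hz, hB, Real.exp_le_exp]
      have := (abs_le.1 (abs_nbr_sum_le v σ')).2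
      nlinarith
    have key : Real.exp (-(8 * β)) * (Real.exp (4 * β) - 1) / (1 + B) ^ 2 ≤
        1 / (1 + x) - 1 / (1 + z) := by
      have e : 1 / (1 + x) - 1 / (1 + z) = (z - x) / ((1 + x) * (1 + z)) := by
        field_simp; ring
      rw [e]
      have h1 : Real.exp (-(8 * β)) * (Real.exp (4 * β) - 1) ≤ z - x := by
        nlinarith [mul_le_mul_of_nonneg_right hx1 (sub_nonneg.2 h4.le)]
      have h2 : (1 + x) * (1 + z) ≤ (1 + B) ^ 2 := by
        rw [sq]
        exact mul_le_mul (by linarith) (by linarith) (by positivity) (by positivity)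
      exact div_le_div₀ (by linarith) h1 (by positivity) h2
    rw [hs2.1, hs2.2]
    have e2 : Real.exp (-(8 * β)) * (Real.exp (4 * β) - 1) / (2 * (1 + B) ^ 2) =
        (Real.exp (-(8 * β)) * (Real.exp (4 * β) - 1) / (1 + B) ^ 2) / 2 := by
      field_simp
    rw [e2]
    linarith

/-- Logarithmic ratio of partition functions with boundary conditions `η` and minus. -/
noncomputable def logratio (β : ℝ) (R : Finset (ℤ × ℤ)) (η : Cfg2) (Λ : Finset (ℤ × ℤ)) : ℝ :=
  Real.log (zf (β / 2) (edg R) Λ η fun _ => 1) -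
    Real.log (zf (β / 2) (edg R) Λ (fun _ => false) fun _ => 1)

lemma zf_erase_false {β : ℝ} {R Λ : Finset (ℤ × ℤ)} {v : ℤ × ℤ} (hR : v ∈ R) (hv : v ∈ Λ)
    {η : Cfg2} (hη : η v = false) :
    zf (β / 2) (edg R) (Λ.erase v) η (fun _ => 1) =
      zf (β / 2) (edg R) Λ η (fun _ => 1) * av (β / 2) (edg R) Λ η (qminus β v) := by
  have h1 := zf_minus (β := β) hR hv η (F := fun _ => 1) fun _ _ => rfl
  simp only [mul_one] at h1
  have h2 : zf (β / 2) (edg R) Λ η (fun σ => if σ v then 0 else 1) =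
      zf (β / 2) (edg R) (Λ.erase v) η (fun _ => 1) := by
    rw [zf, sum_confs_erase hv]
    have hz : ∑ σ ∈ confs (Λ.erase v) (Function.update η v true),
        wt (β / 2) (edg R) σ * (if σ v then 0 else 1) = 0 := by
      refine Finset.sum_eq_zero fun y hy => ?_
      rw [mem_confs] at hy
      simp [hy v (by simp)]
    have huf : Function.update η v false = η := by
      rw [← hη]; exact Function.update_eq_self v η
    rw [hz, zero_add, huf, zf]
    refine Finset.sum_congr rfl fun y hy => ?_
    rw [mem_confs] at hy
    simp [hy v (by simp), hη]
  rw [← h2, h1, av, mul_div_cancel₀ _ zf_one_pos.ne']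

lemma bdLe_false {V : Type*} (Λ : Finset V) (η : V → Bool) : BdLe Λ (fun _ => false) Λ η :=
  ⟨fun _ _ h => by simp at h, fun _ hx _ => ⟨hx, rfl⟩⟩

lemma dsum_nonneg {V : Type*} {κ : ℝ} (hκ : 0 ≤ κ) (E : Finset (V × V)) (Λ : Finset V)
    (η : V → Bool) (u : V) : 0 ≤ dsum κ E Λ η u := by
  rw [dsum_eq, sub_nonneg]
  exact av_le_av hκ E (bdLe_false Λ η) fun a b h => sval_mono (h u)

lemma logratio_erase {β c : ℝ} (hβ : 0 < β)
    (hc : ∀ v, ∀ u ∈ nbrs v, Monotone (fun σ : Cfg2 => -qminus β v σ - c * sval (σ u)))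
    (hc0 : 0 < c) {R Λ : Finset (ℤ × ℤ)} {v u : ℤ × ℤ} (hR : v ∈ R) (hv : v ∈ Λ)
    (hu : u ∈ nbrs v) {η : Cfg2} (hη : η v = false) :
    c * dsum (β / 2) (edg R) Λ η u ≤ logratio β R η Λ - logratio β R η (Λ.erase v) := by
  have hκ : 0 ≤ β / 2 := by linarith
  set pp := av (β / 2) (edg R) Λ η (qminus β v) with hpp
  set pm := av (β / 2) (edg R) Λ (fun _ => false) (qminus β v) with hpm
  have hlow : ∀ η' : Cfg2, 0 < av (β / 2) (edg R) Λ η' (qminus β v) := by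
    intro η'
    refine lt_of_lt_of_le (b := 1 / (1 + Real.exp (8 * β))) (by positivity) ?_
    have := av_mono (κ := β / 2) (E := edg R) (Λ := Λ) (η := η') fun σ _ => qminus_ge hβ v σ
    rwa [av_const] at this
  have hpp0 : 0 < pp := hlow η
  have hpm0 : 0 < pm := hlow _
  have hpm1 : pm ≤ 1 := by
    have := av_mono (κ := β / 2) (E := edg R) (Λ := Λ) (η := fun _ => false)
      (f := qminus β v) (g := fun _ => 1) fun σ _ => by
        have := qminus_le hβ v σ
        have : 0 < 1 / (1 + Real.exp (8 * β)) := by positivity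
        linarith
    rwa [av_const] at this
  have e1 : logratio β R η Λ - logratio β R η (Λ.erase v) = Real.log pm - Real.log pp := by
    rw [logratio, logratio, zf_erase_false hR hv hη, zf_erase_false hR hv rfl,
      Real.log_mul zf_one_pos.ne' hpp0.ne', Real.log_mul zf_one_pos.ne' hpm0.ne']
    ring
  have hmono := av_le_av hκ (edg R) (bdLe_false Λ η) (hc v u hu)
  have e2 : ∀ η' : Cfg2, av (β / 2) (edg R) Λ η' (fun σ => -qminus β v σ - c * sval (σ u)) =
      -av (β / 2) (edg R) Λ η' (qminus β v) -
        c * av (β / 2) (edg R) Λ η' (fun σ => sval (σ u)) := by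
    intro η'
    rw [av_sub, av_const_mul]
    have := av_const_mul (κ := β / 2) (E := edg R) (Λ := Λ) (η := η') (-1) (qminus β v)
    simp only [neg_mul, one_mul] at this
    rw [this]
  rw [e2, e2] at hmono
  have hd : c * dsum (β / 2) (edg R) Λ η u ≤ pm - pp := by
    rw [dsum_eq]
    linarith
  have hge : pp ≤ pm := by
    have := mul_nonneg hc0.le (dsum_nonneg hκ (edg R) Λ η u)
    linarith
  rw [e1, ← Real.log_div hpm0.ne' hpp0.ne']
  have hl := Real.one_sub_inv_le_log_of_pos (div_pos hpm0 hpp0)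
  rw [inv_div] at hl
  have : pm - pp ≤ 1 - pp / pm := by
    have e : 1 - pp / pm = (pm - pp) / pm := by field_simp
    rw [e, le_div_iff₀ hpm0]
    nlinarith
  linarith

lemma logratio_union {β c : ℝ} (hβ : 0 < β)
    (hc : ∀ v, ∀ u ∈ nbrs v, Monotone (fun σ : Cfg2 => -qminus β v σ - c * sval (σ u)))
    (hc0 : 0 < c) {R Λ T : Finset (ℤ × ℤ)} {η : Cfg2} (up : ℤ × ℤ → ℤ × ℤ)
    (hup : ∀ v, up v ∈ nbrs v) (hT : T ⊆ R) (hη : ∀ v ∈ T, η v = false)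
    (hTΛ : Disjoint T Λ) :
    c * ∑ v ∈ T, dsum (β / 2) (edg R) Λ η (up v) ≤
      logratio β R η (T ∪ Λ) - logratio β R η Λ := by
  induction T using Finset.induction_on with
  | empty => simp
  | insert v T hvT ih =>
    rw [Finset.disjoint_insert_left] at hTΛ
    have h1 := ih (fun x hx => hT (Finset.mem_insert_of_mem hx))
      (fun x hx => hη x (Finset.mem_insert_of_mem hx)) hTΛ.2
    have hmem : v ∈ insert v T ∪ Λ := by simp
    have h2 := logratio_erase hβ hc hc0 (R := R) (hT (Finset.mem_insert_self v T)) hmem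
      (hup v) (hη v (Finset.mem_insert_self v T))
    have e : (insert v T ∪ Λ).erase v = T ∪ Λ := by
      ext x
      simp only [Finset.mem_erase, Finset.mem_union, Finset.mem_insert]
      constructor
      · tauto
      · rintro (h | h)
        · exact ⟨fun h' => hvT (h' ▸ h), Or.inl (Or.inr h)⟩
        · exact ⟨fun h' => hTΛ.1 (h' ▸ h), Or.inr h⟩
    rw [e] at h2
    have h3 : dsum (β / 2) (edg R) Λ η (up v) ≤
        dsum (β / 2) (edg R) (insert v T ∪ Λ) η (up v) := by
      refine dsum_mono (by linarith) _ Finset.subset_union_right ?_ _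
      intro x hx hx'
      rcases Finset.mem_union.1 hx with h | h
      · exact hη x h
      · exact absurd h hx'
    rw [Finset.sum_insert hvT, mul_add]
    have := mul_le_mul_of_nonneg_left h3 hc0.le
    linarith

lemma logratio_abs_le {β : ℝ} (hβ : 0 < β) {R Λ O : Finset (ℤ × ℤ)} {η : Cfg2}
    (hη : ∀ x ∈ R, η x = false) (hO : ∀ x ∉ R, ∀ y ∈ R, x ∈ nbrs y → x ∈ O) :
    |logratio β R η Λ| ≤ 8 * β * O.card := by
  have hcmp : ∀ η₁ η₂ : Cfg2, (∀ x ∈ R, η₁ x = η₂ x) →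
      Real.log (zf (β / 2) (edg R) Λ η₁ fun _ => 1) ≤
        Real.log (zf (β / 2) (edg R) Λ η₂ fun _ => 1) + 8 * β * O.card := by
    intro η₁ η₂ h
    have hz : (zf (β / 2) (edg R) Λ η₁ fun _ => 1) ≤
        Real.exp (8 * β * O.card) * (zf (β / 2) (edg R) Λ η₂ fun _ => 1) := by
      rw [zf, zf, sum_confs_eq, sum_confs_eq, Finset.mul_sum]
      refine Finset.sum_le_sum fun τ _ => ?_
      rw [mul_one, mul_one, wt, wt, ← Real.exp_add, Real.exp_le_exp]
      have hag : ∀ x ∈ R, ext2 Λ η₁ τ x = ext2 Λ η₂ τ x := by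
        intro x hx
        by_cases hxΛ : x ∈ Λ
        · simp [ext2, hxΛ]
        · simp [ext2, hxΛ, h x hx]
      have hd : energy (edg R) (ext2 Λ η₁ τ) - energy (edg R) (ext2 Λ η₂ τ) ≤
          2 * (8 * O.card) := by
        have hs : energy (edg R) (ext2 Λ η₁ τ) - energy (edg R) (ext2 Λ η₂ τ) =
            energy (edg R ∩ edg O) (ext2 Λ η₁ τ) - energy (edg R ∩ edg O) (ext2 Λ η₂ τ) := by
          rw [energy, energy, energy, energy, ← Finset.sum_sub_distrib,
            ← Finset.sum_sub_distrib]
          symm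
          refine Finset.sum_subset Finset.inter_subset_left fun p hp hp' => ?_
          have hpO : p ∉ edg O := fun h' => hp' (Finset.mem_inter.2 ⟨hp, h'⟩)
          rw [mem_edg] at hp hpO
          have h1 : p.1 ∈ R := by
            by_contra hcon
            exact hpO ⟨hp.1, Or.inl (hO _ hcon _ (hp.2.resolve_left hcon)
              (mem_nbrs_comm.1 hp.1))⟩
          have h2 : p.2 ∈ R := by
            by_contra hcon
            exact hpO ⟨hp.1, Or.inr (hO _ hcon _ h1 hp.1)⟩
          rw [hag _ h1, hag _ h2, sub_self]
        have hcard : ((edg R ∩ edg O).card : ℝ) ≤ 8 * O.card := by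
          exact_mod_cast (Finset.card_le_card Finset.inter_subset_right).trans (card_edg_le O)
        have a1 := (abs_le.1 (abs_energy_le (edg R ∩ edg O) (ext2 Λ η₁ τ))).2
        have a2 := (abs_le.1 (abs_energy_le (edg R ∩ edg O) (ext2 Λ η₂ τ))).1
        linarith
      nlinarith
    have := Real.log_le_log zf_one_pos hz
    rw [Real.log_mul (Real.exp_pos _).ne' zf_one_pos.ne', Real.log_exp] at this
    linarith
  rw [logratio, abs_le]
  have h1 := hcmp η (fun _ => false) hη
  have h2 := hcmp (fun _ => false) η fun x hx => (hη x hx).symm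
  constructor <;> linarith

end SingleSite

section Wetting

/-- Boundary condition which is minus on `T` and plus elsewhere. -/
def minusOn (T : Finset (ℤ × ℤ)) : Cfg2 := fun x => !(decide (x ∈ T))

lemma minusOn_of_mem {T : Finset (ℤ × ℤ)} {x : ℤ × ℤ} (h : x ∈ T) : minusOn T x = false := by
  simp [minusOn, h]

lemma minusOn_of_notMem {T : Finset (ℤ × ℤ)} {x : ℤ × ℤ} (h : x ∉ T) : minusOn T x = true := by
  simp [minusOn, h]

/-- The block `[a, b) × [c, d]`. -/
noncomputable def blk (a b c d : ℤ) : Finset (ℤ × ℤ) := Finset.Ico a b ×ˢ Finset.Icc c d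

lemma mem_blk {a b c d : ℤ} {x : ℤ × ℤ} :
    x ∈ blk a b c d ↔ (a ≤ x.1 ∧ x.1 < b) ∧ (c ≤ x.2 ∧ x.2 ≤ d) := by
  simp [blk]

lemma sum_range_windows (n k : ℕ) (g : ℕ → ℝ) :
    ∑ i ∈ Finset.range n, ∑ x ∈ Finset.range k, g (i * k + x) = ∑ x ∈ Finset.range (n * k), g x := by
  induction n with
  | zero => simp
  | succ n ih => rw [Finset.sum_range_succ, ih, Nat.succ_mul, Finset.sum_range_add]

lemma nbrs_add (t x y : ℤ × ℤ) : y + t ∈ nbrs (x + t) ↔ y ∈ nbrs x := by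
  rw [mem_nbrs_iff, mem_nbrs_iff]
  simp only [Prod.fst_add, Prod.snd_add]
  omega

lemma dsum_translate (κ : ℝ) (t : ℤ × ℤ) {Λ Λ' : Finset (ℤ × ℤ)} (hΛ : ∀ x, x + t ∈ Λ' ↔ x ∈ Λ)
    {η η' : Cfg2} (hη : ∀ x, x ∉ Λ → (∃ y ∈ Λ, x ∈ nbrs y) → η' (x + t) = η x) {u : ℤ × ℤ}
    (hu : u ∈ Λ) : dsum κ (edg Λ) Λ η u = dsum κ (edg Λ') Λ' η' (u + t) := by
  refine dsum_transport κ (Equiv.addRight t) ?_ ?_ ?_ hu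
  · intro x y
    rw [Equiv.coe_addRight]
    exact nbrs_add t x y
  · simpa using hΛ
  · simpa using hη

lemma outer_border {a b n : ℤ} {x y : ℤ × ℤ} (hx : x ∉ blk a b 0 n) (hy : y ∈ blk a b 0 n)
    (h : x ∈ nbrs y) : x ∈ Finset.Ico a b ×ˢ {-1, n + 1} ∪ {a - 1, b} ×ˢ Finset.Icc 0 n := by
  rw [mem_blk] at hx hy
  rw [mem_nbrs_iff] at h
  simp only [Finset.mem_union, Finset.mem_product, Finset.mem_Ico, Finset.mem_Icc,
    Finset.mem_insert, Finset.mem_singleton]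
  omega

lemma wetting_row_sum {β c : ℝ} (hβ : 0 < β)
    (hc : ∀ v, ∀ u ∈ nbrs v, Monotone (fun σ : Cfg2 => -qminus β v σ - c * sval (σ u)))
    (hc0 : 0 < c) {a b : ℤ} {n : ℕ} (hab : a ≤ b) :
    c * ∑ j ∈ Finset.range n, ∑ x ∈ Finset.Ico a b,
      dsum (β / 2) (edg (blk a b 0 n)) (blk a b (j + 1) n) (minusOn (blk a b 0 n)) (x, j + 1) ≤
    16 * β * (2 * (b - a) + 2 * (n + 1)) := by
  set R := blk a b 0 n with hR
  set η := minusOn R with hη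
  have hrow : ∀ j ∈ Finset.range n, c * ∑ x ∈ Finset.Ico a b,
      dsum (β / 2) (edg R) (blk a b (j + 1) n) η (x, j + 1) ≤
      logratio β R η (blk a b (j : ℕ) n) - logratio β R η (blk a b ((j + 1 : ℕ) : ℤ) n) := by
    intro j hj
    rw [Finset.mem_range] at hj
    have hTR : blk a b j j ⊆ R := by
      intro x; rw [hR, mem_blk, mem_blk]; omega
    have h := logratio_union hβ hc hc0 (R := R) (Λ := blk a b ((j + 1 : ℕ) : ℤ) n)
      (T := blk a b j j) (η := η) (fun x => (x.1, x.2 + 1))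
      (fun v => by rw [mem_nbrs_iff]; simp) hTR
      (fun v hv => minusOn_of_mem (hTR hv))
      (by
        rw [Finset.disjoint_left]; intro x; rw [mem_blk, mem_blk]; push_cast; omega)
    have e1 : blk a b j j ∪ blk a b ((j + 1 : ℕ) : ℤ) n = blk a b (j : ℕ) n := by
      ext x; rw [Finset.mem_union, mem_blk, mem_blk, mem_blk]; push_cast; omega
    rw [e1] at h
    refine le_trans (le_of_eq ?_) h
    rw [show blk a b j j = Finset.Ico a b ×ˢ {(j : ℤ)} by simp [blk], Finset.sum_product]
    simp
  rw [Finset.mul_sum]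
  refine (Finset.sum_le_sum hrow).trans ?_
  rw [Finset.sum_range_sub' (fun j : ℕ => logratio β R η (blk a b (j : ℕ) n))]
  set O : Finset (ℤ × ℤ) := Finset.Ico a b ×ˢ {-1, (n : ℤ) + 1} ∪ {a - 1, b} ×ˢ Finset.Icc 0 (n : ℤ)
    with hO
  have hb : ∀ Λ, |logratio β R η Λ| ≤ 8 * β * O.card := fun Λ =>
    logratio_abs_le hβ (fun x hx => minusOn_of_mem hx) fun x hx y hy h => outer_border hx hy h
  have hcard : (O.card : ℝ) ≤ 2 * (b - a) + 2 * (n + 1) := by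
    have h1 : O.card ≤ (b - a).toNat * 2 + 2 * (n + 1) := by
      refine (Finset.card_union_le _ _).trans ?_
      rw [Finset.card_product, Finset.card_product, Int.card_Ico, Int.card_Icc]
      gcongr
      · exact Finset.card_le_two
      · exact Finset.card_le_two
      · omega
    have h2 : (((b - a).toNat : ℤ) : ℝ) = b - a := by
      rw [Int.toNat_of_nonneg (by omega)]; push_cast; ring
    have h3 : (O.card : ℝ) ≤ ((b - a).toNat : ℝ) * 2 + 2 * (n + 1) := by exact_mod_cast h1
    have h4 : ((b - a).toNat : ℝ) = b - a := by exact_mod_cast h2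
    rw [h4] at h3
    linarith
  have h1 := (abs_le.1 (hb (blk a b (0 : ℕ) n))).2
  have h2 := (abs_le.1 (hb (blk a b (n : ℕ) n))).1
  have := mul_le_mul_of_nonneg_left hcard (show 0 ≤ 16 * β by positivity)
  linarith

/-- There are arbitrarily flat slabs above a minus interval on which the plus and minus
magnetizations above a prescribed window are arbitrarily close to each other. -/
lemma wetting {β : ℝ} (hβ : 0 < β) {k : ℕ} (hk : 1 ≤ k) {ε : ℝ} (hε : 0 < ε) :
    ∃ a b M : ℤ, a ≤ -1 ∧ (k : ℤ) + 1 ≤ b ∧ 1 ≤ M ∧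
      ∑ x ∈ Finset.range k, dsum (β / 2) (edg (blk a b 1 M)) (blk a b 1 M)
        (minusOn (blk a b 0 0)) ((x : ℤ), 1) ≤ ε := by
  obtain ⟨c, hc0, hc⟩ := exists_monotone_qminus hβ
  by_contra! hcon
  obtain ⟨n, hn⟩ := exists_nat_gt (max 1 (16 * β * (2 * k + 10) / (c * ε)))
  have hn1 : (1 : ℝ) < n := (le_max_left _ _).trans_lt hn
  have hn2 : 16 * β * (2 * k + 10) < n * (c * ε) := by
    rw [← div_lt_iff₀ (by positivity)]
    exact (le_max_right _ _).trans_lt hn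
  have hκ : (0 : ℝ) ≤ β / 2 := by linarith
  set a : ℤ := -1 with ha
  set b : ℤ := n * k + 1 with hb
  have hnk : (0 : ℤ) ≤ n * k := by positivity
  have hrow := wetting_row_sum hβ hc hc0 (a := a) (b := b) (n := n) (by omega)
  have hwin : ∀ i < n, ∀ j < n, ε < ∑ x ∈ Finset.range k,
      dsum (β / 2) (edg (blk a b 0 n)) (blk a b (j + 1) n) (minusOn (blk a b 0 n))
        (((i * k + x : ℕ) : ℤ), (j : ℤ) + 1) := by
    intro i hi j hj
    have hik : (i : ℤ) * k + k ≤ n * k := by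
      have : ((i + 1) * k : ℕ) ≤ n * k := Nat.mul_le_mul_right k hi
      zify at this
      linarith
    have hik0 : (0 : ℤ) ≤ i * k := by positivity
    set p : ℤ := i * k with hp
    have h := hcon (a - p) (b - p) (n - j) (by omega) (by omega) (by omega)
    refine h.trans_le (Finset.sum_le_sum fun x hx => le_of_eq ?_)
    rw [Finset.mem_range] at hx
    rw [dsum_edg_subset (R := blk a b 0 n) (β / 2) (by
      intro x; rw [mem_blk, mem_blk]; omega)]
    have e2 : (((i * k + x : ℕ) : ℤ), (j : ℤ) + 1) =
        ((x : ℤ), (1 : ℤ)) + (p, (j : ℤ)) := by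
      simp only [Prod.mk_add_mk, Prod.mk.injEq]
      push_cast
      omega
    rw [e2]
    refine dsum_translate (β / 2) _ ?_ ?_ ?_
    · intro y
      rw [mem_blk, mem_blk]
      simp only [Prod.fst_add, Prod.snd_add]
      omega
    · rintro y hy ⟨z, hz, hyz⟩
      have : y + (p, (j : ℤ)) ∈ blk a b 0 n ↔
          y ∈ blk (a - p) (b - p) 0 0 := by
        rw [mem_nbrs_iff] at hyz
        rw [mem_blk] at *
        rw [mem_blk]
        simp only [Prod.fst_add, Prod.snd_add]
        omega
      rw [minusOn, minusOn]
      simp only [this]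
    · rw [mem_blk]
      constructor <;> constructor <;> simp only <;> omega
  have hlow : ∀ j < n, n * ε ≤ ∑ x ∈ Finset.Ico a b,
      dsum (β / 2) (edg (blk a b 0 n)) (blk a b (j + 1) n) (minusOn (blk a b 0 n))
        (x, (j : ℤ) + 1) := by
    intro j hj
    set g : ℤ → ℝ := fun x => dsum (β / 2) (edg (blk a b 0 n)) (blk a b (j + 1) n)
      (minusOn (blk a b 0 n)) (x, (j : ℤ) + 1) with hg
    have h1 : ∑ x ∈ Finset.range (n * k), g (x : ℤ) ≤ ∑ x ∈ Finset.Ico a b, g x := by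
      have e : ∑ x ∈ Finset.range (n * k), g (x : ℤ) =
          ∑ x ∈ (Finset.range (n * k)).image (fun x : ℕ => (x : ℤ)), g x := by
        rw [Finset.sum_image]
        intro x _ y _ h
        simpa using h
      rw [e]
      refine Finset.sum_le_sum_of_subset_of_nonneg ?_ fun x _ _ => dsum_nonneg hκ _ _ _ _
      intro x hx
      simp only [Finset.mem_image, Finset.mem_range] at hx
      obtain ⟨y, hy, rfl⟩ := hx
      zify at hy
      rw [Finset.mem_Ico]
      omega
    refine le_trans ?_ h1
    rw [← sum_range_windows n k fun x => g (x : ℤ)]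
    have := Finset.card_nsmul_le_sum (Finset.range n)
      (fun i => ∑ x ∈ Finset.range k, g ((i * k + x : ℕ) : ℤ)) ε
      fun i hi => (hwin i (Finset.mem_range.1 hi) j hj).le
    simpa using this
  have htot := Finset.card_nsmul_le_sum (Finset.range n) _ _
    fun j hj => hlow j (Finset.mem_range.1 hj)
  rw [Finset.card_range, nsmul_eq_mul] at htot
  have h1 := (mul_le_mul_of_nonneg_left htot hc0.le).trans hrow
  have h2 : (2 * ((b : ℝ) - a) + 2 * (n + 1)) ≤ n * (2 * k + 10) := by
    rw [ha, hb]
    push_cast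
    linarith
  have h3 := mul_le_mul_of_nonneg_left h2 (show 0 ≤ 16 * β by positivity)
  have h4 := mul_lt_mul_of_pos_left hn2 (show (0 : ℝ) < n by linarith)
  linarith

end Wetting

section Slab

lemma av_diff_le {κ : ℝ} (hκ : 0 ≤ κ) (E : Finset ((ℤ × ℤ) × (ℤ × ℤ))) {Λ T : Finset (ℤ × ℤ)}
    {η η' : Cfg2} (hle : BdLe Λ η Λ η') {f : Cfg2 → ℝ} {B : ℝ} (hB : ∀ σ, |f σ| ≤ B)
    (hf : ∀ σ σ' : Cfg2, (∀ x ∈ T, σ x = σ' x) → f σ = f σ') :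
    |av κ E Λ η' f - av κ E Λ η f| ≤ B * ∑ y ∈ T,
      (av κ E Λ η' (fun σ => sval (σ y)) - av κ E Λ η (fun σ => sval (σ y))) := by
  have hB0 : 0 ≤ B := (abs_nonneg _).trans (hB fun _ => true)
  have hmono : ∀ g : Cfg2 → ℝ, (∀ σ, |g σ| ≤ B) →
      (∀ σ σ' : Cfg2, (∀ x ∈ T, σ x = σ' x) → g σ = g σ') →
      Monotone fun σ => g σ + B * ∑ y ∈ T, sval (σ y) := by
    intro g hg hgT σ σ' h
    simp only
    by_cases heq : ∀ x ∈ T, σ x = σ' x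
    · rw [hgT σ σ' heq, Finset.sum_congr rfl fun x hx => by rw [heq x hx]]
    · push Not at heq
      obtain ⟨x, hx, hne⟩ := heq
      have h1 : ∑ y ∈ T, sval (σ y) + 2 ≤ ∑ y ∈ T, sval (σ' y) := by
        rw [← Finset.add_sum_erase _ _ hx, ← Finset.add_sum_erase _ _ hx]
        have h2 := Finset.sum_le_sum (s := T.erase x) fun y _ => sval_mono (h y)
        have h3 : sval (σ x) + 2 ≤ sval (σ' x) := by
          have := h x
          revert this hne
          cases σ x <;> cases σ' x <;> norm_num [sval]
        linarith
      have h4 := (abs_le.1 (hg σ)).2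
      have h5 := (abs_le.1 (hg σ')).1
      nlinarith
  have hav : ∀ g : Cfg2 → ℝ, ∀ η₀ : Cfg2, av κ E Λ η₀ (fun σ => g σ + B * ∑ y ∈ T, sval (σ y)) =
      av κ E Λ η₀ g + B * ∑ y ∈ T, av κ E Λ η₀ (fun σ => sval (σ y)) := by
    intro g η₀
    rw [av_add, av_const_mul, av_sum]
  have h1 := av_le_av hκ E hle (hmono f hB hf)
  have h2 := av_le_av hκ E hle (hmono (fun σ => -f σ) (fun σ => by rw [abs_neg]; exact hB σ)
    fun σ σ' h => by rw [hf σ σ' h])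
  rw [hav, hav] at h1 h2
  have hneg : ∀ η₀ : Cfg2, av κ E Λ η₀ (fun σ => -f σ) = -av κ E Λ η₀ f := by
    intro η₀
    have := av_const_mul (κ := κ) (E := E) (Λ := Λ) (η := η₀) (-1) f
    simpa using this
  rw [hneg, hneg] at h2
  rw [Finset.sum_sub_distrib, abs_le]
  constructor <;> linarith

/-- Change of weight when the spins on `S` are replaced by `τ`. -/
noncomputable def reweight (κ : ℝ) (S : Finset (ℤ × ℤ)) (τ : ↥S → Bool) (σ : Cfg2) : ℝ :=
  Real.exp (κ * (energy (edg S) (ext2 S σ τ) - energy (edg S) σ))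

lemma wt_ext2 (κ : ℝ) {S G : Finset (ℤ × ℤ)} (hS : S ⊆ G) (τ : ↥S → Bool) (σ : Cfg2) :
    wt κ (edg G) (ext2 S σ τ) = wt κ (edg G) σ * reweight κ S τ σ := by
  have h : ∀ σ' : Cfg2, energy (edg G) σ' = energy (edg G \ edg S) σ' + energy (edg S) σ' := by
    intro σ'
    rw [← energy_union Finset.sdiff_disjoint, Finset.sdiff_union_of_subset (edg_mono hS)]
  have h2 : energy (edg G \ edg S) (ext2 S σ τ) = energy (edg G \ edg S) σ := by
    refine energy_congr fun p hp => ?_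
    rw [Finset.mem_sdiff] at hp
    have := edg_sdiff_away p hp.1 hp.2
    simp [ext2, this.1, this.2]
  rw [wt, wt, reweight, ← Real.exp_add, h, h σ, h2]
  congr 1
  ring

lemma zf_split_on (κ : ℝ) {S B : Finset (ℤ × ℤ)} (hSB : Disjoint S B) {η η₀ : Cfg2}
    (hη : ∀ x, x ∉ S → η x = η₀ x) {f : Cfg2 → ℝ}
    (hf : ∀ σ σ' : Cfg2, (∀ x ∈ S, σ x = σ' x) → f σ = f σ') :
    zf κ (edg (S ∪ B)) (S ∪ B) η f = ∑ τ : ↥S → Bool, f (ext2 S (fun _ => false) τ) *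
      (zf κ (edg (S ∪ B)) B η₀ (fun _ => 1) * av κ (edg B) B η₀ (reweight κ S τ)) := by
  rw [zf, sum_confs_union hSB, sum_confs_eq]
  refine Finset.sum_congr rfl fun τ _ => ?_
  rw [← av_edg_subset κ (Finset.subset_union_right (s₁ := S)), av,
    mul_div_cancel₀ _ zf_one_pos.ne', zf, Finset.mul_sum, sum_confs_eq, sum_confs_eq]
  refine Finset.sum_congr rfl fun ρ _ => ?_
  have e : ext2 B (ext2 S η τ) ρ = ext2 S (ext2 B η₀ ρ) τ := by
    funext x
    by_cases h1 : x ∈ S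
    · have h2 : x ∉ B := Finset.disjoint_left.1 hSB h1
      simp [ext2, h1, h2]
    · by_cases h2 : x ∈ B
      · simp [ext2, h1, h2]
      · simp [ext2, h1, h2, hη x h1]
  rw [e, wt_ext2 κ Finset.subset_union_left, hf (ext2 S (ext2 B η₀ ρ) τ) (ext2 S (fun _ => false) τ)]
  · ring
  · intro x hx
    simp [ext2, hx]

lemma sum_ratio_le {ι : Type*} (s : Finset ι) (f p q : ι → ℝ) (hf : ∀ i, 0 ≤ f i)
    (hq : ∀ i, 0 ≤ q i) (h1 : ∀ i, p i ≤ 2 * q i) (h2 : ∀ i, q i ≤ 2 * p i)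
    (hp0 : 0 < ∑ i ∈ s, p i) :
    (∑ i ∈ s, f i * p i) / ∑ i ∈ s, p i ≤ 4 * ((∑ i ∈ s, f i * q i) / ∑ i ∈ s, q i) := by
  have a1 : ∑ i ∈ s, f i * p i ≤ 2 * ∑ i ∈ s, f i * q i := by
    rw [Finset.mul_sum]
    exact Finset.sum_le_sum fun i _ => by nlinarith [hf i, h1 i]
  have a2 : ∑ i ∈ s, q i ≤ 2 * ∑ i ∈ s, p i := by
    rw [Finset.mul_sum]
    exact Finset.sum_le_sum fun i _ => h2 i
  have a3 : ∑ i ∈ s, p i ≤ 2 * ∑ i ∈ s, q i := by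
    rw [Finset.mul_sum]
    exact Finset.sum_le_sum fun i _ => h1 i
  have hq0 : 0 < ∑ i ∈ s, q i := by linarith
  have hfq : 0 ≤ ∑ i ∈ s, f i * q i := Finset.sum_nonneg fun i _ => mul_nonneg (hf i) (hq i)
  rw [← mul_div_assoc, div_le_div_iff₀ hp0 hq0]
  calc _ ≤ (2 * ∑ i ∈ s, f i * q i) * (2 * ∑ i ∈ s, p i) :=
        mul_le_mul a1 a2 hq0.le (by positivity)
    _ = _ := by ring

lemma exp_neg_le_reweight {κ : ℝ} (hκ : 0 ≤ κ) (S : Finset (ℤ × ℤ)) (τ : ↥S → Bool) (σ : Cfg2) :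
    Real.exp (-(16 * κ * S.card)) ≤ reweight κ S τ σ ∧
      reweight κ S τ σ ≤ Real.exp (16 * κ * S.card) := by
  have hc : ((edg S).card : ℝ) ≤ 8 * S.card := by exact_mod_cast card_edg_le S
  have h1 := abs_le.1 (abs_energy_le (edg S) (ext2 S σ τ))
  have h2 := abs_le.1 (abs_energy_le (edg S) σ)
  rw [reweight, Real.exp_le_exp, Real.exp_le_exp]
  constructor <;> nlinarith

lemma reweight_local (κ : ℝ) (S : Finset (ℤ × ℤ)) (τ : ↥S → Bool) {σ σ' : Cfg2}
    (h : ∀ x ∈ S ∪ S.biUnion nbrs, σ x = σ' x) : reweight κ S τ σ = reweight κ S τ σ' := by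
  have hm : ∀ p ∈ edg S, p.1 ∈ S ∪ S.biUnion nbrs ∧ p.2 ∈ S ∪ S.biUnion nbrs := by
    intro p hp
    rw [mem_edg] at hp
    simp only [Finset.mem_union, Finset.mem_biUnion]
    rcases hp.2 with h | h
    · exact ⟨Or.inl h, Or.inr ⟨_, h, hp.1⟩⟩
    · exact ⟨Or.inr ⟨_, h, mem_nbrs_comm.1 hp.1⟩, Or.inl h⟩
  have h2 : ∀ x ∈ S ∪ S.biUnion nbrs, ext2 S σ τ x = ext2 S σ' τ x := by
    intro x hx
    simp only [ext2, h x hx]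
  rw [reweight, reweight, energy_congr fun p hp => ⟨h _ (hm p hp).1, h _ (hm p hp).2⟩,
    energy_congr fun p hp => ⟨h2 _ (hm p hp).1, h2 _ (hm p hp).2⟩]

lemma av_comparable {κ : ℝ} (hκ : 0 ≤ κ) {S B : Finset (ℤ × ℤ)} (hSB : Disjoint S B)
    {η η₀ : Cfg2} (hη : ∀ x, x ∉ S → η x = η₀ x)
    (hsmall : ∑ y ∈ S ∪ S.biUnion nbrs, dsum κ (edg B) B η₀ y ≤
      Real.exp (-(32 * κ * S.card)) / 2) {f : Cfg2 → ℝ} (hf0 : ∀ σ, 0 ≤ f σ)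
    (hf : ∀ σ σ' : Cfg2, (∀ x ∈ S, σ x = σ' x) → f σ = f σ') :
    av κ (edg (S ∪ B)) (S ∪ B) η f ≤ 4 * av κ (edg (S ∪ B)) (S ∪ B) (fun _ => false) f ∧
      av κ (edg (S ∪ B)) (S ∪ B) (fun _ => false) f ≤
        4 * av κ (edg (S ∪ B)) (S ∪ B) η f := by
  have hr0 : ∀ τ σ, 0 < reweight κ S τ σ := fun τ σ => Real.exp_pos _
  set p : (↥S → Bool) → ℝ := fun τ => av κ (edg B) B η₀ (reweight κ S τ)
  set q : (↥S → Bool) → ℝ := fun τ => av κ (edg B) B (fun _ => false) (reweight κ S τ)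
  have hlow : ∀ (η' : Cfg2) τ,
      Real.exp (-(16 * κ * S.card)) ≤ av κ (edg B) B η' (reweight κ S τ) := by
    intro η' τ
    have := av_mono (κ := κ) (E := edg B) (Λ := B) (η := η')
      fun σ _ => (exp_neg_le_reweight hκ S τ σ).1
    rwa [av_const] at this
  have hdiff : ∀ τ, |p τ - q τ| ≤ Real.exp (-(16 * κ * S.card)) / 2 := by
    intro τ
    have h := av_diff_le hκ (edg B) (bdLe_false B η₀) (f := reweight κ S τ)
      (B := Real.exp (16 * κ * S.card)) (T := S ∪ S.biUnion nbrs)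
      (fun σ => by rw [abs_of_pos (hr0 τ σ)]; exact (exp_neg_le_reweight hκ S τ σ).2)
      fun σ σ' h => reweight_local κ S τ h
    simp only [← dsum_eq] at h
    refine h.trans ((mul_le_mul_of_nonneg_left hsmall (Real.exp_pos _).le).trans (le_of_eq ?_))
    rw [← mul_div_assoc, ← Real.exp_add]
    congr 2
    ring
  have h1 : ∀ τ, p τ ≤ 2 * q τ := fun τ => by
    have := (abs_le.1 (hdiff τ)).2
    have := hlow (fun _ => false) τ
    have := Real.exp_pos (-(16 * κ * S.card))
    simp only [p, q] at *
    linarith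
  have h2 : ∀ τ, q τ ≤ 2 * p τ := fun τ => by
    have := (abs_le.1 (hdiff τ)).1
    have := hlow η₀ τ
    have := Real.exp_pos (-(16 * κ * S.card))
    simp only [p, q] at *
    linarith
  have hp0 : ∀ τ, 0 < p τ := fun τ => (Real.exp_pos _).trans_le (hlow _ τ)
  have hq0 : ∀ τ, 0 < q τ := fun τ => (Real.exp_pos _).trans_le (hlow _ τ)
  have hav : ∀ η η₀ : Cfg2, (∀ x, x ∉ S → η x = η₀ x) → av κ (edg (S ∪ B)) (S ∪ B) η f =
      (∑ τ : ↥S → Bool, f (ext2 S (fun _ => false) τ) * av κ (edg B) B η₀ (reweight κ S τ)) /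
      ∑ τ : ↥S → Bool, av κ (edg B) B η₀ (reweight κ S τ) := by
    intro η η₀ hη
    have hZ : zf κ (edg (S ∪ B)) B η₀ (fun _ => 1) ≠ 0 := zf_one_pos.ne'
    rw [av, zf_split_on κ hSB hη hf, zf_split_on κ hSB hη fun _ _ _ => rfl]
    have e : ∀ g : (↥S → Bool) → ℝ, ∑ τ, g τ * (zf κ (edg (S ∪ B)) B η₀ (fun _ => 1) *
        av κ (edg B) B η₀ (reweight κ S τ)) = zf κ (edg (S ∪ B)) B η₀ (fun _ => 1) *
        ∑ τ, g τ * av κ (edg B) B η₀ (reweight κ S τ) := by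
      intro g
      rw [Finset.mul_sum]
      exact Finset.sum_congr rfl fun τ _ => by ring
    rw [e, e, mul_div_mul_left _ _ hZ]
    simp
  rw [hav η η₀ hη, hav _ (fun _ => false) fun _ _ => rfl]
  exact ⟨sum_ratio_le _ _ p q (fun τ => hf0 _) (fun τ => (hq0 τ).le) h1 h2
      (Finset.sum_pos (fun τ _ => hp0 τ) Finset.univ_nonempty),
    sum_ratio_le _ _ q p (fun τ => hf0 _) (fun τ => (hp0 τ).le) h2 h1
      (Finset.sum_pos (fun τ _ => hq0 τ) Finset.univ_nonempty)⟩

lemma av_of_notMem {κ : ℝ} {E : Finset ((ℤ × ℤ) × (ℤ × ℤ))} {Λ : Finset (ℤ × ℤ)} {η : Cfg2}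
    {u : ℤ × ℤ} (hu : u ∉ Λ) : av κ E Λ η (fun σ => sval (σ u)) = sval (η u) := by
  rw [av_congr (g := fun _ => sval (η u)), av_const]
  intro σ hσ
  rw [mem_confs] at hσ
  rw [hσ u hu]

lemma dsum_of_notMem {κ : ℝ} {E : Finset ((ℤ × ℤ) × (ℤ × ℤ))} {Λ : Finset (ℤ × ℤ)} {η : Cfg2}
    {u : ℤ × ℤ} (hu : u ∉ Λ) (hη : η u = false) : dsum κ E Λ η u = 0 := by
  rw [dsum_eq, av_of_notMem hu, av_of_notMem hu, hη, sub_self]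

/-- Reflection in the horizontal axis. -/
def reflY : ℤ × ℤ ≃ ℤ × ℤ := (Equiv.refl ℤ).prodCongr (Equiv.neg ℤ)

lemma reflY_apply (x : ℤ × ℤ) : reflY x = (x.1, -x.2) := rfl

lemma reflY_nbrs (x y : ℤ × ℤ) : reflY y ∈ nbrs (reflY x) ↔ y ∈ nbrs x := by
  simp only [mem_nbrs_iff, reflY_apply]
  omega

lemma reflY_blk (a b M : ℤ) (x : ℤ × ℤ) : reflY x ∈ blk a b (-M) (-1) ↔ x ∈ blk a b 1 M := by
  simp only [mem_blk, reflY_apply]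
  omega

lemma sum_blk_row (k : ℕ) (j : ℤ) (g : ℤ × ℤ → ℝ) :
    ∑ x ∈ blk 0 k j j, g x = ∑ x ∈ Finset.range k, g ((x : ℤ), j) := by
  rw [show blk 0 k j j = (Finset.range k).image fun x : ℕ => ((x : ℤ), j) by
    ext ⟨x, y⟩
    simp only [mem_blk, Finset.mem_image, Finset.mem_range, Prod.mk.injEq]
    constructor
    · rintro ⟨⟨h1, h2⟩, h3, h4⟩
      exact ⟨x.toNat, by omega, by omega, by omega⟩
    · rintro ⟨z, h1, h2, h3⟩
      omega]
  rw [Finset.sum_image]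
  intro x _ y _ h
  simpa using h

lemma blk_far (a b M : ℤ) : ∀ x ∈ blk a b 1 M, ∀ y ∈ blk a b (-M) (-1), y ∉ nbrs x := by
  intro x hx y hy h
  rw [mem_blk] at hx hy
  rw [mem_nbrs_iff] at h
  omega

lemma blk_disjoint (a b M : ℤ) : Disjoint (blk a b 1 M) (blk a b (-M) (-1)) := by
  rw [Finset.disjoint_left]
  intro x hx hy
  rw [mem_blk] at hx hy
  omega

/-- Two slabs above and below the line in which the influence of a minus window in the line
is the same, up to a factor, for plus and minus boundary conditions. -/
lemma exists_slab {β : ℝ} (hβ : 0 < β) {k : ℕ} (hk : 1 ≤ k) :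
    ∃ a b M : ℤ, a ≤ -1 ∧ (k : ℤ) + 1 ≤ b ∧ 1 ≤ M ∧
      ∀ f : Cfg2 → ℝ, (∀ σ, 0 ≤ f σ) →
      (∀ σ σ' : Cfg2, (∀ x ∈ blk 0 k 0 0, σ x = σ' x) → f σ = f σ') →
      ∀ G, G = blk 0 k 0 0 ∪ (blk a b 1 M ∪ blk a b (-M) (-1)) →
      av (β / 2) (edg G) G (minusOn (blk a b 0 0 \ blk 0 k 0 0)) f ≤
          4 * av (β / 2) (edg G) G (fun _ => false) f ∧
        av (β / 2) (edg G) G (fun _ => false) f ≤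
          4 * av (β / 2) (edg G) G (minusOn (blk a b 0 0 \ blk 0 k 0 0)) f := by
  have hκ : 0 ≤ β / 2 := by linarith
  obtain ⟨a, b, M, ha, hb, hM, h⟩ := wetting hβ hk
    (show 0 < Real.exp (-(32 * (β / 2) * (blk 0 k 0 0).card)) / 4 by positivity)
  refine ⟨a, b, M, ha, hb, hM, fun f hf0 hf G hG => ?_⟩
  subst hG
  set U := blk a b 1 M
  set D := blk a b (-M) (-1)
  set S := blk 0 k 0 0
  set η₀ := minusOn (blk a b 0 0)
  have hUD : Disjoint U D := blk_disjoint a b M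
  have hfar : ∀ x ∈ U, ∀ y ∈ D, y ∉ nbrs x := blk_far a b M
  have hfar' : ∀ x ∈ D, ∀ y ∈ U, y ∉ nbrs x := fun x hx y hy h =>
    hfar y hy x hx (mem_nbrs_comm.1 h)
  refine av_comparable hκ ?_ (η₀ := η₀) ?_ ?_ hf0 hf
  · rw [Finset.disjoint_left]
    intro x hx hx'
    rw [Finset.mem_union, mem_blk, mem_blk] at hx'
    rw [mem_blk] at hx
    omega
  · intro x hx
    simp [η₀, minusOn, hx]
  have hup : ∑ y ∈ blk 0 k 1 1, dsum (β / 2) (edg (U ∪ D)) (U ∪ D) η₀ y ≤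
      Real.exp (-(32 * (β / 2) * S.card)) / 4 := by
    rw [sum_blk_row]
    refine le_trans (Finset.sum_le_sum fun x _ => le_of_eq ?_) h
    refine dsum_decouple _ hUD hfar _ ?_
    rw [mem_blk]
    simp only
    omega
  have hdown : ∑ y ∈ blk 0 k (-1) (-1), dsum (β / 2) (edg (U ∪ D)) (U ∪ D) η₀ y ≤
      Real.exp (-(32 * (β / 2) * S.card)) / 4 := by
    rw [sum_blk_row]
    refine le_trans (Finset.sum_le_sum fun x hx => le_of_eq ?_) h
    rw [Finset.mem_range] at hx
    rw [Finset.union_comm, dsum_decouple _ hUD.symm hfar']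
    · symm
      refine dsum_transport _ reflY reflY_nbrs (reflY_blk a b M) ?_ ?_
      · rintro y hy ⟨z, hz, hyz⟩
        simp only [η₀, minusOn, mem_blk, reflY_apply]
        congr 2
        simp only [eq_iff_iff]
        omega
      · rw [mem_blk]
        constructor <;> constructor <;> simp only <;> omega
    · rw [mem_blk]
      simp only
      omega
  have hzero : ∑ y ∈ blk a b 0 0, dsum (β / 2) (edg (U ∪ D)) (U ∪ D) η₀ y = 0 := by
    refine Finset.sum_eq_zero fun y hy => dsum_of_notMem ?_ (minusOn_of_mem hy)
    rw [mem_blk] at hy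
    rw [Finset.mem_union, mem_blk, mem_blk]
    omega
  have hnn := fun y => dsum_nonneg hκ (edg (U ∪ D)) (U ∪ D) η₀ y
  have hsub : S ∪ S.biUnion nbrs ⊆ blk a b 0 0 ∪ (blk 0 k 1 1 ∪ blk 0 k (-1) (-1)) := by
    intro x hx
    simp only [Finset.mem_union, Finset.mem_biUnion, mem_blk, mem_nbrs_iff, S] at hx ⊢
    rcases hx with hx | ⟨y, hy, hx⟩ <;> omega
  refine (Finset.sum_le_sum_of_subset_of_nonneg hsub fun y _ _ => hnn y).trans ?_
  rw [Finset.sum_union (by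
      rw [Finset.disjoint_left]; intro x; simp only [Finset.mem_union, mem_blk]; omega),
    Finset.sum_union (by rw [Finset.disjoint_left]; intro x; simp only [mem_blk]; omega), hzero]
  linarith

end Slab

section Duality

lemma energy_symm {V ι : Type*} [DecidableEq V] (E : Finset ι) (p q : ι → V)
    (hinj : ∀ e ∈ E, ∀ e' ∈ E, p e = p e' → q e = q e' → e = e')
    (hne : ∀ e ∈ E, ∀ e' ∈ E, p e = q e' → q e ≠ p e') (σ : V → Bool) :
    energy (E.image (fun e => (p e, q e)) ∪ E.image (fun e => (q e, p e))) σ =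
      2 * ∑ e ∈ E, sval (σ (p e)) * sval (σ (q e)) := by
  rw [energy_union]
  · rw [energy, energy, Finset.sum_image, Finset.sum_image, two_mul]
    · congr 1
      exact Finset.sum_congr rfl fun e _ => mul_comm _ _
    · intro e he e' he' h
      simp only [Prod.mk.injEq] at h
      exact hinj e he e' he' h.2 h.1
    · intro e he e' he' h
      simp only [Prod.mk.injEq] at h
      exact hinj e he e' he' h.1 h.2
  · rw [Finset.disjoint_left]
    intro x hx hx'
    simp only [Finset.mem_image] at hx hx'
    obtain ⟨e, he, rfl⟩ := hx
    obtain ⟨e', he', h⟩ := hx'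
    simp only [Prod.mk.injEq] at h
    exact hne e he e' he' h.1.symm h.2.symm

/-- Labels of the bonds of a rectangle: the label `((i, j), false)` is a vertical bond of the
primal lattice, crossed by a horizontal dual bond; `((i, j), true)` is a horizontal bond of the
primal lattice, crossed by a vertical dual bond. -/
abbrev Bond := (ℤ × ℤ) × Bool

/-- The bonds meeting `[a, b) × [1, M]`. -/
noncomputable def bonds (a b M : ℤ) : Finset Bond :=
  (Finset.Ico a b ×ˢ Finset.Icc 0 M) ×ˢ {false} ∪ (Finset.Icc a b ×ˢ Finset.Icc 1 M) ×ˢ {true}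

lemma mem_bonds_false {a b M i j : ℤ} :
    ((i, j), false) ∈ bonds a b M ↔ (a ≤ i ∧ i < b) ∧ 0 ≤ j ∧ j ≤ M := by
  simp [bonds]

lemma mem_bonds_true {a b M i j : ℤ} :
    ((i, j), true) ∈ bonds a b M ↔ (a ≤ i ∧ i ≤ b) ∧ 1 ≤ j ∧ j ≤ M := by
  simp [bonds]

/-- First endpoint of a primal bond. -/
def pst (e : Bond) : ℤ × ℤ := if e.2 then (e.1.1 - 1, e.1.2) else e.1
/-- Second endpoint of a primal bond. -/
def pnd (e : Bond) : ℤ × ℤ := if e.2 then e.1 else (e.1.1, e.1.2 + 1)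
/-- First endpoint of a dual bond. -/
def dst (e : Bond) : ℤ × ℤ := if e.2 then (e.1.1, e.1.2 - 1) else e.1
/-- Second endpoint of a dual bond. -/
def dnd (e : Bond) : ℤ × ℤ := if e.2 then e.1 else (e.1.1 + 1, e.1.2)

/-- The four primal bonds incident to a site. -/
def incid (v : ℤ × ℤ) : Finset Bond :=
  {(v, false), ((v.1, v.2 - 1), false), (v, true), ((v.1 + 1, v.2), true)}

lemma mem_incid {v : ℤ × ℤ} {e : Bond} : e ∈ incid v ↔ pst e = v ∨ pnd e = v := by
  obtain ⟨⟨i, j⟩, t⟩ := e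
  obtain ⟨x, y⟩ := v
  cases t
  · simp [incid, pst, pnd, eq_sub_iff_add_eq]
  · simp [incid, pst, pnd, sub_eq_iff_eq_add, or_comm]

/-- Parity of the bonds of `A` incident to `v`. -/
noncomputable def parity (A : Finset Bond) (v : ℤ × ℤ) : ℝ :=
  ∏ e ∈ incid v, if e ∈ A then -1 else 1

/-- Sign of a bond in a configuration. -/
def bsgn (σ : Cfg2) (e : Bond) : ℝ := sval (σ (pst e)) * sval (σ (pnd e))

lemma pst_ne_pnd (e : Bond) : pst e ≠ pnd e := by
  obtain ⟨⟨i, j⟩, t⟩ := e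
  cases t <;> simp [pst, pnd]

lemma bsgn_flip (σ : Cfg2) (v : ℤ × ℤ) (e : Bond) :
    bsgn (Function.update σ v (!σ v)) e = bsgn σ e * if e ∈ incid v then -1 else 1 := by
  have h := pst_ne_pnd e
  rw [bsgn, bsgn]
  by_cases h1 : pst e = v
  · have h2 : pnd e ≠ v := fun h' => h (h1.trans h'.symm)
    rw [if_pos (mem_incid.2 (Or.inl h1)), Function.update_of_ne h2, h1, Function.update_self,
      sval_not]
    ring
  · by_cases h2 : pnd e = v
    · rw [if_pos (mem_incid.2 (Or.inr h2)), Function.update_of_ne h1, h2, Function.update_self,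
        sval_not]
      ring
    · rw [if_neg (fun h' => (mem_incid.1 h').elim h1 h2), Function.update_of_ne h1,
        Function.update_of_ne h2, mul_one]

lemma prod_bsgn_flip (σ : Cfg2) (v : ℤ × ℤ) (A : Finset Bond) :
    ∏ e ∈ A, bsgn (Function.update σ v (!σ v)) e = (∏ e ∈ A, bsgn σ e) * parity A v := by
  simp only [bsgn_flip, Finset.prod_mul_distrib, parity]
  congr 1
  rw [← Finset.prod_filter, ← Finset.prod_filter, Finset.filter_mem_eq_inter,
    Finset.filter_mem_eq_inter, Finset.inter_comm]

lemma parity_sq (A : Finset Bond) (v : ℤ × ℤ) : parity A v = 1 ∨ parity A v = -1 := by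
  rw [parity]
  refine Finset.prod_induction _ (fun x : ℝ => x = 1 ∨ x = -1) ?_ (Or.inl rfl) ?_
  · rintro x y (rfl | rfl) (rfl | rfl) <;> norm_num
  · intro e _
    split_ifs <;> simp

lemma sum_confs_flip {V : Type*} [DecidableEq V] {Λ : Finset V} {v : V} (hv : v ∈ Λ)
    (η : V → Bool) (F : (V → Bool) → ℝ) :
    ∑ σ ∈ confs Λ η, F (Function.update σ v (!σ v)) = ∑ σ ∈ confs Λ η, F σ := by
  have hinv : ∀ σ : V → Bool, Function.update (Function.update σ v (!σ v)) v
      (!(Function.update σ v (!σ v)) v) = σ := by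
    intro σ; funext x; by_cases hx : x = v <;> simp [hx]
  have hm : ∀ σ ∈ confs Λ η, Function.update σ v (!σ v) ∈ confs Λ η := by
    intro σ hσ
    rw [mem_confs] at *
    intro x hx
    rw [Function.update_of_ne (by rintro rfl; exact hx hv), hσ x hx]
  exact Finset.sum_bij' (fun σ _ => Function.update σ v (!σ v))
    (fun σ _ => Function.update σ v (!σ v)) hm hm (fun σ _ => hinv σ) (fun σ _ => hinv σ)
    fun σ _ => rfl

/-- Sets of bonds with even degree at each site of `U`. -/
noncomputable def closedSets (E : Finset Bond) (U : Finset (ℤ × ℤ)) : Finset (Finset Bond) :=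
  E.powerset.filter fun A => ∀ v ∈ U, parity A v = 1

lemma mem_closedSets {E A : Finset Bond} {U : Finset (ℤ × ℤ)} :
    A ∈ closedSets E U ↔ A ⊆ E ∧ ∀ v ∈ U, parity A v = 1 := by
  simp [closedSets]

lemma sum_prod_bsgn (U : Finset (ℤ × ℤ)) (η : Cfg2) (A : Finset Bond) :
    ∑ σ ∈ confs U η, ∏ e ∈ A, bsgn σ e =
      if ∀ v ∈ U, parity A v = 1 then Fintype.card (↥U → Bool) * ∏ e ∈ A, bsgn η e else 0 := by
  split_ifs with h
  · have hc : ∀ U' ⊆ U, ∀ σ ∈ confs U' η, ∏ e ∈ A, bsgn σ e = ∏ e ∈ A, bsgn η e := by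
      intro U'
      induction U' using Finset.induction_on with
      | empty =>
        intro _ σ hσ
        rw [mem_confs] at hσ
        rw [show σ = η from funext fun x => hσ x (by simp)]
      | insert v U' hv ih =>
        intro hU σ hσ
        rw [mem_confs] at hσ
        by_cases hs : σ v = η v
        · refine ih (fun x hx => hU (Finset.mem_insert_of_mem hx)) σ (mem_confs.2 fun x hx => ?_)
          by_cases hxv : x = v
          · rw [hxv, hs]
          · exact hσ x (by simp [hx, hxv])
        · have h1 := prod_bsgn_flip σ v A
          rw [h v (hU (Finset.mem_insert_self v U')), mul_one] at h1
          rw [← h1]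
          refine ih (fun x hx => hU (Finset.mem_insert_of_mem hx)) _ (mem_confs.2 fun x hx => ?_)
          by_cases hxv : x = v
          · rw [hxv, Function.update_self]
            revert hs
            cases σ v <;> cases η v <;> simp
          · rw [Function.update_of_ne hxv]
            exact hσ x (by simp [hx, hxv])
    rw [Finset.sum_congr rfl (hc U subset_rfl), sum_confs_eq]
    simp
  · push Not at h
    obtain ⟨v, hv, hp⟩ := h
    have hp' := (parity_sq A v).resolve_left hp
    have h1 := sum_confs_flip hv η fun σ => ∏ e ∈ A, bsgn σ e
    simp only [prod_bsgn_flip, hp', ← Finset.sum_mul] at h1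
    linarith

lemma abs_bsgn (σ : Cfg2) (e : Bond) : bsgn σ e = 1 ∨ bsgn σ e = -1 := by
  rw [bsgn]
  cases σ (pst e) <;> cases σ (pnd e) <;> simp [sval]

lemma exp_mul_sign (β : ℝ) {x : ℝ} (hx : x = 1 ∨ x = -1) :
    Real.exp (β * x) = Real.cosh β * (1 + Real.tanh β * x) := by
  have hc := (Real.cosh_pos β).ne'
  rw [Real.tanh_eq_sinh_div_cosh]
  rcases hx with rfl | rfl
  · field_simp
    rw [Real.cosh_add_sinh]
  · field_simp
    rw [← sub_eq_add_neg, Real.cosh_sub_sinh]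

lemma edg_blk {a b M : ℤ} (hab : a < b) (hM : 1 ≤ M) : edg (blk a b 1 M) =
    (bonds a b M).image (fun e => (pst e, pnd e)) ∪
      (bonds a b M).image (fun e => (pnd e, pst e)) := by
  ext ⟨⟨x, y⟩, ⟨z, w⟩⟩
  simp only [mem_edg, mem_nbrs_iff, mem_blk, Finset.mem_union, Finset.mem_image, Prod.exists,
    Bool.exists_bool, mem_bonds_false, mem_bonds_true, pst, pnd, Prod.mk.injEq, if_true,
    Bool.false_eq_true, if_false]
  constructor
  · rintro ⟨h | h | h | h, h'⟩
    · exact Or.inl ⟨z, w, Or.inr (by omega)⟩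
    · exact Or.inr ⟨x, y, Or.inr (by omega)⟩
    · exact Or.inl ⟨x, y, Or.inl (by omega)⟩
    · exact Or.inr ⟨z, w, Or.inl (by omega)⟩
  · rintro (⟨i, j, h | h⟩ | ⟨i, j, h | h⟩) <;> omega

lemma bond_coords (e : Bond) : (pnd e).1 + (pnd e).2 = (pst e).1 + (pst e).2 + 1 := by
  obtain ⟨⟨i, j⟩, t⟩ := e
  cases t <;> simp [pst, pnd] <;> ring

lemma bond_ext {e e' : Bond} (h1 : pst e = pst e') (h2 : pnd e = pnd e') : e = e' := by
  obtain ⟨⟨i, j⟩, t⟩ := e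
  obtain ⟨⟨i', j'⟩, t'⟩ := e'
  cases t <;> cases t' <;> simp [pst, pnd, Prod.ext_iff] at h1 h2 ⊢ <;> omega

lemma energy_edg_blk {a b M : ℤ} (hab : a < b) (hM : 1 ≤ M) (σ : Cfg2) :
    energy (edg (blk a b 1 M)) σ = 2 * ∑ e ∈ bonds a b M, bsgn σ e := by
  rw [edg_blk hab hM, energy_symm]
  · rfl
  · intro e _ e' _ h1 h2
    exact bond_ext h1 h2
  · intro e _ e' _ h1 h2
    have a1 := bond_coords e
    have a2 := bond_coords e'
    rw [h1, h2] at a1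
    omega

lemma zf_high_temp (β : ℝ) {a b M : ℤ} (hab : a < b) (hM : 1 ≤ M) (η : Cfg2) :
    zf (β / 2) (edg (blk a b 1 M)) (blk a b 1 M) η (fun _ => 1) =
      Real.cosh β ^ (bonds a b M).card * Fintype.card (↥(blk a b 1 M) → Bool) *
        ∑ A ∈ closedSets (bonds a b M) (blk a b 1 M),
          Real.tanh β ^ A.card * ∏ e ∈ A, bsgn η e := by
  have h : ∀ σ : Cfg2, wt (β / 2) (edg (blk a b 1 M)) σ * 1 =
      Real.cosh β ^ (bonds a b M).card *
        ∑ A ∈ (bonds a b M).powerset, Real.tanh β ^ A.card * ∏ e ∈ A, bsgn σ e := by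
    intro σ
    rw [mul_one, wt, energy_edg_blk hab hM,
      show β / 2 * (2 * ∑ e ∈ bonds a b M, bsgn σ e) = ∑ e ∈ bonds a b M, β * bsgn σ e by
        rw [Finset.mul_sum, Finset.mul_sum]; exact Finset.sum_congr rfl fun e _ => by ring,
      Real.exp_sum, Finset.prod_congr rfl fun e _ => exp_mul_sign β (abs_bsgn σ e),
      Finset.prod_mul_distrib, Finset.prod_const, Finset.prod_one_add]
    congr 1
    refine Finset.sum_congr rfl fun A _ => ?_
    rw [Finset.prod_mul_distrib, Finset.prod_const]
  rw [zf, Finset.sum_congr rfl fun σ _ => h σ, ← Finset.mul_sum, Finset.sum_comm, mul_assoc]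
  congr 1
  simp only [← Finset.mul_sum, sum_prod_bsgn]
  rw [closedSets, Finset.sum_filter, Finset.mul_sum]
  refine Finset.sum_congr rfl fun A _ => ?_
  split_ifs <;> ring

end Duality

section DualPotential

lemma parity_eq_one_iff (A : Finset Bond) (i j : ℤ) :
    parity A (i, j) = 1 ↔
      ((decide (((i, j), false) ∈ A) ^^ decide (((i, j - 1), false) ∈ A)) ^^
        (decide (((i, j), true) ∈ A) ^^ decide (((i + 1, j), true) ∈ A))) = false := by
  rw [parity, incid, Finset.prod_insert (by simp; omega), Finset.prod_insert (by simp),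
    Finset.prod_insert (by simp), Finset.prod_singleton]
  by_cases h1 : ((i, j), false) ∈ A <;> by_cases h2 : ((i, j - 1), false) ∈ A <;>
    by_cases h3 : ((i, j), true) ∈ A <;> by_cases h4 : ((i + 1, j), true) ∈ A <;>
    simp [h1, h2, h3, h4] <;> norm_num

/-- Dual bonds across which `τ` changes sign. -/
def disagree (E : Finset Bond) (τ : Cfg2) : Finset Bond := E.filter fun e => τ (dst e) ≠ τ (dnd e)

lemma mem_disagree {E : Finset Bond} {τ : Cfg2} {e : Bond} :
    e ∈ disagree E τ ↔ e ∈ E ∧ τ (dst e) ≠ τ (dnd e) := by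
  simp [disagree]

/-- The potential of `A` along the bottom row. -/
def rowPot (A : Finset Bond) (a : ℤ) (c : Bool) : ℕ → Bool
  | 0 => c
  | n + 1 => rowPot A a c n ^^ decide (((a + n, 0), false) ∈ A)

/-- The potential of `A`, integrated first along the bottom row and then vertically. -/
def colPot (A : Finset Bond) (a : ℤ) (c : Bool) (n : ℕ) : ℕ → Bool
  | 0 => rowPot A a c n
  | m + 1 => colPot A a c n m ^^ decide (((a + n, (m : ℤ) + 1), true) ∈ A)

lemma colPot_succ {A : Finset Bond} {a b M : ℤ} (c : Bool)
    (hA : ∀ v ∈ blk a b 1 M, parity A v = 1) (n : ℕ) (hn : a + n < b) (m : ℕ) (hm : (m : ℤ) ≤ M) :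
    colPot A a c (n + 1) m = (colPot A a c n m ^^ decide (((a + n, (m : ℤ)), false) ∈ A)) := by
  induction m with
  | zero => simp [colPot, rowPot]
  | succ m ih =>
    have h := (parity_eq_one_iff A (a + n) (m + 1)).1 (hA _ (mem_blk.2 (by push_cast at hm; simp; omega)))
    have ih' := ih (by push_cast at hm; omega)
    rw [colPot, colPot, ih']
    push_cast
    rw [← add_assoc]
    rw [add_sub_cancel_right] at h
    revert h
    generalize colPot A a c n m = x
    generalize decide (((a + (n : ℤ), (m : ℤ) + 1), false) ∈ A) = y1
    generalize decide (((a + (n : ℤ), (m : ℤ)), false) ∈ A) = y2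
    generalize decide (((a + (n : ℤ), (m : ℤ) + 1), true) ∈ A) = y3
    generalize decide (((a + (n : ℤ) + 1, (m : ℤ) + 1), true) ∈ A) = y4
    revert x y1 y2 y3 y4
    decide

/-- Sites of the dual rectangle. -/
noncomputable def dualBlk (a b M : ℤ) : Finset (ℤ × ℤ) := Finset.Icc a b ×ˢ Finset.Icc 0 M

lemma mem_dualBlk {a b M : ℤ} {x : ℤ × ℤ} :
    x ∈ dualBlk a b M ↔ (a ≤ x.1 ∧ x.1 ≤ b) ∧ 0 ≤ x.2 ∧ x.2 ≤ M := by
  simp [dualBlk]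

/-- The dual configuration with disagreement set `A`, equal to `ζ` at the corner and outside. -/
noncomputable def dualCfg (a b M : ℤ) (ζ : Cfg2) (A : Finset Bond) : Cfg2 := fun x =>
  if x ∈ dualBlk a b M then colPot A a (ζ (a, 0)) (x.1 - a).toNat x.2.toNat else ζ x

lemma dualCfg_apply {a b M : ℤ} (ζ : Cfg2) (A : Finset Bond) (n m : ℕ) (hn : a + n ≤ b)
    (hm : (m : ℤ) ≤ M) : dualCfg a b M ζ A (a + n, (m : ℤ)) = colPot A a (ζ (a, 0)) n m := by
  rw [dualCfg, if_pos (mem_dualBlk.2 (by simp; omega))]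
  simp

lemma disagree_bonds_closed (a b M : ℤ) (τ : Cfg2) :
    disagree (bonds a b M) τ ∈ closedSets (bonds a b M) (blk a b 1 M) := by
  rw [mem_closedSets]
  refine ⟨Finset.filter_subset _ _, ?_⟩
  rintro ⟨i, j⟩ hv
  rw [mem_blk] at hv
  dsimp only at hv
  rw [parity_eq_one_iff]
  have e1 : ((i, j), false) ∈ bonds a b M := mem_bonds_false.2 (by omega)
  have e2 : ((i, j - 1), false) ∈ bonds a b M := mem_bonds_false.2 (by omega)
  have e3 : ((i, j), true) ∈ bonds a b M := mem_bonds_true.2 (by omega)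
  have e4 : ((i + 1, j), true) ∈ bonds a b M := mem_bonds_true.2 (by omega)
  simp only [mem_disagree, e1, e2, e3, e4, true_and, dst, dnd, if_true, Bool.false_eq_true, if_false]
  cases τ (i, j) <;> cases τ (i + 1, j) <;> cases τ (i, j - 1) <;> cases τ (i + 1, j - 1) <;> rfl

lemma bool_xor_ne (x y : Bool) : y = (x ^^ decide (x ≠ y)) := by
  revert x y; decide

lemma rowPot_disagree {a b M : ℤ} (hM : 0 ≤ M) (τ : Cfg2) (n : ℕ) (hn : a + n ≤ b) :
    τ (a + n, 0) = rowPot (disagree (bonds a b M) τ) a (τ (a, 0)) n := by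
  induction n with
  | zero => simp [rowPot]
  | succ n ih =>
    push_cast at hn
    have hb : ((a + n, 0), false) ∈ bonds a b M := mem_bonds_false.2 (by omega)
    rw [rowPot, ← ih (by omega)]
    simp only [mem_disagree, hb, true_and, dst, dnd, Bool.false_eq_true, if_false]
    push_cast
    rw [← add_assoc]
    exact bool_xor_ne _ _

lemma colPot_disagree {a b M : ℤ} (τ : Cfg2) (n : ℕ) (hn : a + n ≤ b) (m : ℕ) (hm : (m : ℤ) ≤ M) :
    τ (a + n, (m : ℤ)) = colPot (disagree (bonds a b M) τ) a (τ (a, 0)) n m := by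
  induction m with
  | zero => exact rowPot_disagree (by simpa using hm) τ n hn
  | succ m ih =>
    push_cast at hm
    have hb : ((a + n, (m : ℤ) + 1), true) ∈ bonds a b M := mem_bonds_true.2 (by omega)
    rw [colPot, ← ih (by omega)]
    simp only [mem_disagree, hb, true_and, dst, dnd, if_true, add_sub_cancel_right]
    push_cast
    exact bool_xor_ne _ _

lemma bool_ne_xor (x : Bool) (p : Prop) [Decidable p] : x ≠ (x ^^ decide p) ↔ p := by
  by_cases h : p <;> cases x <;> simp [h]

lemma disagree_dualCfg {a b M : ℤ} (ζ : Cfg2) {A : Finset Bond}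
    (hA : A ∈ closedSets (bonds a b M) (blk a b 1 M)) :
    disagree (bonds a b M) (dualCfg a b M ζ A) = A := by
  rw [mem_closedSets] at hA
  have key : ∀ e ∈ bonds a b M, (dualCfg a b M ζ A (dst e) ≠ dualCfg a b M ζ A (dnd e) ↔ e ∈ A) := by
    rintro ⟨⟨i, j⟩, t⟩ he
    cases t
    · rw [mem_bonds_false] at he
      obtain ⟨n, rfl⟩ : ∃ n : ℕ, i = a + n := ⟨(i - a).toNat, by omega⟩
      obtain ⟨m, rfl⟩ : ∃ m : ℕ, j = m := ⟨j.toNat, by omega⟩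
      have h1 := dualCfg_apply (M := M) (a := a) ζ A (n + 1) m (b := b) (by push_cast; omega) (by omega)
      push_cast at h1
      rw [← add_assoc] at h1
      simp only [dst, dnd, Bool.false_eq_true, if_false]
      rw [h1, dualCfg_apply (b := b) ζ A n m (by omega) (by omega),
        colPot_succ (b := b) (M := M) _ hA.2 n (by omega) m (by omega), bool_ne_xor]
    · rw [mem_bonds_true] at he
      obtain ⟨n, rfl⟩ : ∃ n : ℕ, i = a + n := ⟨(i - a).toNat, by omega⟩
      obtain ⟨m, rfl⟩ : ∃ m : ℕ, j = (m : ℤ) + 1 := ⟨(j - 1).toNat, by omega⟩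
      have h1 := dualCfg_apply (M := M) (a := a) ζ A n (m + 1) (b := b) (by omega) (by push_cast; omega)
      push_cast at h1
      simp only [dst, dnd, if_true, add_sub_cancel_right]
      rw [h1, dualCfg_apply (b := b) ζ A n m (by omega) (by omega), colPot, bool_ne_xor]
  ext e
  rw [mem_disagree]
  exact ⟨fun h => (key e h.1).1 h.2, fun h => ⟨hA.1 h, (key e (hA.1 h)).2 h⟩⟩

lemma sum_dual {a b M : ℤ} (hab : a ≤ b) (hM : 0 ≤ M) (ζ : Cfg2) (G : Finset Bond → ℝ) :
    ∑ τ ∈ confs ((dualBlk a b M).erase (a, 0)) ζ, G (disagree (bonds a b M) τ) =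
      ∑ A ∈ closedSets (bonds a b M) (blk a b 1 M), G A := by
  refine Finset.sum_bij' (fun τ _ => disagree (bonds a b M) τ) (fun A _ => dualCfg a b M ζ A)
    (fun τ _ => disagree_bonds_closed a b M τ) ?_ ?_ (fun A hA => disagree_dualCfg ζ hA)
    fun τ _ => rfl
  · intro A _
    rw [mem_confs]
    intro x hx
    by_cases hx' : x ∈ dualBlk a b M
    · have : x = (a, 0) := by
        by_contra h
        exact hx (Finset.mem_erase.2 ⟨h, hx'⟩)
      have h := dualCfg_apply (M := M) ζ A 0 0 (b := b) (a := a) (by simpa using hab) (by simpa using hM)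
      simp only [Nat.cast_zero, add_zero] at h
      rw [this, h]
      rfl
    · rw [dualCfg, if_neg hx']
  · intro τ hτ
    rw [mem_confs] at hτ
    funext ⟨i, j⟩
    by_cases hx' : (i, j) ∈ dualBlk a b M
    · have hx := mem_dualBlk.1 hx'
      dsimp only at hx
      obtain ⟨n, rfl⟩ : ∃ n : ℕ, i = a + n := ⟨(i - a).toNat, by omega⟩
      obtain ⟨m, rfl⟩ : ∃ m : ℕ, j = m := ⟨j.toNat, by omega⟩
      rw [dualCfg_apply _ _ n m (by omega) (by omega), colPot_disagree (b := b) (M := M) τ n (by omega) m (by omega),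
        hτ (a, 0) (by simp)]
    · rw [dualCfg, if_neg hx', hτ _ (fun h => hx' (Finset.mem_of_mem_erase h))]

/-- Oriented dual bonds. -/
noncomputable def dualEdg (a b M : ℤ) : Finset ((ℤ × ℤ) × (ℤ × ℤ)) :=
  (bonds a b M).image (fun e => (dst e, dnd e)) ∪ (bonds a b M).image (fun e => (dnd e, dst e))

lemma dual_coords (e : Bond) : (dnd e).1 + (dnd e).2 = (dst e).1 + (dst e).2 + 1 := by
  obtain ⟨⟨i, j⟩, t⟩ := e
  cases t <;> simp [dst, dnd] <;> ring

lemma dual_ext {e e' : Bond} (h1 : dst e = dst e') (h2 : dnd e = dnd e') : e = e' := by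
  obtain ⟨⟨i, j⟩, t⟩ := e
  obtain ⟨⟨i', j'⟩, t'⟩ := e'
  cases t <;> cases t' <;> simp [dst, dnd, Prod.ext_iff] at h1 h2 ⊢ <;> omega

lemma energy_dualEdg (a b M : ℤ) (τ : Cfg2) :
    energy (dualEdg a b M) τ = 2 * ∑ e ∈ bonds a b M, sval (τ (dst e)) * sval (τ (dnd e)) := by
  rw [dualEdg, energy_symm]
  · intro e _ e' _ h1 h2
    exact dual_ext h1 h2
  · intro e _ e' _ h1 h2
    have a1 := dual_coords e
    have a2 := dual_coords e'
    rw [h1, h2] at a1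
    omega

lemma dualEdg_subset {a b M : ℤ} {Λ : Finset (ℤ × ℤ)} (hΛ : dualBlk a b M ⊆ Λ) :
    dualEdg a b M ⊆ edg Λ := by
  have h : ∀ e ∈ bonds a b M, dst e ∈ Λ ∧ dnd e ∈ nbrs (dst e) := by
    rintro ⟨⟨i, j⟩, t⟩ he
    cases t
    · rw [mem_bonds_false] at he
      refine ⟨hΛ (mem_dualBlk.2 ?_), mem_nbrs_iff.2 ?_⟩ <;> (simp [dst, dnd]; try omega)
    · rw [mem_bonds_true] at he
      refine ⟨hΛ (mem_dualBlk.2 ?_), mem_nbrs_iff.2 ?_⟩ <;> (simp [dst, dnd]; try omega)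
  intro p hp
  rw [dualEdg, Finset.mem_union, Finset.mem_image, Finset.mem_image] at hp
  rw [mem_edg]
  rcases hp with ⟨e, he, rfl⟩ | ⟨e, he, rfl⟩
  · exact ⟨(h e he).2, Or.inl (h e he).1⟩
  · exact ⟨mem_nbrs_comm.1 (h e he).2, Or.inr (h e he).1⟩

lemma wt_dual (κ : ℝ) (a b M : ℤ) (τ : Cfg2) :
    wt (κ / 2) (dualEdg a b M) τ = Real.exp κ ^ (bonds a b M).card *
      Real.exp (-2 * κ) ^ (disagree (bonds a b M) τ).card := by
  have h : ∀ e : Bond, Real.exp (κ * (sval (τ (dst e)) * sval (τ (dnd e)))) =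
      Real.exp κ * if τ (dst e) ≠ τ (dnd e) then Real.exp (-2 * κ) else 1 := by
    intro e
    cases τ (dst e) <;> cases τ (dnd e) <;> simp [sval, ← Real.exp_add] <;> ring
  rw [wt, energy_dualEdg,
    show κ / 2 * (2 * ∑ e ∈ bonds a b M, sval (τ (dst e)) * sval (τ (dnd e))) =
      ∑ e ∈ bonds a b M, κ * (sval (τ (dst e)) * sval (τ (dnd e))) by
        rw [Finset.mul_sum, Finset.mul_sum]; exact Finset.sum_congr rfl fun e _ => by ring,
    Real.exp_sum, Finset.prod_congr rfl fun e _ => h e, Finset.prod_mul_distrib, Finset.prod_const,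
    ← Finset.prod_filter, Finset.prod_const]
  rfl

lemma zf_dual (κ : ℝ) {a b M : ℤ} (hab : a ≤ b) (hM : 0 ≤ M) {Λ : Finset (ℤ × ℤ)}
    (hΛ : dualBlk a b M ⊆ Λ) (η : Cfg2) (G : Finset Bond → ℝ) :
    zf (κ / 2) (dualEdg a b M) Λ η (fun τ => G (disagree (bonds a b M) τ)) =
      (confs (Λ \ (dualBlk a b M).erase (a, 0)) η).card * Real.exp κ ^ (bonds a b M).card *
        ∑ A ∈ closedSets (bonds a b M) (blk a b 1 M), Real.exp (-2 * κ) ^ A.card * G A := by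
  have hu : Λ \ (dualBlk a b M).erase (a, 0) ∪ (dualBlk a b M).erase (a, 0) = Λ :=
    Finset.sdiff_union_of_subset ((Finset.erase_subset _ _).trans hΛ)
  rw [zf]
  conv_lhs => rw [← hu, sum_confs_union Finset.sdiff_disjoint]
  have h : ∀ ζ : Cfg2, ∑ τ ∈ confs ((dualBlk a b M).erase (a, 0)) ζ,
      wt (κ / 2) (dualEdg a b M) τ * G (disagree (bonds a b M) τ) =
      Real.exp κ ^ (bonds a b M).card *
        ∑ A ∈ closedSets (bonds a b M) (blk a b 1 M), Real.exp (-2 * κ) ^ A.card * G A := by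
    intro ζ
    rw [← sum_dual hab hM ζ fun A => Real.exp (-2 * κ) ^ A.card * G A, Finset.mul_sum]
    exact Finset.sum_congr rfl fun τ _ => by rw [wt_dual]; ring
  rw [Finset.sum_congr rfl fun ζ _ => h ζ, Finset.sum_const, nsmul_eq_mul, mul_assoc]

lemma prod_disagree {a b M : ℤ} (ha : a ≤ 0) {k : ℕ} (hk : (k : ℤ) ≤ b) (hM : 0 ≤ M) (τ : Cfg2) :
    ∏ e ∈ disagree (bonds a b M) τ, bsgn (minusOn (blk 0 k 0 0)) e =
      sval (τ (0, 0)) * sval (τ (k, 0)) := by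
  rw [disagree, Finset.prod_filter]
  have hsub : (Finset.range k).image (fun i : ℕ => ((((i : ℤ), (0 : ℤ)), false) : Bond)) ⊆
      bonds a b M := by
    intro e he
    obtain ⟨i, hi, rfl⟩ := Finset.mem_image.1 he
    rw [Finset.mem_range] at hi
    exact mem_bonds_false.2 (by omega)
  rw [← Finset.prod_subset hsub]
  · rw [Finset.prod_image (by intro i _ j _ h; simpa using h)]
    have : ∀ i ∈ Finset.range k,
        (if τ (dst ((((i : ℤ), (0 : ℤ)), false) : Bond)) ≠ τ (dnd ((((i : ℤ), (0 : ℤ)), false) : Bond))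
          then bsgn (minusOn (blk 0 k 0 0)) (((i : ℤ), (0 : ℤ)), false) else 1) =
        sval (τ (i, 0)) * sval (τ ((i + 1 : ℕ), 0)) := by
      intro i hi
      rw [Finset.mem_range] at hi
      rw [bsgn, minusOn_of_mem (by simp [pst, mem_blk]; omega),
        minusOn_of_notMem (by simp [pnd, mem_blk])]
      simp only [dst, dnd, Bool.false_eq_true, if_false]
      push_cast
      cases τ (i, 0) <;> cases τ ((i : ℤ) + 1, 0) <;> simp [sval]
    rw [Finset.prod_congr rfl this]
    clear this hk hsub
    induction k with
    | zero => cases τ (0, 0) <;> simp [sval]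
    | succ k ih =>
      rw [Finset.prod_range_succ, ih]
      cases τ (k, 0) <;> simp [sval]
  · rintro ⟨⟨i, j⟩, t⟩ he hne
    have h : bsgn (minusOn (blk 0 k 0 0)) ((i, j), t) = 1 := by
      cases t
      · rw [mem_bonds_false] at he
        have : ¬ (j = 0 ∧ 0 ≤ i ∧ i < k) := by
          rintro ⟨rfl, h1, h2⟩
          exact hne (Finset.mem_image.2 ⟨i.toNat, Finset.mem_range.2 (by omega), by simp; omega⟩)
        rw [bsgn, minusOn_of_notMem (by simp [pst, mem_blk]; omega),
          minusOn_of_notMem (by simp [pnd, mem_blk]; omega)]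
        simp [sval]
      · rw [mem_bonds_true] at he
        rw [bsgn, minusOn_of_notMem (by simp [pst, mem_blk]; omega),
          minusOn_of_notMem (by simp [pnd, mem_blk]; omega)]
        simp [sval]
    rw [h, ite_self]

lemma tanh_ge_of_betaCrit_lt {β : ℝ} (hβ : betaCrit < β) : Real.exp (-2 * β) ≤ Real.tanh β := by
  have hs : Real.sqrt 2 ^ 2 = 2 := Real.sq_sqrt (by norm_num)
  have hs0 : 0 ≤ Real.sqrt 2 := Real.sqrt_nonneg 2
  have hpos : 0 < 1 + Real.sqrt 2 := by positivity
  have h1 : Real.exp (-2 * β) ≤ (1 + Real.sqrt 2)⁻¹ := by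
    rw [← Real.exp_log (inv_pos.2 hpos), Real.log_inv]
    apply Real.exp_le_exp.2
    rw [betaCrit] at hβ
    linarith
  have h2 : (1 + Real.sqrt 2)⁻¹ = Real.sqrt 2 - 1 := by
    exact inv_eq_of_mul_eq_one_right (by linarith)
  have hx := Real.exp_pos (-2 * β)
  set x := Real.exp (-2 * β) with hxd
  have ht : Real.tanh β = (1 - x) / (1 + x) := by
    have he : Real.exp (-β) = x * Real.exp β := by rw [hxd, ← Real.exp_add]; ring_nf
    rw [Real.tanh_eq_sinh_div_cosh, Real.sinh_eq, Real.cosh_eq, he]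
    have := Real.exp_pos β
    field_simp
  rw [ht, le_div_iff₀ (by positivity)]
  rw [h2] at h1
  nlinarith

lemma betaCrit_pos : 0 < betaCrit := by
  rw [betaCrit]
  have : 0 < Real.sqrt 2 := by positivity
  exact div_pos (Real.log_pos (by linarith)) two_pos

/-- By duality, the cost of a line of `k` minus spins at the boundary of a rectangle is bounded
by a two-point function of the plus state. -/
lemma zf_minus_line_le {β : ℝ} (hβ : betaCrit < β) {a b M : ℤ} (ha : a < 0) {k : ℕ}
    (hk : (k : ℤ) ≤ b) (hM : 1 ≤ M) {Λ : Finset (ℤ × ℤ)} (hΛ : dualBlk a b M ⊆ Λ) :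
    zf (β / 2) (edg (blk a b 1 M)) (blk a b 1 M) (minusOn (blk 0 k 0 0)) (fun _ => 1) ≤
      av (β / 2) (edg Λ) Λ (fun _ => true) (fun σ => sval (σ (0, 0)) * sval (σ (k, 0))) *
        zf (β / 2) (edg (blk a b 1 M)) (blk a b 1 M) (fun _ => true) (fun _ => 1) := by
  have hβ0 : 0 < β := betaCrit_pos.trans hβ
  have htge := tanh_ge_of_betaCrit_lt hβ
  have htpos : 0 < Real.tanh β := (Real.exp_pos _).trans_le htge
  set κ := -Real.log (Real.tanh β) / 2 with hκ
  have hek : Real.exp (-2 * κ) = Real.tanh β := by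
    rw [hκ, show -2 * (-Real.log (Real.tanh β) / 2) = Real.log (Real.tanh β) by ring,
      Real.exp_log htpos]
  have hκ0 : 0 ≤ κ := by
    have : Real.log (Real.tanh β) ≤ 0 := Real.log_nonpos htpos.le (Real.tanh_lt_one β).le
    rw [hκ]; linarith
  have hκβ : κ ≤ β := by
    rw [← hek, Real.exp_le_exp] at htge
    linarith
  have hab : a < b := by omega
  have hg := ginibre (κ' := κ / 2) (κ := β / 2) (by linarith) (by linarith) (dualEdg_subset hΛ) Λ
    (0, 0) ((k : ℤ), 0)
  refine le_trans (le_of_eq ?_) (mul_le_mul_of_nonneg_right hg zf_one_pos.le)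
  have hb1 : ∀ A : Finset Bond, ∏ e ∈ A, bsgn (fun _ => true) e = 1 := fun A =>
    Finset.prod_eq_one fun e _ => by simp [bsgn, sval]
  have h1 : zf (κ / 2) (dualEdg a b M) Λ (fun _ => true)
      (fun σ => sval (σ (0, 0)) * sval (σ (k, 0))) =
      zf (κ / 2) (dualEdg a b M) Λ (fun _ => true) (fun τ =>
        ∏ e ∈ disagree (bonds a b M) τ, bsgn (minusOn (blk 0 k 0 0)) e) := by
    simp only [prod_disagree ha.le hk (by omega : (0 : ℤ) ≤ M)]
  have h2 := zf_one_pos (κ := κ / 2) (E := dualEdg a b M) (Λ := Λ) (η := fun _ => true)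
  rw [av, div_mul_eq_mul_div, eq_div_iff h2.ne', h1, zf_high_temp β hab hM, zf_high_temp β hab hM,
    zf_dual κ hab.le (by omega) hΛ _ (fun A => ∏ e ∈ A, bsgn (minusOn (blk 0 k 0 0)) e),
    zf_dual κ hab.le (by omega) hΛ _ (fun _ => 1), hek]
  simp only [hb1]
  ring

end DualPotential

section Cylinders

/-- The cylinder of sequences which agree with `g` on `T`. -/
def cyl (T : Finset ℤ) (g : ZSeq Bool) : Set (ZSeq Bool) := {η | ∀ i ∈ T, η i = g i}

lemma measurableSet_cyl (T : Finset ℤ) (g : ZSeq Bool) : MeasurableSet (cyl T g) := by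
  have : cyl T g = ⋂ i ∈ T, (fun η : ZSeq Bool => η i) ⁻¹' {g i} := by
    ext η; simp [cyl]
  rw [this]
  exact Finset.measurableSet_biInter _ fun i _ => measurable_pi_apply i (measurableSet_singleton _)

/-- Probability of a cylinder. -/
noncomputable def pr (ν : Measure (ZSeq Bool)) (T : Finset ℤ) (g : ZSeq Bool) : ℝ :=
  ν.real (cyl T g)

lemma pr_nonneg (ν : Measure (ZSeq Bool)) (T : Finset ℤ) (g : ZSeq Bool) : 0 ≤ pr ν T g :=
  measureReal_nonneg

lemma pr_congr (ν : Measure (ZSeq Bool)) {T : Finset ℤ} {g g' : ZSeq Bool}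
    (h : ∀ i ∈ T, g i = g' i) : pr ν T g = pr ν T g' := by
  rw [pr, pr]
  congr 1
  ext η
  exact forall₂_congr fun i hi => by rw [h i hi]

/-- `f` depends only on the coordinates in `T`. -/
def LocalOn (T : Finset ℤ) (f : ZSeq Bool → ℝ) : Prop :=
  ∀ η η' : ZSeq Bool, (∀ i ∈ T, η i = η' i) → f η = f η'

lemma localOn_eq_sum {T : Finset ℤ} {f : ZSeq Bool → ℝ} (hf : LocalOn T f)
    (ζ η : ZSeq Bool) :
    f η = ∑ g ∈ confs T ζ, f g * (cyl T g).indicator (fun _ => 1) η := by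
  classical
  have hm : (fun i => if i ∈ T then η i else ζ i) ∈ confs T ζ := by
    rw [mem_confs]; intro x hx; simp [hx]
  rw [Finset.sum_eq_single_of_mem _ hm]
  · rw [Set.indicator_of_mem, mul_one]
    · exact hf _ _ fun i hi => by simp [hi]
    · intro i hi; simp [hi]
  · intro g hg hne
    rw [Set.indicator_of_notMem, mul_zero]
    intro h
    refine hne (funext fun i => ?_)
    rw [mem_confs] at hg
    by_cases hi : i ∈ T
    · simp [hi, h i hi]
    · simp [hi, hg i hi]

lemma LocalOn.measurable {T : Finset ℤ} {f : ZSeq Bool → ℝ} (hf : LocalOn T f) : Measurable f := by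
  rw [funext (localOn_eq_sum hf fun _ => true)]
  exact Finset.measurable_sum _ fun g _ =>
    (measurable_const.indicator (measurableSet_cyl T g)).const_mul _

lemma LocalOn.integrable {T : Finset ℤ} {f : ZSeq Bool → ℝ} (hf : LocalOn T f)
    (ν : Measure (ZSeq Bool)) [IsFiniteMeasure ν] : Integrable f ν := by
  rw [funext (localOn_eq_sum hf fun _ => true)]
  exact integrable_finsetSum _ fun g _ =>
    ((integrable_const (1 : ℝ)).indicator (measurableSet_cyl T g)).const_mul _

lemma LocalOn.integral {T : Finset ℤ} {f : ZSeq Bool → ℝ} (hf : LocalOn T f)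
    (ν : Measure (ZSeq Bool)) [IsFiniteMeasure ν] (ζ : ZSeq Bool) :
    ∫ η, f η ∂ν = ∑ g ∈ confs T ζ, f g * pr ν T g := by
  conv_lhs => rw [funext (localOn_eq_sum hf ζ)]
  rw [integral_finsetSum _ fun g _ =>
    ((integrable_const (1 : ℝ)).indicator (measurableSet_cyl T g)).const_mul _]
  refine Finset.sum_congr rfl fun g _ => ?_
  rw [integral_const_mul, integral_indicator_const _ (measurableSet_cyl T g), smul_eq_mul, mul_one,
    pr]

lemma LocalOn.mono {T T' : Finset ℤ} (h : T ⊆ T') {f : ZSeq Bool → ℝ} (hf : LocalOn T f) :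
    LocalOn T' f := fun η η' hη => hf η η' fun i hi => hη i (h hi)

lemma localOn_cyl (T : Finset ℤ) (g : ZSeq Bool) :
    LocalOn T ((cyl T g).indicator fun _ => 1) := by
  intro η η' h
  have : η ∈ cyl T g ↔ η' ∈ cyl T g := forall₂_congr fun i hi => by rw [h i hi]
  by_cases h' : η ∈ cyl T g
  · rw [Set.indicator_of_mem h', Set.indicator_of_mem (this.1 h')]
  · rw [Set.indicator_of_notMem h', Set.indicator_of_notMem fun h'' => h' (this.2 h'')]

lemma integral_cyl (ν : Measure (ZSeq Bool)) (T : Finset ℤ) (g : ZSeq Bool) :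
    ∫ η, (cyl T g).indicator (fun _ => (1 : ℝ)) η ∂ν = pr ν T g := by
  rw [integral_indicator_const _ (measurableSet_cyl T g), smul_eq_mul, mul_one, pr]

lemma measurable_lineProj : Measurable lineProj :=
  measurable_pi_lambda _ fun i => measurable_pi_apply (i, 0)

/-- The finite volume expectation of `f` in the box `[-n, n]²` with plus boundary conditions. -/
noncomputable def boxAv (β : ℝ) (n : ℕ) (f : Cfg2 → ℝ) : ℝ :=
  av (β / 2) (edg (box n)) (box n) (fun _ => true) f

lemma tendsto_boxAv_cyl {β : ℝ} {μp : Measure Cfg2} (hμp : IsPlusPhase β 0 μp) (T : Finset ℤ)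
    (g : ZSeq Bool) :
    Tendsto (fun n => boxAv β n fun σ => (cyl T g).indicator (fun _ => 1) (lineProj σ)) atTop
      (𝓝 (pr (schonmann μp) T g)) := by
  classical
  have := hμp.1
  have h := hμp.2 (T.image fun i => (i, 0)) (fun x => g x.1)
  have hset : {η : Cfg2 | ∀ x ∈ T.image (fun i => (i, (0 : ℤ))), η x = g x.1} =
      lineProj ⁻¹' cyl T g := by
    ext η; simp [cyl, lineProj]
  rw [hset] at h
  have h2 := (ENNReal.tendsto_toReal (measure_ne_top μp (lineProj ⁻¹' cyl T g))).comp h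
  rw [pr, schonmann, Measure.real, Measure.map_apply measurable_lineProj (measurableSet_cyl T g)]
  refine h2.congr fun n => ?_
  rw [Function.comp_apply, isingFV_apply _ _ _ (measurable_lineProj (measurableSet_cyl T g)), boxAv]
  refine av_congr fun σ _ => ?_
  rw [Set.indicator_apply, Set.mem_preimage]

lemma schonmann_prob {β : ℝ} {μp : Measure Cfg2} (hμp : IsPlusPhase β 0 μp) :
    IsProbabilityMeasure (schonmann μp) :=
  have := hμp.1
  Measure.isProbabilityMeasure_map measurable_lineProj.aemeasurable

lemma tendsto_boxAv {β : ℝ} {μp : Measure Cfg2} (hμp : IsPlusPhase β 0 μp) {T : Finset ℤ}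
    {f : ZSeq Bool → ℝ} (hf : LocalOn T f) :
    Tendsto (fun n => boxAv β n fun σ => f (lineProj σ)) atTop
      (𝓝 (∫ η, f η ∂(schonmann μp))) := by
  have := schonmann_prob hμp
  rw [hf.integral _ fun _ => true]
  have h := tendsto_finsetSum (confs T fun _ => true) fun g _ =>
    (tendsto_boxAv_cyl hμp T g).const_mul (f g)
  refine h.congr fun n => ?_
  simp only [boxAv, ← av_const_mul]
  rw [← av_sum]
  exact av_congr fun σ _ => (localOn_eq_sum hf _ (lineProj σ)).symm

/-- The finite energy constant. -/
noncomputable def feConst (β : ℝ) : ℝ := 1 / (1 + Real.exp (8 * β))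

lemma feConst_pos (β : ℝ) : 0 < feConst β := by
  have := Real.exp_pos (8 * β)
  exact one_div_pos.2 (by linarith)

lemma boxAv_fe {β : ℝ} (hβ : 0 < β) {n : ℕ} {v : ℤ × ℤ} (hv : v ∈ box n) (b : Bool)
    {F : Cfg2 → ℝ} (hF : ∀ σ c, F (Function.update σ v c) = F σ) (hF0 : ∀ σ, 0 ≤ F σ) :
    feConst β * boxAv β n F ≤ boxAv β n fun σ => (if σ v = b then 1 else 0) * F σ := by
  rw [boxAv, boxAv, ← av_const_mul, av, av]
  refine div_le_div_of_nonneg_right ?_ zf_one_pos.le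
  have h0 := zf_minus hv hv (β := β) (fun _ => true) hF
  cases b
  · have e : (fun σ : Cfg2 => (if σ v = false then 1 else 0) * F σ) =
        fun σ => (if σ v then 0 else 1) * F σ := by
      funext σ; cases σ v <;> simp
    rw [e, h0]
    exact zf_mono fun σ _ => mul_le_mul_of_nonneg_right (qminus_ge hβ v σ) (hF0 σ)
  · have e : (fun σ : Cfg2 => (if σ v = true then 1 else 0) * F σ) =
        fun σ => F σ - (if σ v then 0 else 1) * F σ := by
      funext σ; cases σ v <;> simp
    rw [e, zf_sub, h0, ← zf_sub]
    refine zf_mono fun σ _ => ?_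
    have := mul_le_mul_of_nonneg_right (qminus_le hβ v σ) (hF0 σ)
    rw [feConst]
    linarith

lemma pr_insert_ge {β : ℝ} (hβ : 0 < β) {μp : Measure Cfg2} (hμp : IsPlusPhase β 0 μp)
    {T : Finset ℤ} {x : ℤ} (hx : x ∉ T) (g : ZSeq Bool) :
    feConst β * pr (schonmann μp) T g ≤ pr (schonmann μp) (insert x T) g := by
  refine le_of_tendsto_of_tendsto ((tendsto_boxAv_cyl hμp T g).const_mul (feConst β))
    (tendsto_boxAv_cyl hμp (insert x T) g) ?_
  filter_upwards [eventually_ge_atTop x.natAbs] with n hn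
  have hv : ((x, 0) : ℤ × ℤ) ∈ box n := by
    simp [box]; omega
  refine (boxAv_fe hβ hv (g x) ?_ ?_).trans (le_of_eq ?_)
  · intro σ c
    refine localOn_cyl T g _ _ fun i hi => ?_
    have : ((i, 0) : ℤ × ℤ) ≠ (x, 0) := by
      intro h; rw [Prod.mk.injEq] at h; exact hx (h.1 ▸ hi)
    simp [lineProj, Function.update_of_ne this]
  · intro σ
    exact Set.indicator_nonneg (fun _ _ => zero_le_one) _
  · refine av_congr fun σ _ => ?_
    have e : cyl (insert x T) g = {η | η x = g x} ∩ cyl T g := by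
      ext η; simp [cyl]
    rw [e]
    have hmem : lineProj σ ∈ {η : ZSeq Bool | η x = g x} ↔ σ (x, 0) = g x := Iff.rfl
    classical
    by_cases h1 : σ (x, 0) = g x <;>
      simp only [Set.indicator_apply, Set.mem_inter_iff, hmem, h1, true_and, false_and, if_true,
        if_false, one_mul, zero_mul]

lemma pr_empty (ν : Measure (ZSeq Bool)) [IsProbabilityMeasure ν] (g : ZSeq Bool) :
    pr ν ∅ g = 1 := by
  simp [pr, cyl]

lemma pr_pos {β : ℝ} (hβ : 0 < β) {μp : Measure Cfg2} (hμp : IsPlusPhase β 0 μp)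
    (T : Finset ℤ) (g : ZSeq Bool) : 0 < pr (schonmann μp) T g := by
  have := schonmann_prob hμp
  induction T using Finset.induction_on with
  | empty => rw [pr_empty]; exact one_pos
  | insert x T hx ih => exact (mul_pos (feConst_pos β) ih).trans_le (pr_insert_ge hβ hμp hx g)

lemma pr_shift {ν : Measure (ZSeq Bool)} (hν : ν.map shiftSeq = ν) (a b : ℤ) (g : ZSeq Bool) :
    pr ν (Finset.Ico (a + 1) (b + 1)) g = pr ν (Finset.Ico a b) (shiftSeq g) := by
  have hm : Measurable (shiftSeq : ZSeq Bool → ZSeq Bool) :=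
    measurable_pi_lambda _ fun i => measurable_pi_apply (i + 1)
  rw [pr, pr]
  conv_rhs => rw [← hν]
  rw [Measure.real, Measure.real, Measure.map_apply hm (measurableSet_cyl _ _)]
  congr 2
  ext η
  simp only [cyl, shiftSeq, Set.mem_preimage, Set.mem_ofPred_eq, Finset.mem_Ico]
  refine ⟨fun h i hi => h (i + 1) (by omega), fun h i hi => ?_⟩
  have := h (i - 1) (by omega)
  simpa using this

lemma pr_shift_nat {ν : Measure (ZSeq Bool)} (hν : ν.map shiftSeq = ν) (s : ℕ) (a b : ℤ)
    (g : ZSeq Bool) :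
    pr ν (Finset.Ico (a + s) (b + s)) g = pr ν (Finset.Ico a b) (fun i => g (i + s)) := by
  induction s generalizing a b with
  | zero => simp
  | succ s ih =>
    have h := ih (a + 1) (b + 1)
    push_cast
    rw [show a + ((s : ℤ) + 1) = a + 1 + s by ring, show b + ((s : ℤ) + 1) = b + 1 + s by ring, h,
      pr_shift hν]
    refine pr_congr ν fun i _ => ?_
    simp only [shiftSeq]
    congr 1; ring

lemma pr_shift_int {ν : Measure (ZSeq Bool)} (hν : ν.map shiftSeq = ν) (s : ℤ) (a b : ℤ)
    (g : ZSeq Bool) :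
    pr ν (Finset.Ico (a + s) (b + s)) g = pr ν (Finset.Ico a b) (fun i => g (i + s)) := by
  obtain ⟨n, rfl | rfl⟩ := s.eq_nat_or_neg
  · exact pr_shift_nat hν n a b g
  · have h := pr_shift_nat hν n (a + -n) (b + -n) (fun i => g (i + -n))
    simp only [neg_add_cancel_right] at h
    rw [h]
    exact pr_congr ν fun i _ => by ring_nf

lemma abs_sub_le_varG {P : Bool → Past Bool → ℝ} (hP : IsGFunction P) {k : ℕ} {ω σ : Past Bool}
    (h : ∀ j < k, ω j = σ j) (a : Bool) : |P a ω - P a σ| ≤ varG P k := by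
  refine le_csSup ⟨1, ?_⟩ ⟨a, ω, σ, h, rfl⟩
  rintro d ⟨a, ω, σ, -, rfl⟩
  have h1 := (hP.2 ω).2 a
  have h2 := (hP.2 σ).2 a
  rw [abs_le]
  constructor <;> linarith [h1.1, h1.2, h2.1, h2.2]

lemma varG_nonneg {P : Bool → Past Bool → ℝ} (hP : IsGFunction P) (k : ℕ) : 0 ≤ varG P k :=
  (abs_nonneg _).trans (abs_sub_le_varG hP (ω := fun _ => true) (σ := fun _ => true)
    (fun _ _ => rfl) true)

lemma pastSigma_le : pastSigma Bool ≤ (inferInstance : MeasurableSpace (ZSeq Bool)) := by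
  rw [pastSigma, measurable_iff_comap_le.symm]
  exact measurable_pi_lambda _ fun k => measurable_pi_apply _

lemma measurableSet_past_cyl (m : ℕ) (g : ZSeq Bool) :
    MeasurableSet[pastSigma Bool] (cyl (Finset.Ico (-m) 0) g) := by
  refine ⟨{ω | ∀ j ∈ Finset.range m, ω j = restrictPast g j}, ?_, ?_⟩
  · have : {ω : Past Bool | ∀ j ∈ Finset.range m, ω j = restrictPast g j} =
        ⋂ j ∈ Finset.range m, (fun ω : Past Bool => ω j) ⁻¹' {restrictPast g j} := by
      ext η; simp
    rw [this]
    exact Finset.measurableSet_biInter _ fun i _ =>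
      measurable_pi_apply i (measurableSet_singleton _)
  · ext η
    simp only [cyl, Set.mem_preimage, Set.mem_ofPred_eq, Finset.mem_range, Finset.mem_Ico,
      restrictPast]
    constructor
    · intro h i hi
      have := h (-i - 1).toNat (by omega)
      rwa [show (-((((-i - 1).toNat : ℕ) : ℤ) + 1)) = i by omega] at this
    · intro h j hj
      exact h _ (by omega)

lemma abs_pr_sub_le {ν : Measure (ZSeq Bool)} {P : Bool → Past Bool → ℝ} (hP : IsGFunction P)
    (hν : IsGMeasure ν P) {k m : ℕ} (hkm : k ≤ m) (g : ZSeq Bool) :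
    |pr ν (Finset.Ico (-m) 1) g - P (g 0) (restrictPast g) * pr ν (Finset.Ico (-m) 0) g| ≤
      varG P k * pr ν (Finset.Ico (-m) 0) g := by
  have hprob := hν.1
  set A := cyl (Finset.Ico (-(m : ℤ)) 0) g with hA
  have hAm : MeasurableSet A := measurableSet_cyl _ _
  have h0 : MeasurableSet {ω : ZSeq Bool | ω 0 = g 0} :=
    (measurable_pi_apply (X := fun _ : ℤ => Bool) 0) (measurableSet_singleton (g 0))
  have h1 : ∫ ω in A, P (g 0) (restrictPast ω) ∂ν = pr ν (Finset.Ico (-m) 1) g := by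
    rw [integral_congr_ae (ae_restrict_of_ae (hν.2.2 (g 0))),
      setIntegral_condExp pastSigma_le ((integrable_const _).indicator h0)
        (measurableSet_past_cyl m g),
      integral_indicator_const _ h0, smul_eq_mul, mul_one, measureReal_restrict_apply h0, pr]
    congr 1
    ext η
    simp only [cyl, Set.mem_inter_iff, Set.mem_ofPred_eq, Finset.mem_Ico]
    constructor
    · rintro ⟨h, h'⟩ i hi
      by_cases hi0 : i = 0
      · rw [hi0, h]
      · exact h' i (by omega)
    · intro h
      exact ⟨h 0 (by omega), fun i hi => h i (by omega)⟩
  have h2 : ∫ _ in A, P (g 0) (restrictPast g) ∂ν =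
      P (g 0) (restrictPast g) * pr ν (Finset.Ico (-m) 0) g := by
    rw [setIntegral_const, smul_eq_mul, mul_comm, pr]
  have hmeas : Measurable fun ω : ZSeq Bool => P (g 0) (restrictPast ω) :=
    (hP.1 (g 0)).comp (measurable_pi_lambda _ fun k => measurable_pi_apply _)
  have hPint : Integrable (fun ω : ZSeq Bool => P (g 0) (restrictPast ω)) ν :=
    Integrable.of_bound hmeas.aestronglyMeasurable 1 (ae_of_all _ fun ω => by
      have := (hP.2 (restrictPast ω)).2 (g 0)
      rw [Real.norm_eq_abs, abs_of_nonneg this.1]; exact this.2)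
  rw [← h1, ← h2, ← integral_sub hPint.integrableOn (integrable_const _), ← Real.norm_eq_abs]
  refine norm_setIntegral_le_of_norm_le_const (measure_lt_top ν A) fun ω hω => ?_
  rw [Real.norm_eq_abs]
  refine abs_sub_le_varG hP (fun j hj => ?_) _
  exact hω _ (by simp; omega)

lemma pr_ratio_compare {ν : Measure (ZSeq Bool)} {P : Bool → Past Bool → ℝ} (hP : IsGFunction P)
    (hν : IsGMeasure ν P) {c : ℝ} (hc : 0 < c)
    (hfe : ∀ (T : Finset ℤ) (x : ℤ), x ∉ T → ∀ g, c * pr ν T g ≤ pr ν (insert x T) g)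
    {k m : ℕ} (hkm : k ≤ m) (g : ZSeq Bool) :
    pr ν (Finset.Ico (-m) 1) g * pr ν (Finset.Ico (-k) 0) g ≤
        (1 + 2 * varG P k / c) * (pr ν (Finset.Ico (-k) 1) g * pr ν (Finset.Ico (-m) 0) g) ∧
      pr ν (Finset.Ico (-k) 1) g * pr ν (Finset.Ico (-m) 0) g ≤
        (1 + 2 * varG P k / c) * (pr ν (Finset.Ico (-m) 1) g * pr ν (Finset.Ico (-k) 0) g) := by
  have e : ∀ n : ℕ, Finset.Ico (-(n : ℤ)) 1 = insert 0 (Finset.Ico (-(n : ℤ)) 0) := by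
    intro n; ext i; simp; omega
  have h1 := abs_le.1 (abs_pr_sub_le hP hν le_rfl (k := k) g)
  have h2 := abs_le.1 (abs_pr_sub_le hP hν hkm g)
  have f1 := hfe (Finset.Ico (-(k : ℤ)) 0) 0 (by simp) g
  have f2 := hfe (Finset.Ico (-(m : ℤ)) 0) 0 (by simp) g
  rw [← e] at f1 f2
  have p1 := pr_nonneg ν (Finset.Ico (-(k : ℤ)) 0) g
  have p2 := pr_nonneg ν (Finset.Ico (-(m : ℤ)) 0) g
  have hv := varG_nonneg hP k
  generalize varG P k = v at *
  generalize pr ν (Finset.Ico (-(k : ℤ)) 0) g = x at *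
  generalize pr ν (Finset.Ico (-(k : ℤ)) 1) g = x' at *
  generalize pr ν (Finset.Ico (-(m : ℤ)) 0) g = y at *
  generalize pr ν (Finset.Ico (-(m : ℤ)) 1) g = y' at *
  generalize P (g 0) (restrictPast g) = p at *
  have hvc : 0 ≤ 2 * v / c := by positivity
  have g1 : 2 * v * (x * y) ≤ 2 * v / c * (x' * y) := by
    rw [div_mul_eq_mul_div, le_div_iff₀ hc]
    nlinarith [mul_le_mul_of_nonneg_right f1 (mul_nonneg hv p2)]
  have g2 : 2 * v * (x * y) ≤ 2 * v / c * (y' * x) := by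
    rw [div_mul_eq_mul_div, le_div_iff₀ hc]
    nlinarith [mul_le_mul_of_nonneg_right f2 (mul_nonneg hv p1)]
  constructor
  · nlinarith [mul_le_mul_of_nonneg_right h2.2 p1, mul_le_mul_of_nonneg_right h1.1 p2]
  · nlinarith [mul_le_mul_of_nonneg_right h1.2 p2, mul_le_mul_of_nonneg_right h2.1 p1]

/-- Summable variations and finite energy give quasi-independence of adjacent blocks. -/
lemma quasi_independence {ν : Measure (ZSeq Bool)} {P : Bool → Past Bool → ℝ}
    (hP : IsGFunction P) (hν : IsGMeasure ν P) {c : ℝ} (hc : 0 < c)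
    (hfe : ∀ (T : Finset ℤ) (x : ℤ), x ∉ T → ∀ g, c * pr ν T g ≤ pr ν (insert x T) g)
    (hpos : ∀ T g, 0 < pr ν T g) (hsum : Summable fun k : ℕ => varG P (k + 1)) :
    ∃ C : ℝ, 1 ≤ C ∧ ∀ (a b d : ℤ) (g : ZSeq Bool), a ≤ b → b ≤ d →
      pr ν (Finset.Ico a d) g ≤ C * (pr ν (Finset.Ico a b) g * pr ν (Finset.Ico b d) g) ∧
      pr ν (Finset.Ico a b) g * pr ν (Finset.Ico b d) g ≤ C * pr ν (Finset.Ico a d) g := by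
  have hprob := hν.1
  set w : ℕ → ℝ := fun i => 1 + 2 * varG P i / c with hw
  have hw1 : ∀ i, 1 ≤ w i := fun i => by
    have := varG_nonneg hP i
    have : 0 ≤ 2 * varG P i / c := by positivity
    simp only [hw]; linarith
  have hsum' : Summable fun k : ℕ => varG P k := (summable_nat_add_iff 1).1 hsum
  have hs2 : Summable fun i => 2 * varG P i / c := (hsum'.mul_left 2).div_const c
  set C := Real.exp (∑' i, 2 * varG P i / c) with hC
  have hprod : ∀ n, ∏ i ∈ Finset.range n, w i ≤ C := by
    intro n
    have hnn : ∀ i, 0 ≤ 2 * varG P i / c := fun i => by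
      have := varG_nonneg hP i; positivity
    calc ∏ i ∈ Finset.range n, w i ≤ ∏ i ∈ Finset.range n, Real.exp (2 * varG P i / c) :=
          Finset.prod_le_prod (fun i _ => zero_le_one.trans (hw1 i)) fun i _ => by
            have := Real.add_one_le_exp (2 * varG P i / c); simp only [hw]; linarith
      _ = Real.exp (∑ i ∈ Finset.range n, 2 * varG P i / c) := (Real.exp_sum _ _).symm
      _ ≤ C := Real.exp_le_exp.2 (hs2.sum_le_tsum _ fun i _ => hnn i)
  refine ⟨C, by simpa using hprod 0, ?_⟩
  have key : ∀ (a b : ℤ) (g : ZSeq Bool), a ≤ b → ∀ n : ℕ,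
      pr ν (Finset.Ico a (b + n)) g ≤ (∏ i ∈ Finset.range n, w i) *
        (pr ν (Finset.Ico a b) g * pr ν (Finset.Ico b (b + n)) g) ∧
      pr ν (Finset.Ico a b) g * pr ν (Finset.Ico b (b + n)) g ≤
        (∏ i ∈ Finset.range n, w i) * pr ν (Finset.Ico a (b + n)) g := by
    intro a b g hab n
    induction n with
    | zero => simp [pr_empty]
    | succ n ih =>
      obtain ⟨m, hm⟩ : ∃ m : ℕ, a = b + n - m := ⟨(b + n - a).toNat, by omega⟩
      have hr := pr_ratio_compare hP hν hc hfe (k := n) (m := m) (by omega)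
        (fun i => g (i + (b + n)))
      simp only [← pr_shift_int hν.2.1] at hr
      rw [show -(m : ℤ) + (b + n) = a by omega, show -(n : ℤ) + (b + n) = b by ring, zero_add,
        show 1 + (b + n) = b + (n + 1 : ℕ) by push_cast; ring] at hr
      rw [Finset.prod_range_succ]
      have hW : 0 < ∏ i ∈ Finset.range n, w i :=
        Finset.prod_pos fun i _ => zero_lt_one.trans_le (hw1 i)
      have hwn : w n = 1 + 2 * varG P n / c := rfl
      rw [← hwn] at hr
      have hwp := zero_lt_one.trans_le (hw1 n)
      have p1 := hpos (Finset.Ico a (b + n)) g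
      have p2 := hpos (Finset.Ico b (b + n)) g
      have p3 := hpos (Finset.Ico a (b + (n + 1 : ℕ))) g
      have p4 := hpos (Finset.Ico b (b + (n + 1 : ℕ))) g
      have p5 := hpos (Finset.Ico a b) g
      generalize pr ν (Finset.Ico a (b + n)) g = x at *
      generalize pr ν (Finset.Ico b (b + n)) g = y at *
      generalize pr ν (Finset.Ico a (b + (n + 1 : ℕ))) g = x' at *
      generalize pr ν (Finset.Ico b (b + (n + 1 : ℕ))) g = y' at *
      generalize pr ν (Finset.Ico a b) g = z at *
      generalize ∏ i ∈ Finset.range n, w i = W at *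
      generalize w n = u at *
      constructor
      · refine le_of_mul_le_mul_right (hr.1.trans ?_) p2
        calc u * (y' * x) ≤ u * (y' * (W * (z * y))) := by gcongr; exact ih.1
          _ = W * u * (z * y') * y := by ring
      · refine le_of_mul_le_mul_right ?_ p1
        calc z * y' * x = z * (y' * x) := by ring
          _ ≤ z * (u * (x' * y)) := mul_le_mul_of_nonneg_left hr.2 p5.le
          _ = u * x' * (z * y) := by ring
          _ ≤ u * x' * (W * x) := mul_le_mul_of_nonneg_left ih.2 (by positivity)
          _ = W * u * x' * x := by ring
  intro a b d g hab hbd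
  obtain ⟨n, rfl⟩ : ∃ n : ℕ, d = b + n := ⟨(d - b).toNat, by omega⟩
  have h := key a b g hab n
  refine ⟨h.1.trans ?_, h.2.trans ?_⟩
  · exact mul_le_mul_of_nonneg_right (hprod n) (mul_nonneg (pr_nonneg _ _ _) (pr_nonneg _ _ _))
  · exact mul_le_mul_of_nonneg_right (hprod n) (pr_nonneg _ _ _)

end Cylinders

section Comparison

/-- Adjacent blocks are independent up to a factor `C`. -/
def QuasiIndep (ν : Measure (ZSeq Bool)) (C : ℝ) : Prop :=
  ∀ (a b d : ℤ) (g : ZSeq Bool), a ≤ b → b ≤ d →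
    pr ν (Finset.Ico a d) g ≤ C * (pr ν (Finset.Ico a b) g * pr ν (Finset.Ico b d) g) ∧
    pr ν (Finset.Ico a b) g * pr ν (Finset.Ico b d) g ≤ C * pr ν (Finset.Ico a d) g

lemma LocalOn.mul {T : Finset ℤ} {f g : ZSeq Bool → ℝ} (hf : LocalOn T f) (hg : LocalOn T g) :
    LocalOn T fun η => f η * g η := fun η η' h => by
  simp only [hf η η' h, hg η η' h]

lemma QuasiIndep.integral_mul {ν : Measure (ZSeq Bool)} [IsProbabilityMeasure ν] {C : ℝ}
    (hQ : QuasiIndep ν C) {a b d : ℤ} (hab : a ≤ b) (hbd : b ≤ d) {f g : ZSeq Bool → ℝ}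
    (hf : LocalOn (Finset.Ico a b) f) (hg : LocalOn (Finset.Ico b d) g)
    (hf0 : ∀ η, 0 ≤ f η) (hg0 : ∀ η, 0 ≤ g η) :
    ∫ η, f η * g η ∂ν ≤ C * ((∫ η, f η ∂ν) * ∫ η, g η ∂ν) ∧
      (∫ η, f η ∂ν) * ∫ η, g η ∂ν ≤ C * ∫ η, f η * g η ∂ν := by
  have hU : Finset.Ico a b ∪ Finset.Ico b d = Finset.Ico a d :=
    Finset.Ico_union_Ico_eq_Ico hab hbd
  have hD : Disjoint (Finset.Ico a b) (Finset.Ico b d) := Finset.Ico_disjoint_Ico_consecutive a b d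
  have hfg : LocalOn (Finset.Ico a b ∪ Finset.Ico b d) fun η => f η * g η :=
    (hf.mono Finset.subset_union_left).mul (hg.mono Finset.subset_union_right)
  have e1 : ∫ η, f η * g η ∂ν = ∑ ζ ∈ confs (Finset.Ico a b) (fun _ => true),
      ∑ σ ∈ confs (Finset.Ico b d) ζ, f σ * g σ * pr ν (Finset.Ico a d) σ := by
    rw [hfg.integral ν fun _ => true, sum_confs_union hD, hU]
  have e2 : (∫ η, f η ∂ν) * ∫ η, g η ∂ν = ∑ ζ ∈ confs (Finset.Ico a b) (fun _ => true),
      ∑ σ ∈ confs (Finset.Ico b d) ζ, f σ * g σ *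
        (pr ν (Finset.Ico a b) σ * pr ν (Finset.Ico b d) σ) := by
    rw [hf.integral ν fun _ => true, Finset.sum_mul]
    refine Finset.sum_congr rfl fun ζ _ => ?_
    rw [hg.integral ν ζ, Finset.mul_sum]
    refine Finset.sum_congr rfl fun σ hσ => ?_
    have h : ∀ i ∈ Finset.Ico a b, ζ i = σ i := fun i hi =>
      (mem_confs.1 hσ i (Finset.disjoint_left.1 hD hi)).symm
    rw [hf ζ σ h, pr_congr ν h]
    ring
  rw [e1, e2, Finset.mul_sum, Finset.mul_sum]
  constructor <;> refine Finset.sum_le_sum fun ζ _ => ?_ <;> rw [Finset.mul_sum] <;>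
    refine Finset.sum_le_sum fun σ _ => ?_
  · have := mul_le_mul_of_nonneg_left (hQ a b d σ hab hbd).1 (mul_nonneg (hf0 σ) (hg0 σ))
    linarith
  · have := mul_le_mul_of_nonneg_left (hQ a b d σ hab hbd).2 (mul_nonneg (hf0 σ) (hg0 σ))
    linarith

lemma cyl_indicator_nonneg (T : Finset ℤ) (g η : ZSeq Bool) :
    0 ≤ (cyl T g).indicator (fun _ => (1 : ℝ)) η :=
  Set.indicator_nonneg (fun _ _ => zero_le_one) η

lemma cyl_union_indicator (T T' : Finset ℤ) (g η : ZSeq Bool) :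
    (cyl (T ∪ T') g).indicator (fun _ => (1 : ℝ)) η =
      (cyl T g).indicator (fun _ => 1) η * (cyl T' g).indicator (fun _ => 1) η := by
  classical
  have : η ∈ cyl (T ∪ T') g ↔ η ∈ cyl T g ∧ η ∈ cyl T' g := by
    simp only [cyl, Set.mem_ofPred_eq, Finset.mem_union]
    exact ⟨fun h => ⟨fun i hi => h i (Or.inl hi), fun i hi => h i (Or.inr hi)⟩,
      fun h i hi => hi.elim (h.1 i) (h.2 i)⟩
  simp only [Set.indicator_apply, this]
  by_cases h1 : η ∈ cyl T g <;> by_cases h2 : η ∈ cyl T' g <;> simp [h1, h2]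

lemma QuasiIndep.sandwich {ν : Measure (ZSeq Bool)} [IsProbabilityMeasure ν] {C : ℝ}
    (hQ : QuasiIndep ν C) (hC : 0 ≤ C) {a b k : ℤ} (ha : a ≤ 0) (hk : 0 ≤ k) (hb : k ≤ b)
    (g : ZSeq Bool) {f : ZSeq Bool → ℝ} (hf : LocalOn (Finset.Ico 0 k) f) (hf0 : ∀ η, 0 ≤ f η) :
    ∫ η, f η * (cyl (Finset.Ico a 0 ∪ Finset.Ico k b) g).indicator (fun _ => 1) η ∂ν ≤
        C ^ 2 * (pr ν (Finset.Ico a 0) g * pr ν (Finset.Ico k b) g * ∫ η, f η ∂ν) ∧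
      pr ν (Finset.Ico a 0) g * pr ν (Finset.Ico k b) g * ∫ η, f η ∂ν ≤
        C ^ 2 * ∫ η, f η *
          (cyl (Finset.Ico a 0 ∪ Finset.Ico k b) g).indicator (fun _ => 1) η ∂ν := by
  set u : ZSeq Bool → ℝ := (cyl (Finset.Ico a 0) g).indicator fun _ => 1 with hu
  set v : ZSeq Bool → ℝ := (cyl (Finset.Ico k b) g).indicator fun _ => 1 with hv
  have e : ∀ η, f η * (cyl (Finset.Ico a 0 ∪ Finset.Ico k b) g).indicator (fun _ => 1) η =
      u η * (f η * v η) := fun η => by rw [cyl_union_indicator]; ring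
  simp only [e]
  have hfv : LocalOn (Finset.Ico 0 b) fun η => f η * v η :=
    (hf.mono (Finset.Ico_subset_Ico_right hb)).mul
      ((localOn_cyl _ g).mono (Finset.Ico_subset_Ico_left hk))
  have hu0 : ∀ η, 0 ≤ u η := cyl_indicator_nonneg _ g
  have hv0 : ∀ η, 0 ≤ v η := cyl_indicator_nonneg _ g
  have h1 := hQ.integral_mul ha (hk.trans hb) (localOn_cyl _ g) hfv hu0
    fun η => mul_nonneg (hf0 η) (hv0 η)
  have h2 := hQ.integral_mul hk hb hf (localOn_cyl _ g) hf0 hv0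
  rw [integral_cyl] at h1 h2
  have p1 := pr_nonneg ν (Finset.Ico a 0) g
  constructor
  · refine h1.1.trans ?_
    calc _ ≤ C * (pr ν (Finset.Ico a 0) g * (C * ((∫ η, f η ∂ν) * pr ν (Finset.Ico k b) g))) :=
          mul_le_mul_of_nonneg_left (mul_le_mul_of_nonneg_left h2.1 p1) hC
      _ = _ := by ring
  · calc _ = pr ν (Finset.Ico a 0) g * ((∫ η, f η ∂ν) * pr ν (Finset.Ico k b) g) := by ring
      _ ≤ pr ν (Finset.Ico a 0) g * (C * ∫ η, f η * v η ∂ν) :=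
          mul_le_mul_of_nonneg_left h2.2 p1
      _ = C * (pr ν (Finset.Ico a 0) g * ∫ η, f η * v η ∂ν) := by ring
      _ ≤ C * (C * ∫ η, u η * (f η * v η) ∂ν) := mul_le_mul_of_nonneg_left h1.2 hC
      _ = _ := by ring

lemma zf_cond {V : Type*} [DecidableEq V] (κ : ℝ) (E : Finset (V × V)) {Λ T : Finset V}
    (hT : T ⊆ Λ) (η ζ : V → Bool) (f : (V → Bool) → ℝ) :
    zf κ E Λ η (fun σ => f σ * {σ : V → Bool | ∀ x ∈ T, σ x = ζ x}.indicator (fun _ => 1) σ) =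
      zf κ E (Λ \ T) (T.piecewise ζ η) f := by
  classical
  have e : confs (Λ \ T) (T.piecewise ζ η) =
      (confs Λ η).filter (fun σ => ∀ x ∈ T, σ x = ζ x) := by
    convert (filter_confs_eq hT η ζ).symm
  rw [zf, zf, e, Finset.sum_filter]
  refine Finset.sum_congr rfl fun σ _ => ?_
  simp only [Set.indicator_apply, Set.mem_ofPred_eq]
  split_ifs <;> simp

lemma av_cond {V : Type*} [DecidableEq V] (κ : ℝ) (E : Finset (V × V)) {Λ T : Finset V}
    (hT : T ⊆ Λ) (η ζ : V → Bool) (f : (V → Bool) → ℝ) :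
    av κ E Λ η (fun σ => f σ * {σ : V → Bool | ∀ x ∈ T, σ x = ζ x}.indicator (fun _ => 1) σ) =
      av κ E (Λ \ T) (T.piecewise ζ η) f *
        av κ E Λ η (fun σ => {σ : V → Bool | ∀ x ∈ T, σ x = ζ x}.indicator (fun _ => 1) σ) := by
  have h1 := zf_cond κ E hT η ζ fun _ => 1
  simp only [one_mul] at h1
  have hp := zf_one_pos (κ := κ) (E := E) (Λ := Λ \ T) (η := T.piecewise ζ η)
  rw [av, av, av, zf_cond κ E hT, h1]
  field_simp

/-- The part of the segment `[a, b)` of the line outside `[0, k)`. -/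
noncomputable def lineOut (a b k : ℤ) : Finset (ℤ × ℤ) := blk a b 0 0 \ blk 0 k 0 0

lemma mem_lineOut {a b k : ℤ} {x : ℤ × ℤ} :
    x ∈ lineOut a b k ↔ x.2 = 0 ∧ (a ≤ x.1 ∧ x.1 < b) ∧ ¬ (0 ≤ x.1 ∧ x.1 < k) := by
  rw [lineOut, Finset.mem_sdiff, mem_blk, mem_blk]
  omega

lemma lineProj_mem_cyl_iff {a b k : ℤ} (ha : a ≤ 0) (hk : 0 ≤ k) (hb : k ≤ b) (c : Bool)
    (σ : Cfg2) :
    lineProj σ ∈ cyl (Finset.Ico a 0 ∪ Finset.Ico k b) (fun _ => c) ↔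
      ∀ x ∈ lineOut a b k, σ x = c := by
  constructor
  · rintro h ⟨i, j⟩ hx
    rw [mem_lineOut] at hx
    obtain ⟨rfl, h1, h2⟩ := hx
    refine h i ?_
    rw [Finset.mem_union, Finset.mem_Ico, Finset.mem_Ico]
    dsimp only at h1 h2
    omega
  · intro h i hi
    rw [Finset.mem_union, Finset.mem_Ico, Finset.mem_Ico] at hi
    refine h (i, 0) (mem_lineOut.2 ⟨rfl, ?_⟩)
    dsimp only
    omega

lemma lineOut_subset {a b k : ℤ} {n : ℕ} (ha : -(n : ℤ) ≤ a) (hb : b ≤ n) :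
    lineOut a b k ⊆ box n := by
  intro x hx
  rw [mem_lineOut] at hx
  rw [box, Finset.mem_product, Finset.mem_Icc, Finset.mem_Icc]
  omega

lemma boxAv_cond (β : ℝ) {a b k : ℤ} {n : ℕ} (ha : -(n : ℤ) ≤ a) (hb : b ≤ n) (ha0 : a ≤ 0)
    (hk : 0 ≤ k) (hkb : k ≤ b) (c : Bool) (f : Cfg2 → ℝ) :
    boxAv β n (fun σ => f σ *
        (cyl (Finset.Ico a 0 ∪ Finset.Ico k b) fun _ => c).indicator (fun _ => 1) (lineProj σ)) =
      av (β / 2) (edg (box n)) (box n \ lineOut a b k)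
          ((lineOut a b k).piecewise (fun _ => c) fun _ => true) f *
        boxAv β n (fun σ =>
          (cyl (Finset.Ico a 0 ∪ Finset.Ico k b) fun _ => c).indicator (fun _ => 1)
            (lineProj σ)) := by
  classical
  have e : ∀ σ : Cfg2, (cyl (Finset.Ico a 0 ∪ Finset.Ico k b) fun _ => c).indicator
      (fun _ => (1 : ℝ)) (lineProj σ) =
      {σ : Cfg2 | ∀ x ∈ lineOut a b k, σ x = (fun _ => c) x}.indicator (fun _ => 1) σ := by
    intro σ
    simp only [Set.indicator_apply, lineProj_mem_cyl_iff ha0 hk hkb, Set.mem_ofPred_eq]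
  simp only [e, boxAv]
  exact av_cond _ _ (lineOut_subset ha hb) _ (fun _ => c) f

lemma av_le_av_anti {V : Type*} [DecidableEq V] {κ : ℝ} (hκ : 0 ≤ κ) (E : Finset (V × V))
    {Λ Λ' : Finset V} {η η' : V → Bool} (hle : BdLe Λ η Λ' η') {f : (V → Bool) → ℝ}
    (hf : Antitone f) : av κ E Λ' η' f ≤ av κ E Λ η f := by
  have h := av_le_av hκ E hle (f := fun σ => (-1) * f σ) fun σ σ' hσ => by
    have := hf hσ
    dsimp only
    linarith
  rw [av_const_mul, av_const_mul] at h
  linarith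

lemma lineProj_mono {σ σ' : Cfg2} (h : σ ≤ σ') : lineProj σ ≤ lineProj σ' := fun i => h (i, 0)

lemma localOn_blk {k : ℤ} {f : ZSeq Bool → ℝ} (hf : LocalOn (Finset.Ico 0 k) f) (σ σ' : Cfg2)
    (h : ∀ x ∈ blk 0 k 0 0, σ x = σ' x) : f (lineProj σ) = f (lineProj σ') := by
  refine hf _ _ fun i hi => h (i, 0) ?_
  rw [Finset.mem_Ico] at hi
  rw [mem_blk]
  dsimp only
  omega

/-- The slab around the segment `[0, k)` with the segment attached. -/
noncomputable def slab (a b M k : ℤ) : Finset (ℤ × ℤ) :=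
  blk 0 k 0 0 ∪ (blk a b 1 M ∪ blk a b (-M) (-1))

lemma mem_slab {a b M k : ℤ} {x : ℤ × ℤ} :
    x ∈ slab a b M k ↔ (x.2 = 0 ∧ 0 ≤ x.1 ∧ x.1 < k) ∨
      (a ≤ x.1 ∧ x.1 < b) ∧ (1 ≤ x.2 ∧ x.2 ≤ M ∨ -M ≤ x.2 ∧ x.2 ≤ -1) := by
  rw [slab, Finset.mem_union, Finset.mem_union, mem_blk, mem_blk, mem_blk]
  omega

lemma slab_subset_box {a b M k : ℤ} {n : ℕ} (ha : -(n : ℤ) ≤ a) (hb : b ≤ n) (hM : M ≤ n)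
    (hkb : k ≤ b) (hM0 : 0 ≤ M) : slab a b M k ⊆ box n := by
  intro x hx
  rw [mem_slab] at hx
  rw [box, Finset.mem_product, Finset.mem_Icc, Finset.mem_Icc]
  omega

lemma notMem_lineOut_of_slab {a b M k : ℤ} {x : ℤ × ℤ} (hx : x ∈ slab a b M k) :
    x ∉ lineOut a b k := by
  rw [mem_slab] at hx
  rw [mem_lineOut]
  omega

lemma piecewise_false (T : Finset (ℤ × ℤ)) :
    T.piecewise (fun _ => false) (fun _ => true) = minusOn T := by
  funext x
  by_cases h : x ∈ T <;> simp [h, minusOn]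

lemma piecewise_true (T : Finset (ℤ × ℤ)) :
    T.piecewise (fun _ => true) (fun _ => true) = fun _ : ℤ × ℤ => true := by
  funext x
  by_cases h : x ∈ T <;> simp [h]

/-- Up to a constant, decreasing events are at least as likely as their spin flips. -/
lemma integral_flip_le {β : ℝ} (hβ : 0 < β) {μp : Measure Cfg2} (hμp : IsPlusPhase β 0 μp)
    {C : ℝ} (hC : 0 ≤ C) (hQ : QuasiIndep (schonmann μp) C) {k : ℕ} (hk : 1 ≤ k)
    {f : ZSeq Bool → ℝ} (hf : LocalOn (Finset.Ico 0 k) f) (hf0 : ∀ η, 0 ≤ f η) (hfa : Antitone f) :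
    ∫ η, f (flipc η) ∂(schonmann μp) ≤ 4 * C ^ 4 * ∫ η, f η ∂(schonmann μp) := by
  have hprob := schonmann_prob hμp
  have hκ : 0 ≤ β / 2 := by linarith
  obtain ⟨a, b, M, ha, hb, hM, hslab⟩ := exists_slab hβ hk
  have hf' : LocalOn (Finset.Ico 0 k) fun η => f (flipc η) := fun η η' h =>
    hf _ _ fun i hi => by simp only [flipc, h i hi]
  set T := Finset.Ico a 0 ∪ Finset.Ico (k : ℤ) b with hT
  set m : ZSeq Bool := fun _ => false with hm
  have hline : (∫ η, f (flipc η) ∂(schonmann μp)) * pr (schonmann μp) T m ≤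
      4 * ∫ η, f η * (cyl T m).indicator (fun _ => 1) η ∂(schonmann μp) := by
    have hfT : LocalOn (Finset.Ico 0 (k : ℤ) ∪ T) fun η =>
        f η * (cyl T m).indicator (fun _ => 1) η :=
      (hf.mono Finset.subset_union_left).mul ((localOn_cyl T m).mono Finset.subset_union_right)
    refine le_of_tendsto_of_tendsto ((tendsto_boxAv hμp hf').mul (tendsto_boxAv_cyl hμp T m))
      ((tendsto_boxAv hμp hfT).const_mul 4) ?_
    filter_upwards [eventually_ge_atTop (a.natAbs + b.natAbs + M.natAbs)] with n hn
    rw [boxAv_cond β (by omega) (by omega) (by omega) (by omega) (by omega), piecewise_false,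
      ← mul_assoc]
    have hpos : 0 ≤ boxAv β n fun σ => (cyl T m).indicator (fun _ => 1) (lineProj σ) :=
      av_nonneg fun σ _ => cyl_indicator_nonneg T m _
    refine mul_le_mul_of_nonneg_right ?_ hpos
    set F : Cfg2 → ℝ := fun σ => f (lineProj σ) with hF
    have hFa : Antitone F := fun σ σ' h => hfa (lineProj_mono h)
    have h0 := (hslab F (fun σ => hf0 _) (localOn_blk hf) (slab a b M k) rfl).2
    have hsub : slab a b M k ⊆ box n :=
      slab_subset_box (by omega) (by omega) (by omega) (by omega) (by omega)
    rw [← av_edg_subset _ hsub, ← av_edg_subset _ hsub] at h0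
    have h1 : av (β / 2) (edg (box n)) (slab a b M k) (minusOn (lineOut a b k)) F ≤
        av (β / 2) (edg (box n)) (box n \ lineOut a b k) (minusOn (lineOut a b k)) F := by
      refine av_le_av_anti hκ _ ⟨fun x hx hx' => ?_, fun x hx hx' => ?_⟩ hFa
      · refine ⟨fun h => hx (Finset.mem_sdiff.2 ⟨hsub h, notMem_lineOut_of_slab h⟩), hx'⟩
      · refine ⟨fun h => ?_, hx'⟩
        rw [minusOn_of_notMem (Finset.mem_sdiff.1 h).2] at hx'
        exact Bool.noConfusion hx'
    have h2 : av (β / 2) (edg (box n)) (box n) (fun _ => false) F ≤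
        av (β / 2) (edg (box n)) (slab a b M k) (fun _ => false) F := by
      refine av_le_av_anti hκ _ ⟨fun x hx hx' => Bool.noConfusion hx', fun x hx hx' => ?_⟩ hFa
      exact ⟨fun h => hx (hsub h), rfl⟩
    rw [av_false] at h2
    have e : (boxAv β n fun σ => f (flipc (lineProj σ))) =
        av (β / 2) (edg (box n)) (box n) (fun _ => true) (fun σ => F (flipc σ)) := rfl
    rw [e]
    have h0' : av (β / 2) (edg (box n)) (slab a b M k) (fun _ => false) F ≤
        4 * av (β / 2) (edg (box n)) (slab a b M k) (minusOn (lineOut a b k)) F := h0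
    linarith
  have s1 := (hQ.sandwich hC (a := a) (b := b) (k := k) (by omega) (by omega) (by omega) m hf
    hf0).1
  have s2 := (hQ.sandwich hC (a := a) (b := b) (k := k) (by omega) (by omega) (by omega) m
    (f := fun _ => 1) (fun _ _ _ => rfl) fun _ => zero_le_one).2
  simp only [one_mul, integral_const, probReal_univ, smul_eq_mul, mul_one] at s2
  rw [integral_cyl] at s2
  have p1 := pr_pos hβ hμp (Finset.Ico a 0) m
  have p2 := pr_pos hβ hμp (Finset.Ico (k : ℤ) b) m
  have hfl : 0 ≤ ∫ η, f (flipc η) ∂(schonmann μp) := integral_nonneg fun η => hf0 _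
  set q := pr (schonmann μp) (Finset.Ico a 0) m * pr (schonmann μp) (Finset.Ico (k : ℤ) b) m
  have hq : 0 < q := mul_pos p1 p2
  refine le_of_mul_le_mul_right ?_ hq
  calc (∫ η, f (flipc η) ∂(schonmann μp)) * q
      ≤ (∫ η, f (flipc η) ∂(schonmann μp)) * (C ^ 2 * pr (schonmann μp) T m) :=
        mul_le_mul_of_nonneg_left s2 hfl
    _ = C ^ 2 * ((∫ η, f (flipc η) ∂(schonmann μp)) * pr (schonmann μp) T m) := by ring
    _ ≤ C ^ 2 * (4 * (C ^ 2 * (q * ∫ η, f η ∂(schonmann μp)))) :=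
        mul_le_mul_of_nonneg_left (hline.trans (mul_le_mul_of_nonneg_left s1 (by norm_num)))
          (by positivity)
    _ = 4 * C ^ 4 * (∫ η, f η ∂(schonmann μp)) * q := by ring

end Comparison

section LongRangeOrder

/-- The indicator that all spins of the segment `[0, k)` equal `c`. -/
noncomputable def allEq (k : ℕ) (c : Bool) : ZSeq Bool → ℝ :=
  (cyl (Finset.Ico 0 (k : ℤ)) fun _ => c).indicator fun _ => 1

lemma allEq_nonneg (k : ℕ) (c : Bool) (η : ZSeq Bool) : 0 ≤ allEq k c η :=
  cyl_indicator_nonneg _ _ η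

lemma allEq_flipc (k : ℕ) (c : Bool) (η : ZSeq Bool) : allEq k c (flipc η) = allEq k (!c) η := by
  classical
  have : flipc η ∈ cyl (Finset.Ico 0 (k : ℤ)) (fun _ => c) ↔
      η ∈ cyl (Finset.Ico 0 (k : ℤ)) (fun _ => !c) :=
    forall₂_congr fun i _ => by cases c <;> simp [flipc]
  simp only [allEq, Set.indicator_apply, this]

lemma allEq_mono (k : ℕ) : Monotone (allEq k true) := by
  classical
  intro η η' h
  rw [allEq, Set.indicator_apply, Set.indicator_apply]
  by_cases h' : η ∈ cyl (Finset.Ico 0 (k : ℤ)) fun _ => true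
  · have : η' ∈ cyl (Finset.Ico 0 (k : ℤ)) fun _ => true := fun i hi => by
      have h1 := h i
      have h2 := h' i hi
      dsimp only at h2
      rw [h2] at h1
      exact top_le_iff.1 h1
    rw [if_pos h', if_pos this]
  · rw [if_neg h']
    split_ifs <;> norm_num

lemma allEq_anti (k : ℕ) : Antitone (allEq k false) := by
  intro η η' h
  have e : ∀ η, allEq k false η = allEq k true (flipc η) := fun η => (allEq_flipc k true η).symm
  rw [e, e]
  refine allEq_mono k fun i => ?_
  have := h i
  revert this
  simp only [flipc]
  cases η i <;> cases η' i <;> simp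

lemma slab_allEq_le {β : ℝ} (hβ : 0 < β) {μp : Measure Cfg2} (hμp : IsPlusPhase β 0 μp)
    {C : ℝ} (hC : 0 ≤ C) (hQ : QuasiIndep (schonmann μp) C) {k : ℕ} (hk : 1 ≤ k) :
    ∃ a b M : ℤ, a ≤ -1 ∧ (k : ℤ) + 1 ≤ b ∧ 1 ≤ M ∧
      av (β / 2) (edg (slab a b M k)) (slab a b M k) (fun _ => true)
          (fun σ => allEq k true (lineProj σ)) ≤
        64 * C ^ 8 * av (β / 2) (edg (slab a b M k)) (slab a b M k) (fun _ => true)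
          (fun σ => allEq k false (lineProj σ)) := by
  have hprob := schonmann_prob hμp
  have hκ : 0 ≤ β / 2 := by linarith
  obtain ⟨a, b, M, ha, hb, hM, hslab⟩ := exists_slab hβ hk
  refine ⟨a, b, M, ha, hb, hM, ?_⟩
  set X : Cfg2 → ℝ := fun σ => allEq k true (lineProj σ) with hX
  set Y : Cfg2 → ℝ := fun σ => allEq k false (lineProj σ) with hY
  have hXm : Monotone X := fun σ σ' h => allEq_mono k (lineProj_mono h)
  have hYa : Antitone Y := fun σ σ' h => allEq_anti k (lineProj_mono h)
  have hXY : (fun σ => X (flipc σ)) = Y := funext fun σ => allEq_flipc k true (lineProj σ)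
  have hYX : (fun σ => Y (flipc σ)) = X := funext fun σ => allEq_flipc k false (lineProj σ)
  have hloc : ∀ c, LocalOn (Finset.Ico 0 (k : ℤ)) (allEq k c) := fun c => localOn_cyl _ _
  set x := av (β / 2) (edg (slab a b M k)) (slab a b M k) (fun _ => true) X with hx
  set y := av (β / 2) (edg (slab a b M k)) (slab a b M k) (fun _ => true) Y with hy
  have hx0 : 0 ≤ x := av_nonneg fun σ _ => allEq_nonneg _ _ _
  have hy0 : 0 ≤ y := av_nonneg fun σ _ => allEq_nonneg _ _ _
  set m := minusOn (lineOut a b k) with hm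
  have i1 : av (β / 2) (edg (slab a b M k)) (slab a b M k) (flipc m) Y ≤ 4 * y := by
    have := (hslab X (fun σ => allEq_nonneg _ _ _) (localOn_blk (hloc true)) (slab a b M k) rfl).1
    rw [av_false, hXY] at this
    rw [av_flip, hYX]
    exact this
  have i2 : x ≤ 4 * av (β / 2) (edg (slab a b M k)) (slab a b M k) (flipc m) X := by
    have := (hslab Y (fun σ => allEq_nonneg _ _ _) (localOn_blk (hloc false)) (slab a b M k) rfl).2
    rw [av_false, hYX] at this
    rw [av_flip, hXY]
    exact this
  set T := Finset.Ico a 0 ∪ Finset.Ico (k : ℤ) b with hT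
  set p : ZSeq Bool := fun _ => true with hp
  have hlocT : ∀ c, LocalOn (Finset.Ico 0 (k : ℤ) ∪ T) fun η =>
      allEq k c η * (cyl T p).indicator (fun _ => 1) η := fun c =>
    ((hloc c).mono Finset.subset_union_left).mul
      ((localOn_cyl T p).mono Finset.subset_union_right)
  have hline : (∫ η, allEq k false η * (cyl T p).indicator (fun _ => 1) η ∂(schonmann μp)) * x ≤
      16 * (∫ η, allEq k true η * (cyl T p).indicator (fun _ => 1) η ∂(schonmann μp)) * y := by
    refine le_of_tendsto_of_tendsto ((tendsto_boxAv hμp (hlocT false)).mul_const x)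
      (((tendsto_boxAv hμp (hlocT true)).const_mul 16).mul_const y) ?_
    filter_upwards [eventually_ge_atTop (a.natAbs + b.natAbs + M.natAbs)] with n hn
    rw [boxAv_cond β (by omega) (by omega) (by omega) (by omega) (by omega),
      boxAv_cond β (by omega) (by omega) (by omega) (by omega) (by omega), piecewise_true]
    have hpos : 0 ≤ boxAv β n fun σ => (cyl T p).indicator (fun _ => 1) (lineProj σ) :=
      av_nonneg fun σ _ => cyl_indicator_nonneg T p _
    have hsub : slab a b M k ⊆ box n :=
      slab_subset_box (by omega) (by omega) (by omega) (by omega) (by omega)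
    rw [← av_edg_subset _ hsub] at i1 i2
    have hle : BdLe (slab a b M k) (flipc m) (box n \ lineOut a b k) fun _ => true := by
      refine ⟨fun z _ hz' => ⟨fun h => ?_, rfl⟩, fun z _ hz' => Bool.noConfusion hz'⟩
      rw [flipc, hm, minusOn_of_notMem (Finset.mem_sdiff.1 h).2] at hz'
      exact Bool.noConfusion hz'
    have j1 := (av_le_av_anti hκ (edg (box n)) hle hYa).trans i1
    have j2 := i2.trans (mul_le_mul_of_nonneg_left (av_le_av hκ (edg (box n)) hle hXm)
      (by norm_num : (0 : ℝ) ≤ 4))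
    have j3 := mul_le_mul j1 j2 hx0 (by positivity)
    have j4 := mul_le_mul_of_nonneg_right j3 hpos
    calc _ = _ := by rw [mul_right_comm]
      _ ≤ _ := j4
      _ = _ := by ring
  have s1 := (hQ.sandwich hC (a := a) (b := b) (k := k) (by omega) (by omega) (by omega) p
    (hloc true) (allEq_nonneg k true)).1
  have s2 := (hQ.sandwich hC (a := a) (b := b) (k := k) (by omega) (by omega) (by omega) p
    (hloc false) (allEq_nonneg k false)).2
  have s3 := integral_flip_le hβ hμp hC hQ hk (hloc false) (allEq_nonneg k false) (allEq_anti k)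
  simp only [allEq_flipc, Bool.not_false] at s3
  have p1 := pr_pos hβ hμp (Finset.Ico a 0) p
  have p2 := pr_pos hβ hμp (Finset.Ico (k : ℤ) b) p
  have p3 : 0 < ∫ η, allEq k false η ∂(schonmann μp) := by
    rw [allEq, integral_cyl]
    exact pr_pos hβ hμp _ _
  set q := pr (schonmann μp) (Finset.Ico a 0) p * pr (schonmann μp) (Finset.Ico (k : ℤ) b) p
  set r := ∫ η, allEq k false η ∂(schonmann μp)
  set r' := ∫ η, allEq k true η ∂(schonmann μp)
  set J := ∫ η, allEq k false η * (cyl T p).indicator (fun _ => 1) η ∂(schonmann μp)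
  set J' := ∫ η, allEq k true η * (cyl T p).indicator (fun _ => 1) η ∂(schonmann μp)
  have hq : 0 < q := mul_pos p1 p2
  refine le_of_mul_le_mul_left ?_ (mul_pos hq p3)
  calc q * r * x ≤ C ^ 2 * J * x := mul_le_mul_of_nonneg_right s2 hx0
    _ = C ^ 2 * (J * x) := by ring
    _ ≤ C ^ 2 * (16 * J' * y) := by gcongr
    _ ≤ C ^ 2 * (16 * (C ^ 2 * (q * (4 * C ^ 4 * r))) * y) := by
        gcongr
        exact s1.trans (by gcongr)
    _ = q * r * (64 * C ^ 8 * y) := by ring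

lemma energy_le_energy_true {V : Type*} (E : Finset (V × V)) (σ : V → Bool) :
    energy E σ ≤ energy E fun _ => true := by
  refine Finset.sum_le_sum fun p _ => ?_
  cases σ p.1 <;> cases σ p.2 <;> norm_num [sval]

lemma wt_le_wt_true {V : Type*} {κ : ℝ} (hκ : 0 ≤ κ) (E : Finset (V × V)) (σ : V → Bool) :
    wt κ E σ ≤ wt κ E fun _ => true :=
  Real.exp_le_exp.2 (mul_le_mul_of_nonneg_left (energy_le_energy_true E σ) hκ)

lemma zf_blk_union (κ : ℝ) (a b M : ℤ) {η : Cfg2} (hη : ∀ x, η (reflY x) = η x) :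
    zf κ (edg (blk a b 1 M ∪ blk a b (-M) (-1))) (blk a b 1 M ∪ blk a b (-M) (-1)) η
        (fun _ => 1) =
      zf κ (edg (blk a b 1 M)) (blk a b 1 M) η (fun _ => 1) ^ 2 := by
  have h := zf_decouple κ (blk_disjoint a b M) (blk_far a b M) η (f := fun _ => 1)
    (g := fun _ => 1) (fun _ _ _ => rfl) (fun _ _ _ => rfl)
  have h' : zf κ (edg (blk a b 1 M)) (blk a b 1 M) η (fun _ => 1) =
      zf κ (edg (blk a b (-M) (-1))) (blk a b (-M) (-1)) η (fun _ => 1) :=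
    zf_transport κ reflY reflY_nbrs (reflY_blk a b M) (fun x _ _ => hη x)
      (fun _ _ _ _ _ => rfl)
  simp only [mul_one] at h
  rw [h, ← h', sq]

lemma zf_slab_allEq (κ : ℝ) (a b M : ℤ) (k : ℕ) (c : Bool) :
    zf κ (edg (slab a b M k)) (slab a b M k) (fun _ => true)
        (fun σ => allEq k c (lineProj σ)) =
      wt κ (edg (slab a b M k) \ edg (blk a b 1 M ∪ blk a b (-M) (-1)))
          ((blk 0 k 0 0).piecewise (fun _ => c) fun _ => true) *
        zf κ (edg (blk a b 1 M)) (blk a b 1 M)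
          ((blk 0 k 0 0).piecewise (fun _ => c) fun _ => true) (fun _ => 1) ^ 2 := by
  have hS : blk 0 k 0 0 ⊆ slab a b M k := Finset.subset_union_left
  classical
  have hR : slab a b M k \ blk 0 k 0 0 = blk a b 1 M ∪ blk a b (-M) (-1) := by
    ext x
    rw [Finset.mem_sdiff, mem_slab, Finset.mem_union, mem_blk, mem_blk, mem_blk]
    omega
  have hη : ∀ x, (blk 0 k 0 0).piecewise (fun _ => c) (fun _ => true) (reflY x) =
      (blk 0 k 0 0).piecewise (fun _ => c) (fun _ => true) x := by
    intro x
    have : reflY x ∈ blk 0 k 0 0 ↔ x ∈ blk 0 k 0 0 := by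
      rw [mem_blk, mem_blk, reflY_apply]
      omega
    simp only [Finset.piecewise, this]
  rw [← zf_blk_union κ a b M hη, ← zf_edg_subset κ (hR ▸ Finset.sdiff_subset), ← hR,
    ← zf_cond _ _ hS]
  congr 1
  funext σ
  have : lineProj σ ∈ cyl (Finset.Ico 0 (k : ℤ)) (fun _ => c) ↔
      ∀ x ∈ blk 0 k 0 0, σ x = (fun _ => c) x := by
    constructor
    · rintro h ⟨i, j⟩ hx
      rw [mem_blk] at hx
      obtain rfl : j = 0 := by dsimp only at hx; omega
      exact h i (Finset.mem_Ico.2 (by dsimp only at hx; omega))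
    · intro h i hi
      rw [Finset.mem_Ico] at hi
      exact h (i, 0) (mem_blk.2 (by dsimp only; omega))
  simp only [allEq, Set.indicator_apply, this, Set.mem_ofPred_eq, one_mul]

lemma two_point_ge {β : ℝ} (hβ : betaCrit < β) {μp : Measure Cfg2} (hμp : IsPlusPhase β 0 μp)
    {C : ℝ} (hC : 1 ≤ C) (hQ : QuasiIndep (schonmann μp) C) (k : ℕ) :
    1 / (8 * C ^ 4) ≤ ∫ η, sval (η 0) * sval (η k) ∂(schonmann μp) := by
  have hprob := schonmann_prob hμp
  have hβ0 : 0 < β := betaCrit_pos.trans hβ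
  have hC0 : 0 < C := by linarith
  rcases Nat.eq_zero_or_pos k with rfl | hk
  · have : ∀ η : ZSeq Bool, sval (η 0) * sval (η (0 : ℕ)) = 1 := fun η => by
      rw [Nat.cast_zero, ← abs_mul_abs_self, abs_sval, one_mul]
    simp only [this, integral_const, probReal_univ, smul_eq_mul, mul_one]
    rw [div_le_one (by positivity)]
    have := one_le_pow₀ hC (n := 4)
    linarith
  obtain ⟨a, b, M, ha, hb, hM, h⟩ := slab_allEq_le hβ0 hμp hC0.le hQ hk
  set U := blk a b 1 M
  set z := zf (β / 2) (edg U) U (fun _ => true) fun _ => 1 with hz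
  set z' := zf (β / 2) (edg U) U (minusOn (blk 0 k 0 0)) fun _ => 1 with hz'
  have hz0 : 0 < z := zf_one_pos
  have hz'0 : 0 < z' := zf_one_pos
  have h1 : z ^ 2 ≤ (8 * C ^ 4 * z') ^ 2 := by
    rw [av, av, ← mul_div_assoc, div_le_div_iff_of_pos_right zf_one_pos, zf_slab_allEq,
      zf_slab_allEq, piecewise_true, piecewise_false] at h
    set w := wt (β / 2) (edg (slab a b M k) \ edg (U ∪ blk a b (-M) (-1))) fun _ => true
    have hw : 0 < w := wt_pos _ _ _
    refine le_of_mul_le_mul_left (h.trans ?_) hw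
    calc _ ≤ 64 * C ^ 8 * (w * z' ^ 2) := by
          gcongr
          exact wt_le_wt_true (by linarith) _ _
      _ = _ := by ring
  have h2 : z ≤ 8 * C ^ 4 * z' := le_of_sq_le_sq h1 (by positivity)
  have hloc : LocalOn ({0, (k : ℤ)} : Finset ℤ) fun η => sval (η 0) * sval (η k) :=
    fun η η' h => by
      have e0 := h 0 (by simp)
      have e1 := h k (by simp)
      simp only [e0, e1]
  refine ge_of_tendsto (tendsto_boxAv hμp hloc) ?_
  filter_upwards [eventually_ge_atTop (a.natAbs + b.natAbs + M.natAbs)] with n hn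
  have hΛ : dualBlk a b M ⊆ box n := by
    intro x hx
    rw [mem_dualBlk] at hx
    rw [box, Finset.mem_product, Finset.mem_Icc, Finset.mem_Icc]
    omega
  have h3 := zf_minus_line_le hβ (a := a) (b := b) (M := M) (k := k) (by omega) (by omega) hM hΛ
  rw [div_le_iff₀ (by positivity)]
  refine le_of_mul_le_mul_right ?_ hz0
  calc 1 * z ≤ 8 * C ^ 4 * z' := by rw [one_mul]; exact h2
    _ ≤ 8 * C ^ 4 * (boxAv β n (fun σ => sval (lineProj σ 0) * sval (lineProj σ k)) * z) := by
        gcongr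
        exact h3
    _ = _ := by ring

end LongRangeOrder

section MeanSpin

lemma integral_shift {ν : Measure (ZSeq Bool)} (hν : ν.map shiftSeq = ν) (n : ℕ)
    {f : ZSeq Bool → ℝ} (hf : Measurable f) :
    ∫ η, f (fun i => η (i + n)) ∂ν = ∫ η, f η ∂ν := by
  have hm : Measurable (shiftSeq : ZSeq Bool → ZSeq Bool) :=
    measurable_pi_lambda _ fun i => measurable_pi_apply (i + 1)
  induction n with
  | zero => simp
  | succ n ih =>
    have hm' : Measurable fun η : ZSeq Bool => f fun i => η (i + n) :=
      hf.comp (measurable_pi_lambda _ fun i => measurable_pi_apply (i + (n : ℤ)))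
    conv_rhs => rw [← ih, ← hν, integral_map hm.aemeasurable hm'.aestronglyMeasurable]
    refine integral_congr_ae (Eventually.of_forall fun η => ?_)
    dsimp only
    congr 1
    funext i
    rw [shiftSeq]
    congr 1
    push_cast
    ring

/-- The average spin over `[0, k)`. -/
noncomputable def meanSpin (k : ℕ) (η : ZSeq Bool) : ℝ := (∑ i ∈ Finset.range k, sval (η i)) / k

lemma localOn_meanSpin (k : ℕ) : LocalOn (Finset.Ico 0 (k : ℤ)) (meanSpin k) := by
  intro η η' h
  rw [meanSpin, meanSpin, Finset.sum_congr rfl fun i hi => ?_]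
  rw [h i (Finset.mem_Ico.2 ⟨by omega, by simpa using hi⟩)]

lemma localOn_meanSpin_sq (k : ℕ) :
    LocalOn (Finset.Ico 0 (k : ℤ)) fun η => meanSpin k η ^ 2 :=
  fun η η' h => by simp only [localOn_meanSpin k η η' h]

lemma abs_meanSpin_le (k : ℕ) (η : ZSeq Bool) : |meanSpin k η| ≤ 1 := by
  rw [meanSpin, abs_div, Nat.abs_cast]
  refine div_le_one_of_le₀ ((Finset.abs_sum_le_sum_abs _ _).trans ?_) (Nat.cast_nonneg k)
  simp [abs_sval]

lemma meanSpin_flipc (k : ℕ) (η : ZSeq Bool) : meanSpin k (flipc η) = -meanSpin k η := by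
  simp only [meanSpin, flipc, sval_not, Finset.sum_neg_distrib, neg_div]

lemma meanSpin_mono (k : ℕ) : Monotone (meanSpin k) := by
  intro η η' h
  refine div_le_div_of_nonneg_right (Finset.sum_le_sum fun i _ => ?_) (Nat.cast_nonneg k)
  have := h i
  revert this
  cases η i <;> cases η' i <;> simp [sval]

lemma meanSpin_two_mul {k : ℕ} (hk : 1 ≤ k) (η : ZSeq Bool) :
    meanSpin (2 * k) η = (meanSpin k η + meanSpin k fun i => η (i + k)) / 2 := by
  have hk' : (k : ℝ) ≠ 0 := by positivity
  have : ∑ i ∈ Finset.range (2 * k), sval (η i) = ∑ i ∈ Finset.range k, sval (η i) +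
      ∑ i ∈ Finset.range k, sval (η (i + k)) := by
    rw [two_mul, Finset.sum_range_add]
    congr 1
    refine Finset.sum_congr rfl fun i _ => ?_
    push_cast
    rw [add_comm]
  rw [meanSpin, meanSpin, meanSpin, this]
  push_cast
  field_simp

lemma integral_meanSpin_sq_ge {ν : Measure (ZSeq Bool)} [IsProbabilityMeasure ν]
    (hν : ν.map shiftSeq = ν) {c : ℝ} (hc : ∀ k : ℕ, c ≤ ∫ η, sval (η 0) * sval (η k) ∂ν)
    {k : ℕ} (hk : 1 ≤ k) : c ≤ ∫ η, meanSpin k η ^ 2 ∂ν := by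
  have hloc : ∀ i j : ℕ, LocalOn ({(i : ℤ), (j : ℤ)} : Finset ℤ) fun η =>
      sval (η i) * sval (η j) := fun i j η η' h => by
    have e0 := h i (by simp)
    have e1 := h j (by simp)
    simp only [e0, e1]
  have hle : ∀ i j : ℕ, i ≤ j → c ≤ ∫ η, sval (η i) * sval (η j) ∂ν := by
    intro i j hij
    obtain ⟨n, rfl⟩ := Nat.exists_eq_add_of_le hij
    have := integral_shift hν i (hloc 0 n).measurable
    simp only [Nat.cast_zero, zero_add] at this
    rw [add_comm, Nat.cast_add, this]
    exact hc n
  have hall : ∀ i j : ℕ, c ≤ ∫ η, sval (η i) * sval (η j) ∂ν := by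
    intro i j
    rcases le_total i j with h | h
    · exact hle i j h
    · simpa only [mul_comm] using hle j i h
  have hk' : (0 : ℝ) < k := by positivity
  have e : ∀ η, meanSpin k η ^ 2 =
      (∑ i ∈ Finset.range k, ∑ j ∈ Finset.range k, sval (η i) * sval (η j)) / (k : ℝ) ^ 2 := by
    intro η
    rw [meanSpin, div_pow, sq, Finset.sum_mul_sum]
  simp only [e]
  rw [integral_div, integral_finsetSum _ fun i _ => integrable_finsetSum _ fun j _ =>
    (hloc i j).integrable ν, le_div_iff₀ (by positivity)]
  have h1 : ∀ i ∈ Finset.range k, k * c ≤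
      ∫ η, ∑ j ∈ Finset.range k, sval (η i) * sval (η j) ∂ν := by
    intro i _
    rw [integral_finsetSum _ fun j _ => (hloc i j).integrable ν]
    simpa using Finset.card_nsmul_le_sum (Finset.range k) _ c fun j _ => hall i j
  have h2 := Finset.card_nsmul_le_sum (Finset.range k) _ _ h1
  rw [Finset.card_range, nsmul_eq_mul] at h2
  linarith

/-- The indicator that the average spin over `[0, k)` is at most `-a`. -/
noncomputable def lowMean (a : ℝ) (k : ℕ) (η : ZSeq Bool) : ℝ := if meanSpin k η ≤ -a then 1 else 0

lemma lowMean_nonneg (a : ℝ) (k : ℕ) (η : ZSeq Bool) : 0 ≤ lowMean a k η := by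
  rw [lowMean]
  split_ifs <;> norm_num

lemma lowMean_anti (a : ℝ) (k : ℕ) : Antitone (lowMean a k) := by
  intro η η' h
  have := meanSpin_mono k h
  rw [lowMean, lowMean]
  split_ifs
  · exact le_rfl
  · linarith
  · exact zero_le_one
  · exact le_rfl

lemma localOn_lowMean (a : ℝ) (k : ℕ) : LocalOn (Finset.Ico 0 (k : ℤ)) (lowMean a k) :=
  fun η η' h => by rw [lowMean, lowMean, localOn_meanSpin k η η' h]

lemma localOn_lowMean_flipc (a : ℝ) (k : ℕ) :
    LocalOn (Finset.Ico 0 (k : ℤ)) fun η => lowMean a k (flipc η) :=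
  fun η η' h => localOn_lowMean a k _ _ fun i hi => by rw [flipc, flipc, h i hi]

lemma lowMean_flipc (a : ℝ) (k : ℕ) (η : ZSeq Bool) :
    lowMean a k (flipc η) = if a ≤ meanSpin k η then 1 else 0 := by
  simp only [lowMean, meanSpin_flipc, neg_le_neg_iff]

lemma meanSpin_sq_le {a : ℝ} (k : ℕ) (η : ZSeq Bool) :
    meanSpin k η ^ 2 ≤ a ^ 2 + (lowMean a k (flipc η) + lowMean a k η) := by
  have h1 : meanSpin k η ^ 2 ≤ 1 := (sq_le_one_iff_abs_le_one _).2 (abs_meanSpin_le k η)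
  have h2 := sq_nonneg a
  rw [lowMean_flipc, lowMean]
  split_ifs with h h' h'
  · linarith
  · linarith
  · linarith
  · rw [add_zero, add_zero]
    exact sq_le_sq' (by linarith) (by linarith)

lemma meanSpin_two_mul_sq_le {a : ℝ} (ha : 0 ≤ a) {k : ℕ} (hk : 1 ≤ k) (η : ZSeq Bool) :
    meanSpin (2 * k) η ^ 2 ≤ (meanSpin k η ^ 2 + meanSpin k (fun i => η (i + k)) ^ 2) / 2 -
      a ^ 2 * (lowMean a k η * lowMean a k (flipc fun i => η (i + k))) := by
  rw [meanSpin_two_mul hk, lowMean_flipc, lowMean]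
  set x := meanSpin k η
  set y := meanSpin k fun i => η (i + k)
  have h0 : ((x + y) / 2) ^ 2 = (x ^ 2 + y ^ 2) / 2 - ((y - x) / 2) ^ 2 := by ring
  rw [h0]
  refine sub_le_sub_left ?_ _
  split_ifs with h h'
  · rw [mul_one, mul_one]
    exact pow_le_pow_left₀ ha (by linarith) 2
  all_goals simp only [mul_zero, zero_mul]; positivity

lemma integral_lowMean_le_flipc {β : ℝ} (hβ : 0 < β) {μp : Measure Cfg2}
    (hμp : IsPlusPhase β 0 μp) (a : ℝ) (k : ℕ) :
    ∫ η, lowMean a k η ∂(schonmann μp) ≤ ∫ η, lowMean a k (flipc η) ∂(schonmann μp) := by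
  refine le_of_tendsto_of_tendsto' (tendsto_boxAv hμp (localOn_lowMean a k))
    (tendsto_boxAv hμp (localOn_lowMean_flipc a k)) fun n => ?_
  have h := av_le_av_anti (κ := β / 2) (by linarith) (edg (box n)) (Λ := box n) (Λ' := box n)
    (η := fun _ => false) (η' := fun _ => true)
    ⟨fun _ _ h => Bool.noConfusion h, fun _ _ h => Bool.noConfusion h⟩
    (f := fun σ => lowMean a k (lineProj σ)) fun σ σ' h => lowMean_anti a k (lineProj_mono h)
  rw [av_false] at h
  exact h

lemma integral_meanSpin_two_mul_le {ν : Measure (ZSeq Bool)} [IsProbabilityMeasure ν]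
    (hν : ν.map shiftSeq = ν) {C : ℝ} (hC : 0 < C) (hQ : QuasiIndep ν C) {a d : ℝ} (ha : 0 ≤ a)
    {k : ℕ} (hk : 1 ≤ k) (hd : 0 ≤ d) (h1 : d ≤ ∫ η, lowMean a k η ∂ν)
    (h2 : d ≤ ∫ η, lowMean a k (flipc η) ∂ν) :
    ∫ η, meanSpin (2 * k) η ^ 2 ∂ν ≤ ∫ η, meanSpin k η ^ 2 ∂ν - a ^ 2 * (d ^ 2 / C) := by
  set f : ZSeq Bool → ℝ := fun η => lowMean a k (flipc fun i => η (i + k)) with hf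
  set s : ZSeq Bool → ℝ := fun η => meanSpin k (fun i => η (i + k)) ^ 2 with hs
  have hmem : ∀ i ∈ Finset.Ico 0 (k : ℤ), i + k ∈ Finset.Ico (k : ℤ) (2 * k) := fun i hi => by
    rw [Finset.mem_Ico] at *
    omega
  have hfl : LocalOn (Finset.Ico (k : ℤ) (2 * k)) f := fun η η' h =>
    localOn_lowMean_flipc a k _ _ fun i hi => h (i + k) (hmem i hi)
  have hsl : LocalOn (Finset.Ico (k : ℤ) (2 * k)) s := fun η η' h =>
    localOn_meanSpin_sq k _ _ fun i hi => h (i + k) (hmem i hi)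
  have e1 : ∫ η, f η ∂ν = ∫ η, lowMean a k (flipc η) ∂ν :=
    integral_shift hν k (localOn_lowMean_flipc a k).measurable
  have e2 : ∫ η, s η ∂ν = ∫ η, meanSpin k η ^ 2 ∂ν :=
    integral_shift hν k (localOn_meanSpin_sq k).measurable
  have h3 := (hQ.integral_mul (a := 0) (b := k) (d := 2 * k) (by omega) (by omega)
    (localOn_lowMean a k) hfl (lowMean_nonneg a k) fun η => lowMean_nonneg a k _).2
  rw [← e1] at h2
  have h4 : d ^ 2 / C ≤ ∫ η, lowMean a k η * f η ∂ν := by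
    rw [div_le_iff₀ hC, sq, mul_comm _ C]
    exact (mul_le_mul h1 h2 hd (hd.trans h1)).trans h3
  have i1 := (localOn_meanSpin_sq k).integrable ν
  have i2 := hsl.integrable ν
  have i3 : Integrable (fun η => lowMean a k η * f η) ν :=
    (((localOn_lowMean a k).mono Finset.subset_union_left).mul
      (hfl.mono (Finset.subset_union_right (s₁ := Finset.Ico 0 (k : ℤ))))).integrable ν
  have h5 : ∫ η, meanSpin (2 * k) η ^ 2 ∂ν ≤
      ∫ η, ((meanSpin k η ^ 2 + s η) / 2 - a ^ 2 * (lowMean a k η * f η)) ∂ν :=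
    integral_mono ((localOn_meanSpin_sq (2 * k)).integrable ν)
      (((i1.add i2).div_const 2).sub (i3.const_mul (a ^ 2))) (meanSpin_two_mul_sq_le ha hk)
  have e3 : ∫ η, (meanSpin k η ^ 2 + s η) ∂ν = ∫ η, meanSpin k η ^ 2 ∂ν + ∫ η, s η ∂ν :=
    integral_add i1 i2
  have e4 : ∫ η, ((meanSpin k η ^ 2 + s η) / 2 - a ^ 2 * (lowMean a k η * f η)) ∂ν =
      ∫ η, (meanSpin k η ^ 2 + s η) / 2 ∂ν - ∫ η, a ^ 2 * (lowMean a k η * f η) ∂ν :=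
    integral_sub ((i1.add i2).div_const 2) (i3.const_mul (a ^ 2))
  rw [e4, integral_const_mul, integral_div, e3, e2] at h5
  have h6 := mul_le_mul_of_nonneg_left h4 (sq_nonneg a)
  linarith

lemma not_quasiIndep {β : ℝ} (hβ : betaCrit < β) {μp : Measure Cfg2}
    (hμp : IsPlusPhase β 0 μp) (hν : (schonmann μp).map shiftSeq = schonmann μp)
    {C : ℝ} (hC : 1 ≤ C) (hQ : QuasiIndep (schonmann μp) C) : False := by
  have hprob := schonmann_prob hμp
  have hβ0 : 0 < β := betaCrit_pos.trans hβ
  have hC0 : 0 < C := by linarith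
  set c := 1 / (8 * C ^ 4) with hc
  have hc0 : 0 < c := by positivity
  set a := Real.sqrt (c / 2) with ha
  have ha2 : a ^ 2 = c / 2 := Real.sq_sqrt (by positivity)
  set d := c / 2 / (4 * C ^ 4 + 1) with hd
  have hd0 : 0 < d := by positivity
  have hlow : ∀ k : ℕ, 1 ≤ k → d ≤ ∫ η, lowMean a k η ∂(schonmann μp) := by
    intro k hk
    have h1 := integral_meanSpin_sq_ge hν (two_point_ge hβ hμp hC hQ) hk
    have i1 := (localOn_lowMean_flipc a k).integrable (schonmann μp)
    have i2 := (localOn_lowMean a k).integrable (schonmann μp)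
    have h2 := integral_mono ((localOn_meanSpin_sq k).integrable (schonmann μp))
      ((integrable_const (a ^ 2)).add (i1.add i2)) (meanSpin_sq_le k)
    have h3 := integral_flip_le hβ0 hμp hC0.le hQ hk (localOn_lowMean a k) (lowMean_nonneg a k)
      (lowMean_anti a k)
    rw [integral_add' (integrable_const _) (i1.add i2), integral_add' i1 i2, integral_const,
      probReal_univ, one_smul, ha2] at h2
    rw [hd, div_le_iff₀ (by positivity)]
    linarith
  have hstep : ∀ k : ℕ, 1 ≤ k → ∫ η, meanSpin (2 * k) η ^ 2 ∂(schonmann μp) ≤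
      ∫ η, meanSpin k η ^ 2 ∂(schonmann μp) - a ^ 2 * (d ^ 2 / C) := fun k hk =>
    integral_meanSpin_two_mul_le hν hC0 hQ (Real.sqrt_nonneg _) hk hd0.le (hlow k hk)
      ((hlow k hk).trans (integral_lowMean_le_flipc hβ0 hμp a k))
  have hiter : ∀ j : ℕ, ∫ η, meanSpin (2 ^ j) η ^ 2 ∂(schonmann μp) ≤
      ∫ η, meanSpin 1 η ^ 2 ∂(schonmann μp) - j * (a ^ 2 * (d ^ 2 / C)) := by
    intro j
    induction j with
    | zero => simp
    | succ j ih =>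
      have := hstep (2 ^ j) Nat.one_le_two_pow
      rw [pow_succ']
      push_cast
      linarith
  have hδ : 0 < a ^ 2 * (d ^ 2 / C) := by
    rw [ha2]
    positivity
  obtain ⟨j, hj⟩ := exists_nat_gt ((∫ η, meanSpin 1 η ^ 2 ∂(schonmann μp)) /
    (a ^ 2 * (d ^ 2 / C)))
  rw [div_lt_iff₀ hδ] at hj
  have h1 : 0 ≤ ∫ η, meanSpin (2 ^ j) η ^ 2 ∂(schonmann μp) :=
    integral_nonneg fun η => sq_nonneg _
  linarith [hiter j]

end MeanSpin

/-- For `h = 0` and `β > β_c`, no g-function with which the Schonmann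
projection is consistent can have summable variations. -/
theorem schonmann_variations_not_summable
    (β : ℝ) (hβ : betaCrit < β) (μp : Measure Cfg2) (hμp : IsPlusPhase β 0 μp)
    (P : Bool → Past Bool → ℝ) (hP : IsGFunction P)
    (hcons : IsGMeasure (schonmann μp) P) :
    ¬ Summable (fun k : ℕ => varG P (k + 1)) := by
  intro hsum
  have hβ0 : 0 < β := betaCrit_pos.trans hβ
  obtain ⟨C, hC, hQ⟩ := quasi_independence hP hcons (feConst_pos β)
    (fun T x hx g => pr_insert_ge hβ0 hμp hx g) (pr_pos hβ0 hμp) hsum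
  exact not_quasiIndep hβ hμp hcons.2.1 hC hQ
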